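/- Let d ≥ 2 and let t be an integer with 1 ≤ t ≤ d−1. Let P, Q ∈ ℝ[x_1,…,x_d] be polynomials of degree at most δ, each depending non-trivially on every variable x_1,…,x_d. Suppose the pair (P, Q) is NOT a t-additive pair and NOT a t-multiplicative pair. Then there exists a constant c > 0, depending only on δ, d and t, such that for all n ∈ ℕ and all finite sets A_1,…,A_d ⊂ ℝ with |A_i| = n for each i, we have max{|P(A_1,…,A_d)|, |Q(A_1,…,A_d)|} ≥ c · n^{3/2 − 1/2^{t+1}}. -/

import Mathlib

open Polynomial Pointwise

noncomputable section

/-- `p ≡_a q` : there is a nonzero real `λ` with `p(x) = λ q(x)` for all real `x`. -/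
def EquivA (p q : Polynomial ℝ) : Prop :=
  ∃ l : ℝ, l ≠ 0 ∧ ∀ x : ℝ, p.eval x = l * q.eval x

/-- `p ≡_m q` : there is a positive rational `κ` with `|p(x)| = |q(x)|^κ` for all real `x`. -/
def EquivM (p q : Polynomial ℝ) : Prop :=
  ∃ k : ℚ, 0 < k ∧ ∀ x : ℝ, |p.eval x| = |q.eval x| ^ (k : ℝ)

/-- `(P, Q)` is a `t`-additive pair. -/
def TAdditivePair (d t : ℕ) (P Q : MvPolynomial (Fin d) ℝ) : Prop :=
  ∃ (f g : Polynomial ℝ) (u v : Fin d → Polynomial ℝ),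
    0 < f.natDegree ∧ 0 < g.natDegree ∧
    (∀ i, 0 < (u i).natDegree) ∧ (∀ i, 0 < (v i).natDegree) ∧
    (∀ a : Fin d → ℝ, MvPolynomial.eval a P = f.eval (∑ i, (u i).eval (a i))) ∧
    (∀ a : Fin d → ℝ, MvPolynomial.eval a Q = g.eval (∑ i, (v i).eval (a i))) ∧
    ({i : Fin d | ¬ EquivA (u i) (v i)} : Set (Fin d)).ncard < t

/-- `(P, Q)` is a `t`-multiplicative pair. -/
def TMultiplicativePair (d t : ℕ) (P Q : MvPolynomial (Fin d) ℝ) : Prop :=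
  ∃ (f g : Polynomial ℝ) (u v : Fin d → Polynomial ℝ),
    0 < f.natDegree ∧ 0 < g.natDegree ∧
    (∀ i, 0 < (u i).natDegree) ∧ (∀ i, 0 < (v i).natDegree) ∧
    (∀ a : Fin d → ℝ, MvPolynomial.eval a P = f.eval (∏ i, (u i).eval (a i))) ∧
    (∀ a : Fin d → ℝ, MvPolynomial.eval a Q = g.eval (∏ i, (v i).eval (a i))) ∧
    ({i : Fin d | ¬ EquivM (u i) (v i)} : Set (Fin d)).ncard < t

/-! ### General facts on multivariate polynomials -/

theorem coeff_X_mul_pderiv {d : ℕ} (i : Fin d) (P : MvPolynomial (Fin d) ℝ) (m : Fin d →₀ ℕ) :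
    MvPolynomial.coeff m (MvPolynomial.X i * MvPolynomial.pderiv i P)
      = (m i : ℝ) * MvPolynomial.coeff m P := by
  classical
  induction P using MvPolynomial.induction_on' with
  | monomial s a =>
    rw [MvPolynomial.X_mul_pderiv_monomial]
    rw [MvPolynomial.coeff_smul, MvPolynomial.coeff_monomial]
    split_ifs with h
    · subst h; simp
    · simp
  | add p q hp hq =>
    rw [map_add, mul_add, MvPolynomial.coeff_add, hp, hq, MvPolynomial.coeff_add]; ring

theorem degreeOf_X_mul_pderiv_le {d : ℕ} (i j : Fin d) (P : MvPolynomial (Fin d) ℝ) :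
    (MvPolynomial.X i * MvPolynomial.pderiv i P).degreeOf j ≤ P.degreeOf j := by
  rw [MvPolynomial.degreeOf_le_iff]
  intro m hm
  apply MvPolynomial.monomial_le_degreeOf
  rw [MvPolynomial.mem_support_iff, coeff_X_mul_pderiv] at hm
  rw [MvPolynomial.mem_support_iff]
  exact right_ne_zero_of_mul hm

theorem degreeOf_pderiv_of_ne {d : ℕ} {i j : Fin d} (hij : j ≠ i) (P : MvPolynomial (Fin d) ℝ) :
    (MvPolynomial.pderiv i P).degreeOf j ≤ P.degreeOf j := by
  have := degreeOf_X_mul_pderiv_le i j P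
  rwa [mul_comm, MvPolynomial.degreeOf_mul_X_of_ne _ hij] at this

/-- Exact degree of a derivative in characteristic zero. -/
theorem degreeOf_pderiv_self {d : ℕ} {i : Fin d} {P : MvPolynomial (Fin d) ℝ}
    (h : 0 < P.degreeOf i) :
    MvPolynomial.pderiv i P ≠ 0 ∧ (MvPolynomial.pderiv i P).degreeOf i + 1 = P.degreeOf i := by
  obtain ⟨m, hm, hmi⟩ : ∃ m ∈ P.support, m i = P.degreeOf i := by
    have hne : P.support.Nonempty := by
      rw [MvPolynomial.support_nonempty]
      rintro rfl
      simp at h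
    obtain ⟨m, hm, h2⟩ := Finset.exists_mem_eq_sup _ hne (fun m => m i)
    exact ⟨m, hm, by rw [MvPolynomial.degreeOf_eq_sup, h2]⟩
  have hc : MvPolynomial.coeff m (MvPolynomial.X i * MvPolynomial.pderiv i P) ≠ 0 := by
    rw [coeff_X_mul_pderiv]
    refine mul_ne_zero ?_ (MvPolynomial.mem_support_iff.1 hm)
    rw [hmi]; exact_mod_cast h.ne'
  have hne : MvPolynomial.pderiv i P ≠ 0 := by
    intro h0
    rw [h0] at hc; simp at hc
  refine ⟨hne, ?_⟩
  have h1 := degreeOf_X_mul_pderiv_le i i P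
  have h2 : P.degreeOf i ≤ (MvPolynomial.X i * MvPolynomial.pderiv i P).degreeOf i := by
    rw [← hmi]
    exact MvPolynomial.monomial_le_degreeOf i (MvPolynomial.mem_support_iff.2 hc)
  have h3 := MvPolynomial.degreeOf_mul_X_self_pow_eq_add_of_ne_zero i 1 hne
  rw [pow_one, mul_comm] at h3
  omega

theorem pderiv_eq_zero_iff {d : ℕ} {i : Fin d} {P : MvPolynomial (Fin d) ℝ} :
    MvPolynomial.pderiv i P = 0 ↔ P.degreeOf i = 0 := by
  constructor
  · intro h
    by_contra h0
    exact (degreeOf_pderiv_self (Nat.pos_of_ne_zero h0)).1 h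
  · intro h
    apply MvPolynomial.pderiv_eq_zero_of_notMem_vars
    intro hv
    rw [MvPolynomial.vars_def, Multiset.mem_toFinset, ← Multiset.count_pos,
      ← MvPolynomial.degreeOf_def] at hv
    omega

theorem eq_C_of_degreeOf {d : ℕ} {P : MvPolynomial (Fin d) ℝ}
    (h : ∀ i, P.degreeOf i = 0) : ∃ c, P = MvPolynomial.C c := by
  refine ⟨MvPolynomial.coeff 0 P, ?_⟩
  rw [← MvPolynomial.totalDegree_eq_zero_iff_eq_C, MvPolynomial.totalDegree_eq_zero_iff]
  intro m hm i
  have := MvPolynomial.monomial_le_degreeOf i hm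
  rw [h i] at this
  omega

theorem eq_C_of_pderiv {d : ℕ} {P : MvPolynomial (Fin d) ℝ}
    (h : ∀ i, MvPolynomial.pderiv i P = 0) : ∃ c, P = MvPolynomial.C c :=
  eq_C_of_degreeOf fun i => pderiv_eq_zero_iff.1 (h i)

theorem totalDegree_pderiv_lt {d : ℕ} {i : Fin d} {P : MvPolynomial (Fin d) ℝ}
    (h : MvPolynomial.pderiv i P ≠ 0) :
    (MvPolynomial.pderiv i P).totalDegree < P.totalDegree := by
  have hpos : 0 < P.totalDegree := by
    have h1 : P.degreeOf i ≠ 0 := fun h0 => h (pderiv_eq_zero_iff.2 h0)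
    have := MvPolynomial.degreeOf_le_totalDegree P i
    omega
  rw [MvPolynomial.totalDegree, Finset.sup_lt_iff (by simpa using hpos)]
  intro m hm
  rw [MvPolynomial.mem_support_iff, MvPolynomial.coeff_pderiv] at hm
  have h2 : m + Finsupp.single i 1 ∈ P.support :=
    MvPolynomial.mem_support_iff.2 (fun h0 => hm (by simp [h0]))
  have h3 := MvPolynomial.le_totalDegree h2
  rw [Finsupp.sum_add_index' (by simp) (by simp)] at h3
  simp at h3
  exact h3

theorem totalDegree_pderiv_le {d : ℕ} (i : Fin d) (P : MvPolynomial (Fin d) ℝ) :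
    (MvPolynomial.pderiv i P).totalDegree ≤ P.totalDegree := by
  by_cases h : MvPolynomial.pderiv i P = 0
  · simp [h]
  · exact (totalDegree_pderiv_lt h).le

/-- Chain rule. -/
theorem pderiv_aeval_mv {k l : ℕ} (f : Fin k → MvPolynomial (Fin l) ℝ)
    (Φ : MvPolynomial (Fin k) ℝ) (j : Fin l) :
    MvPolynomial.pderiv j (MvPolynomial.aeval f Φ)
      = ∑ i, MvPolynomial.aeval f (MvPolynomial.pderiv i Φ) * MvPolynomial.pderiv j (f i) := by
  induction Φ using MvPolynomial.induction_on with
  | C a => simp [← MvPolynomial.algebraMap_eq]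
  | add p q hp hq => simp only [map_add, hp, hq, add_mul, Finset.sum_add_distrib]
  | mul_X p i hp =>
    rw [map_mul, Derivation.leibniz, hp]
    simp only [MvPolynomial.aeval_X, smul_eq_mul, Derivation.leibniz, MvPolynomial.pderiv_X,
      map_add, map_mul, add_mul, Finset.sum_add_distrib]
    congr 1
    · rw [Finset.sum_eq_single i]
      · simp
      · intro b _ hb
        simp [hb.symm]
      · simp
    · rw [Finset.mul_sum]
      refine Finset.sum_congr rfl fun b _ => ?_
      ring

theorem totalDegree_aeval_le {k l : ℕ} (f : Fin k → MvPolynomial (Fin l) ℝ) (D : ℕ)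
    (hf : ∀ i, (f i).totalDegree ≤ D) (Φ : MvPolynomial (Fin k) ℝ) :
    (MvPolynomial.aeval f Φ).totalDegree ≤ D * Φ.totalDegree := by
  rw [MvPolynomial.aeval_def, MvPolynomial.eval₂_eq]
  apply MvPolynomial.totalDegree_finsetSum_le
  intro m hm
  refine (MvPolynomial.totalDegree_mul _ _).trans ?_
  rw [MvPolynomial.algebraMap_eq, MvPolynomial.totalDegree_C, zero_add]
  refine (MvPolynomial.totalDegree_finsetProd _ _).trans ?_
  have h1 := MvPolynomial.le_totalDegree hm
  calc ∑ i ∈ m.support, (f i ^ m i).totalDegree ≤ ∑ i ∈ m.support, D * m i := by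
        refine Finset.sum_le_sum fun i _ => ?_
        refine (MvPolynomial.totalDegree_pow _ _).trans ?_
        rw [mul_comm]
        exact Nat.mul_le_mul_right _ (hf i)
    _ = D * ∑ i ∈ m.support, m i := by rw [Finset.mul_sum]
    _ ≤ _ := Nat.mul_le_mul_left _ h1

/-- The Jacobian criterion. -/
theorem aeval_ne_zero_of_jacobian {k : ℕ} (f : Fin k → MvPolynomial (Fin k) ℝ)
    (hJ : (Matrix.of fun i j => MvPolynomial.pderiv j (f i)).det ≠ 0) :
    ∀ (D : ℕ) (Φ : MvPolynomial (Fin k) ℝ), Φ.totalDegree ≤ D → MvPolynomial.aeval f Φ = 0 →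
      Φ = 0 := by
  intro D
  induction D using Nat.strong_induction_on with
  | _ D ih =>
    intro Φ hD h0
    have h1 : ∀ i, MvPolynomial.aeval f (MvPolynomial.pderiv i Φ) = 0 := by
      have : (fun i => MvPolynomial.aeval f (MvPolynomial.pderiv i Φ)) = 0 := by
        apply Matrix.eq_zero_of_vecMul_eq_zero hJ
        funext j
        have := pderiv_aeval_mv f Φ j
        rw [h0, map_zero] at this
        simp only [Matrix.vecMul, dotProduct, Matrix.of_apply, Pi.zero_apply]
        exact this.symm
      intro i
      exact congrFun this i
    have h2 : ∀ i, MvPolynomial.pderiv i Φ = 0 := by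
      intro i
      by_contra hne
      have hlt := totalDegree_pderiv_lt hne
      exact hne (ih _ (lt_of_lt_of_le hlt hD) _ le_rfl (h1 i))
    obtain ⟨c, hc⟩ := eq_C_of_pderiv h2
    rw [hc] at h0 ⊢
    rw [← MvPolynomial.algebraMap_eq, AlgHom.commutes, MvPolynomial.algebraMap_eq] at h0
    rw [MvPolynomial.C_eq_zero] at h0
    simp [h0]

/-- The polynomial with coefficients `c e`, for exponents `e : Fin k → Fin N`. -/
def cubePoly {k N : ℕ} (c : (Fin k → Fin N) → ℝ) : MvPolynomial (Fin k) ℝ :=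
  ∑ e, MvPolynomial.monomial (Finsupp.equivFunOnFinite.symm (fun j => ((e j : Fin N) : ℕ))) (c e)

theorem cubePoly_ne_zero {k N : ℕ} (c : (Fin k → Fin N) → ℝ) (hc : c ≠ 0) : cubePoly c ≠ 0 := by
  classical
  obtain ⟨e0, he0⟩ := Function.ne_iff.1 hc
  intro h
  apply he0
  have h1 : MvPolynomial.coeff (Finsupp.equivFunOnFinite.symm (fun j => ((e0 j : Fin N) : ℕ)))
      (cubePoly c) = c e0 := by
    rw [cubePoly, MvPolynomial.coeff_sum, Finset.sum_eq_single e0]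
    · simp
    · intro e _ he
      rw [MvPolynomial.coeff_monomial, if_neg]
      intro h2
      apply he
      funext j
      have := congrFun (Finsupp.equivFunOnFinite.symm.injective h2) j
      exact Fin.ext this
    · simp
  rw [← h1, h]; simp

theorem totalDegree_cubePoly {k N : ℕ} (c : (Fin k → Fin N) → ℝ) :
    (cubePoly c).totalDegree ≤ k * N := by
  apply MvPolynomial.totalDegree_finsetSum_le
  intro e _
  refine (MvPolynomial.totalDegree_monomial_le _ _).trans ?_
  rw [Finsupp.sum_fintype _ _ (by simp)]
  calc _ ≤ ∑ _j : Fin k, N := Finset.sum_le_sum fun j _ => by simp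
    _ = k * N := by simp

theorem eval_cubePoly {k N : ℕ} (c : (Fin k → Fin N) → ℝ) (w : Fin k → ℝ) :
    MvPolynomial.eval w (cubePoly c) = ∑ e, c e * ∏ j, w j ^ ((e j : Fin N) : ℕ) := by
  rw [cubePoly, map_sum]
  refine Finset.sum_congr rfl fun e _ => ?_
  rw [MvPolynomial.eval_monomial, Finsupp.prod_fintype _ _ (by simp)]
  simp

theorem eval_aeval_mv {k l : ℕ} (f : Fin k → MvPolynomial (Fin l) ℝ) (Φ : MvPolynomial (Fin k) ℝ)
    (p : Fin l → ℝ) : MvPolynomial.eval p (MvPolynomial.aeval f Φ)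
      = MvPolynomial.eval (fun i => MvPolynomial.eval p (f i)) Φ := by
  induction Φ using MvPolynomial.induction_on with
  | C a => simp [← MvPolynomial.algebraMap_eq]
  | add p q hp hq => simp only [map_add, hp, hq]
  | mul_X p i hp => simp only [map_mul, hp, MvPolynomial.aeval_X, MvPolynomial.eval_X]

/-- Dimension counting: bounded-degree algebraic dependence. -/
theorem exists_dependence (k δ : ℕ) : ∃ N : ℕ, ∀ f : Fin k → MvPolynomial (Fin k) ℝ,
    (∀ i, (f i).totalDegree ≤ δ) → ∀ i : Fin k,
    ∃ c : Fin N → (Fin k → Fin N) → ℝ, c ≠ 0 ∧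
      ∑ a : Fin N, MvPolynomial.X i ^ (a : ℕ) * MvPolynomial.aeval f (cubePoly (c a)) = 0 := by
  classical
  set B := (1 + k * δ) + 1 with hB
  refine ⟨B ^ k + 1, ?_⟩
  set N := B ^ k + 1 with hN
  intro f hf i
  set M := B * N with hM
  -- the polynomial attached to a coefficient vector
  let T : (Fin N → (Fin k → Fin N) → ℝ) → MvPolynomial (Fin k) ℝ := fun c =>
    ∑ a : Fin N, MvPolynomial.X i ^ (a : ℕ) * MvPolynomial.aeval f (cubePoly (c a))
  have hTev : ∀ c p, MvPolynomial.eval p (T c) = ∑ a, p i ^ ((a : Fin N) : ℕ) *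
      ∑ e, c a e * ∏ j, (MvPolynomial.eval p (f j)) ^ ((e j : Fin N) : ℕ) := by
    intro c p
    simp only [T, map_sum, map_mul, map_pow, MvPolynomial.eval_X, eval_aeval_mv, eval_cubePoly]
  have hTdeg : ∀ c, (T c).totalDegree < M := by
    intro c
    have : (T c).totalDegree ≤ N + δ * (k * N) := by
      apply MvPolynomial.totalDegree_finsetSum_le
      intro a _
      refine (MvPolynomial.totalDegree_mul _ _).trans ?_
      refine add_le_add ?_ ?_
      · rw [MvPolynomial.totalDegree_X_pow]; exact a.2.le
      · refine (totalDegree_aeval_le f δ hf _).trans ?_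
        exact Nat.mul_le_mul_left _ (totalDegree_cubePoly _)
    refine lt_of_le_of_lt this ?_
    rw [hM, hB]
    have : 0 < N := by positivity
    nlinarith
  let L : (Fin N → (Fin k → Fin N) → ℝ) →ₗ[ℝ] ((Fin k → Fin M) → ℝ) :=
    { toFun := fun c g => ∑ a, ((g i : ℕ) : ℝ) ^ ((a : Fin N) : ℕ) *
        ∑ e, c a e * ∏ j, (MvPolynomial.eval (fun l => ((g l : ℕ) : ℝ)) (f j)) ^ ((e j : Fin N) : ℕ)
      map_add' := by
        intro c c'
        funext g
        simp only [Pi.add_apply, add_mul, Finset.sum_add_distrib, mul_add]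
      map_smul' := by
        intro r c
        funext g
        simp only [Pi.smul_apply, smul_eq_mul, RingHom.id_apply, Finset.mul_sum]
        refine Finset.sum_congr rfl fun a _ => Finset.sum_congr rfl fun e _ => ?_
        ring }
  have hker : LinearMap.ker L ≠ ⊥ := by
    apply LinearMap.ker_ne_bot_of_finrank_lt
    have h1 : Module.finrank ℝ ((Fin k → Fin M) → ℝ) = M ^ k := by simp
    have h2 : Module.finrank ℝ (Fin N → (Fin k → Fin N) → ℝ) = N * N ^ k := by
      rw [Module.finrank_pi_fintype]; simp
    rw [h1, h2, hM, mul_pow]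
    apply Nat.mul_lt_mul_of_pos_right
    · omega
    · positivity
  obtain ⟨c, hc, hc0⟩ := (Submodule.ne_bot_iff _).1 hker
  refine ⟨c, hc0, ?_⟩
  change T c = 0
  apply MvPolynomial.eq_zero_of_eval_zero_at_prod_finset (T c)
    (fun _ => (Finset.range M).image (fun n : ℕ => (n : ℝ)))
  · intro l
    rw [Finset.card_image_of_injective _ Nat.cast_injective, Finset.card_range]
    exact lt_of_le_of_lt (MvPolynomial.degreeOf_le_totalDegree _ _) (hTdeg c)
  · intro x hx
    have : ∀ l, ∃ n : Fin M, ((n : ℕ) : ℝ) = x l := by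
      intro l
      obtain ⟨n, hn, h⟩ := Finset.mem_image.1 (hx l)
      exact ⟨⟨n, Finset.mem_range.1 hn⟩, h⟩
    choose g hg using this
    have hx' : x = fun l => ((g l : ℕ) : ℝ) := by funext l; exact (hg l).symm
    have h3 := congrFun (LinearMap.mem_ker.1 hc) g
    rw [hTev, hx']
    exact h3

/-- Elimination: generic fibres of a map with nonzero Jacobian are bounded. -/
theorem elimination (k δ : ℕ) : ∃ D : ℕ, ∀ f : Fin k → MvPolynomial (Fin k) ℝ,
    (∀ i, (f i).totalDegree ≤ δ) →
    (Matrix.of fun i j => MvPolynomial.pderiv j (f i)).det ≠ 0 →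
    ∃ H : MvPolynomial (Fin k) ℝ, H ≠ 0 ∧ H.totalDegree ≤ D ∧
      ∀ (w : Fin k → ℝ) (S : Finset (Fin k → ℝ)),
        (∀ p ∈ S, MvPolynomial.eval p H ≠ 0 ∧ ∀ i, MvPolynomial.eval p (f i) = w i) →
        S.card ≤ D := by
  classical
  obtain ⟨N, hN⟩ := exists_dependence k δ
  refine ⟨k * (δ * (k * N)) + N ^ k, ?_⟩
  intro f hf hJ
  choose c hc0 hc using hN f hf
  have h1 : ∀ i, ∃ a, c i a ≠ 0 := fun i => Function.ne_iff.1 (hc0 i)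
  choose a ha using h1
  refine ⟨∏ i, MvPolynomial.aeval f (cubePoly (c i (a i))), ?_, ?_, ?_⟩
  · rw [Finset.prod_ne_zero_iff]
    intro i _ h0
    exact cubePoly_ne_zero _ (ha i) (aeval_ne_zero_of_jacobian f hJ _ _ le_rfl h0)
  · refine (MvPolynomial.totalDegree_finsetProd _ _).trans ?_
    calc _ ≤ ∑ _i : Fin k, δ * (k * N) := Finset.sum_le_sum fun i _ =>
          (totalDegree_aeval_le f δ hf _).trans (Nat.mul_le_mul_left _ (totalDegree_cubePoly _))
      _ = k * (δ * (k * N)) := by simp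
      _ ≤ _ := Nat.le_add_right _ _
  · intro w S hS
    by_cases hSe : S = ∅
    · simp [hSe]
    obtain ⟨p0, hp0⟩ := Finset.nonempty_iff_ne_empty.2 hSe
    let E : Fin k → ℝ[X] := fun i => ∑ b : Fin N, Polynomial.C (MvPolynomial.eval w
      (cubePoly (c i b))) * Polynomial.X ^ (b : ℕ)
    have hEdeg : ∀ i, (E i).natDegree ≤ N := by
      intro i
      apply Polynomial.natDegree_sum_le_of_forall_le
      intro b _
      refine (Polynomial.natDegree_C_mul_X_pow_le _ _).trans b.2.le
    have hE0 : ∀ i, E i ≠ 0 := by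
      intro i h0
      have h2 : (E i).coeff (a i) = MvPolynomial.eval w (cubePoly (c i (a i))) := by
        simp only [E, Polynomial.finsetSum_coeff, Polynomial.coeff_C_mul, Polynomial.coeff_X_pow]
        rw [Finset.sum_eq_single (a i)]
        · simp
        · intro b _ hb
          rw [if_neg, mul_zero]
          intro h3
          exact hb (Fin.ext h3.symm)
        · simp
      rw [h0, Polynomial.coeff_zero] at h2
      have h3 := (hS p0 hp0).1
      rw [map_prod, Finset.prod_ne_zero_iff] at h3
      apply h3 i (Finset.mem_univ _)
      rw [eval_aeval_mv]
      have : (fun i => MvPolynomial.eval p0 (f i)) = w := funext (hS p0 hp0).2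
      rw [this, ← h2]
    have hsub : S ⊆ Fintype.piFinset fun i => (E i).roots.toFinset := by
      intro p hp
      rw [Fintype.mem_piFinset]
      intro i
      rw [Multiset.mem_toFinset, Polynomial.mem_roots (hE0 i), Polynomial.IsRoot.def]
      have h4 := congrArg (MvPolynomial.eval p) (hc i)
      have : (fun i => MvPolynomial.eval p (f i)) = w := funext (hS p hp).2
      simp only [map_sum, map_mul, map_pow, MvPolynomial.eval_X, eval_aeval_mv, this,
        map_zero] at h4
      simp only [E, Polynomial.eval_finsetSum, Polynomial.eval_mul, Polynomial.eval_C,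
        Polynomial.eval_pow, Polynomial.eval_X]
      rw [← h4]
      exact Finset.sum_congr rfl fun b _ => mul_comm _ _
    calc S.card ≤ _ := Finset.card_le_card hsub
      _ = ∏ i, ((E i).roots.toFinset).card := Fintype.card_piFinset _
      _ ≤ ∏ _i : Fin k, N := Finset.prod_le_prod' fun i _ =>
          (Multiset.toFinset_card_le _).trans ((Polynomial.card_roots' _).trans (hEdeg i))
      _ = N ^ k := by simp
      _ ≤ _ := Nat.le_add_left _ _

theorem det_four_special {R : Type*} [CommRing R] (a1 a2 a3 b1 b2 b3 c1 c2 c3 e1 e2 e3 : R) :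
    Matrix.det !![a1, a2, a3, 0; b1, b2, b3, 0; c1, c2, 0, c3; e1, e2, 0, e3]
      = (b3 * a2 - a3 * b2) * (e3 * c1 - c3 * e1) - (b3 * a1 - a3 * b1) * (e3 * c2 - c3 * e2) := by
  simp [Matrix.det_succ_row_zero, Fin.sum_univ_succ, Fin.succAbove]
  ring

/-- Division of a finite set of reals into cells. -/
theorem exists_cells (U : Finset ℝ) (s : ℕ) (hs : 1 ≤ s) :
    ∃ (cell : ℝ → ℕ) (cuts : Finset ℝ), cuts.card ≤ s ∧
      (∀ u ∈ U, ∀ v ∈ U, (∀ c ∈ cuts, c ≤ u ↔ c ≤ v) → cell u = cell v) ∧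
      ∀ k, (U.filter fun u => cell u = k).card ≤ U.card / s + 1 := by
  classical
  set w := U.card / s + 1 with hw
  have hwpos : 0 < w := Nat.succ_pos _
  have hws : U.card < w * s := by
    rw [hw]
    have h2 := Nat.div_add_mod U.card s
    have h3 := Nat.mod_lt U.card hs
    nlinarith
  let rank : ℝ → ℕ := fun u => (U.filter fun v => v < u).card
  have hmono : ∀ u v, u ≤ v → rank u ≤ rank v := by
    intro u v huv
    apply Finset.card_le_card
    intro x hx
    rw [Finset.mem_filter] at hx ⊢
    exact ⟨hx.1, lt_of_lt_of_le hx.2 huv⟩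
  have hstrict : ∀ u ∈ U, ∀ v, u < v → rank u < rank v := by
    intro u hu v huv
    apply Finset.card_lt_card
    rw [Finset.ssubset_iff_of_subset]
    · exact ⟨u, by simp [hu, huv], by simp⟩
    · intro x hx
      rw [Finset.mem_filter] at hx ⊢
      exact ⟨hx.1, lt_trans hx.2 huv⟩
  have hinj : ∀ u ∈ U, ∀ v ∈ U, rank u = rank v → u = v := by
    intro u hu v hv h
    rcases lt_trichotomy u v with h1 | h1 | h1
    · exact absurd h (hstrict u hu v h1).ne
    · exact h1
    · exact absurd h (hstrict v hv u h1).ne'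
  have hlt : ∀ u ∈ U, rank u < U.card := by
    intro u hu
    apply Finset.card_lt_card
    rw [Finset.ssubset_iff_of_subset (Finset.filter_subset _ _)]
    exact ⟨u, hu, by simp⟩
  have himg : U.image rank = Finset.range U.card := by
    apply Finset.eq_of_subset_of_card_le
    · intro r hr
      obtain ⟨u, hu, rfl⟩ := Finset.mem_image.1 hr
      exact Finset.mem_range.2 (hlt u hu)
    · rw [Finset.card_range, Finset.card_image_of_injOn]
      intro u hu v hv h
      exact hinj u hu v hv h
  refine ⟨fun u => rank u / w, U.filter fun u => w ∣ rank u, ?_, ?_, ?_⟩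
  · calc _ ≤ (Finset.range s).card := by
          apply Finset.card_le_card_of_injOn (fun u => rank u / w)
          · intro u hu
            rw [Finset.mem_coe, Finset.mem_filter] at hu
            rw [Finset.mem_coe, Finset.mem_range]
            exact Nat.div_lt_of_lt_mul ((hlt u hu.1).trans hws)
          · intro u hu v hv h
            rw [Finset.mem_coe, Finset.mem_filter] at hu hv
            apply hinj u hu.1 v hv.1
            rw [← Nat.mul_div_cancel' hu.2, ← Nat.mul_div_cancel' hv.2]
            exact congrArg _ h
      _ = s := Finset.card_range s
  · have key : ∀ u ∈ U, ∀ v ∈ U, (∀ c ∈ U.filter (fun u => w ∣ rank u), c ≤ u ↔ c ≤ v) →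
        rank v / w ≤ rank u / w := by
      intro u hu v hv h
      by_contra hcon
      push Not at hcon
      have h1 : w * (rank v / w) ≤ rank v := Nat.mul_div_le _ _
      have h2 : w * (rank v / w) ∈ U.image rank := by
        rw [himg, Finset.mem_range]
        exact lt_of_le_of_lt h1 (hlt v hv)
      obtain ⟨c, hc, hcr⟩ := Finset.mem_image.1 h2
      have h3 := h c (Finset.mem_filter.2 ⟨hc, hcr ▸ Dvd.intro _ rfl⟩)
      have h4 : c ≤ v := by
        by_contra h5
        have := hstrict v hv c (lt_of_not_ge h5)
        omega
      have h6 := hmono c u (h3.2 h4)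
      rw [hcr] at h6
      have h7 : rank v / w ≤ rank u / w := by
        rw [Nat.le_div_iff_mul_le hwpos, mul_comm]; exact h6
      omega
    intro u hu v hv h
    exact le_antisymm (key v hv u hu fun c hc => (h c hc).symm) (key u hu v hv h)
  · intro k
    calc _ ≤ (Finset.Ico (k * w) (k * w + w)).card := by
          apply Finset.card_le_card_of_injOn rank
          · intro u hu
            rw [Finset.mem_coe, Finset.mem_filter] at hu
            have hk : rank u / w = k := hu.2
            rw [Finset.mem_coe, Finset.mem_Ico, ← hk]
            have := Nat.div_add_mod (rank u) w
            have h2 := Nat.mod_lt (rank u) hwpos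
            rw [mul_comm] at this
            omega
          · intro u hu v hv h
            rw [Finset.mem_coe, Finset.mem_filter] at hu hv
            exact hinj u hu.1 v hv.1 h
      _ = w := by simp

/-- Cauchy-Schwarz for pairs with equal colour. -/
theorem pairs_same_colour (Y : Finset ℝ) (r : ℝ → ℕ) (R : ℕ) (hr : ∀ y ∈ Y, r y < R) :
    Y.card ^ 2 ≤ R * ((Y ×ˢ Y).filter fun q => r q.1 = r q.2).card := by
  classical
  have h1 : Y.card = ∑ k ∈ Finset.range R, (Y.filter fun y => r y = k).card :=
    Finset.card_eq_sum_card_fiberwise fun y hy => by simpa using hr y hy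
  have h2 : ((Y ×ˢ Y).filter fun q => r q.1 = r q.2).card
      = ∑ k ∈ Finset.range R, (Y.filter fun y => r y = k).card ^ 2 := by
    rw [Finset.card_eq_sum_card_fiberwise (f := fun q : ℝ × ℝ => r q.1) (t := Finset.range R)]
    · refine Finset.sum_congr rfl fun k _ => ?_
      rw [sq, ← Finset.card_product]
      congr 1
      ext ⟨a, b⟩
      simp only [Finset.mem_filter, Finset.mem_product]
      constructor
      · rintro ⟨⟨⟨ha, hb⟩, h⟩, h'⟩
        exact ⟨⟨ha, h'⟩, hb, h ▸ h'⟩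
      · rintro ⟨⟨ha, h'⟩, hb, h⟩
        exact ⟨⟨⟨ha, hb⟩, h'.trans h.symm⟩, h'⟩
    · intro q hq
      simp only [Finset.coe_filter, Finset.mem_product, Set.mem_ofPred_eq] at hq
      simpa using hr q.1 hq.1.1
  rw [h2]
  conv_lhs => rw [h1]
  have := sq_sum_le_card_mul_sum_sq (s := Finset.range R)
    (f := fun k => (Y.filter fun y => r y = k).card)
  simpa using this

/-- A polynomial without roots of `p - c` between two points is on the same side of `c`. -/
theorem same_side (p : ℝ[X]) (c : ℝ) (Z : Finset ℝ) (hZ : ∀ z, p.eval z = c → p ≠ C c → z ∈ Z)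
    (y y' : ℝ)
    (h : (Z.filter fun z => z < y).card + (Z.filter fun z => z ≤ y).card
      = (Z.filter fun z => z < y').card + (Z.filter fun z => z ≤ y').card)
    (hy : c ≤ p.eval y) : c ≤ p.eval y' := by
  by_contra hcon
  push Not at hcon
  have hpc : p ≠ C c := by
    rintro rfl
    simp at hcon
  rcases lt_trichotomy y y' with hlt | heq | hlt
  · obtain ⟨z, hz, hzc⟩ := intermediate_value_Icc' hlt.le p.continuous.continuousOn
      (show c ∈ Set.Icc (p.eval y') (p.eval y) from ⟨hcon.le, hy⟩)
    have hz' : z < y' := lt_of_le_of_ne hz.2 (by rintro rfl; exact hcon.ne hzc)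
    have hzZ := hZ z hzc hpc
    have h1 : (Z.filter fun z => z < y).card < (Z.filter fun z => z < y').card := by
      apply Finset.card_lt_card
      rw [Finset.ssubset_iff_of_subset]
      · exact ⟨z, by simp [hzZ, hz'], by simp [hz.1]⟩
      · intro x hx
        rw [Finset.mem_filter] at hx ⊢
        exact ⟨hx.1, hx.2.trans hlt⟩
    have h2 : (Z.filter fun z => z ≤ y).card ≤ (Z.filter fun z => z ≤ y').card := by
      apply Finset.card_le_card
      intro x hx
      rw [Finset.mem_filter] at hx ⊢
      exact ⟨hx.1, hx.2.trans hlt.le⟩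
    omega
  · rw [heq] at hy; linarith
  · obtain ⟨z, hz, hzc⟩ := intermediate_value_Icc hlt.le p.continuous.continuousOn
      (show c ∈ Set.Icc (p.eval y') (p.eval y) from ⟨hcon.le, hy⟩)
    have hz' : y' < z := lt_of_le_of_ne hz.1 (by rintro rfl; exact hcon.ne hzc)
    have hzZ := hZ z hzc hpc
    have h1 : (Z.filter fun z => z ≤ y').card < (Z.filter fun z => z ≤ y).card := by
      apply Finset.card_lt_card
      rw [Finset.ssubset_iff_of_subset]
      · exact ⟨z, by simp [hzZ, hz.2], by simp [hz']⟩
      · intro x hx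
        rw [Finset.mem_filter] at hx ⊢
        exact ⟨hx.1, hx.2.trans hlt.le⟩
    have h2 : (Z.filter fun z => z < y').card ≤ (Z.filter fun z => z < y).card := by
      apply Finset.card_le_card
      intro x hx
      rw [Finset.mem_filter] at hx ⊢
      exact ⟨hx.1, hx.2.trans hlt⟩
    omega

/-- On each curve there are many pairs of points that lie in the same cell. -/
theorem pairs_same_cell (p q : ℝ[X]) (δ s : ℕ) (hp : p.natDegree ≤ δ) (hq : q.natDegree ≤ δ)
    (CU CV : Finset ℝ) (hCU : CU.card ≤ s) (hCV : CV.card ≤ s) (Y : Finset ℝ) :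
    Y.card ^ 2 ≤ (4 * δ * s + 1) * ((Y ×ˢ Y).filter fun z =>
      (∀ c ∈ CU, c ≤ p.eval z.1 ↔ c ≤ p.eval z.2) ∧
      (∀ c ∈ CV, c ≤ q.eval z.1 ↔ c ≤ q.eval z.2)).card := by
  classical
  set Z : Finset ℝ := (CU.biUnion fun c => (p - C c).roots.toFinset) ∪
    (CV.biUnion fun c => (q - C c).roots.toFinset) with hZdef
  have hroots : ∀ (r : ℝ[X]) (c : ℝ), r.natDegree ≤ δ → (r - C c).roots.toFinset.card ≤ δ := by
    intro r c hr
    refine (Multiset.toFinset_card_le _).trans ((Polynomial.card_roots' _).trans ?_)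
    rwa [Polynomial.natDegree_sub_C]
  have hZcard : Z.card ≤ 2 * δ * s := by
    have h1 : (CU.biUnion fun c => (p - C c).roots.toFinset).card ≤ CU.card * δ :=
      Finset.card_biUnion_le_card_mul _ _ _ fun c _ => hroots p c hp
    have h2 : (CV.biUnion fun c => (q - C c).roots.toFinset).card ≤ CV.card * δ :=
      Finset.card_biUnion_le_card_mul _ _ _ fun c _ => hroots q c hq
    have h3 := Finset.card_union_le (CU.biUnion fun c => (p - C c).roots.toFinset)
      (CV.biUnion fun c => (q - C c).roots.toFinset)
    have h4 := Nat.mul_le_mul_right δ hCU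
    have h5 := Nat.mul_le_mul_right δ hCV
    calc Z.card ≤ _ := h3
      _ ≤ s * δ + s * δ := by omega
      _ = 2 * δ * s := by ring
  have hmem : ∀ (r : ℝ[X]) (c z : ℝ), r.eval z = c → r ≠ C c → z ∈ (r - C c).roots.toFinset := by
    intro r c z hz hr
    rw [Multiset.mem_toFinset, Polynomial.mem_roots (sub_ne_zero.2 hr)]
    simp [hz]
  have h1 := pairs_same_colour Y
    (fun y => (Z.filter fun z => z < y).card + (Z.filter fun z => z ≤ y).card) (4 * δ * s + 1) (by
      intro y _
      have h1 := Finset.card_filter_le Z fun z => z < y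
      have h2 := Finset.card_filter_le Z fun z => z ≤ y
      have h3 : 4 * δ * s = 2 * δ * s + 2 * δ * s := by ring
      omega)
  refine h1.trans (Nat.mul_le_mul_left _ (Finset.card_le_card ?_))
  intro z hz
  rw [Finset.mem_filter] at hz ⊢
  refine ⟨hz.1, ?_, ?_⟩
  · intro c hc
    have hZ : ∀ z, p.eval z = c → p ≠ C c → z ∈ Z := fun x hx hne =>
      Finset.mem_union_left _ (Finset.mem_biUnion.2 ⟨c, hc, hmem p c x hx hne⟩)
    exact ⟨same_side p c Z hZ _ _ hz.2, same_side p c Z hZ _ _ hz.2.symm⟩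
  · intro c hc
    have hZ : ∀ z, q.eval z = c → q ≠ C c → z ∈ Z := fun x hx hne =>
      Finset.mem_union_right _ (Finset.mem_biUnion.2 ⟨c, hc, hmem q c x hx hne⟩)
    exact ⟨same_side q c Z hZ _ _ hz.2, same_side q c Z hZ _ _ hz.2.symm⟩

theorem pairs_cell_card (U : Finset ℝ) (cell : ℝ → ℕ) (w : ℕ)
    (h : ∀ k, (U.filter fun u => cell u = k).card ≤ w) :
    ((U ×ˢ U).filter fun z => cell z.1 = cell z.2).card ≤ U.card * w := by
  classical
  rw [Finset.card_eq_sum_card_fiberwise (f := Prod.fst) (t := U)]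
  · rw [← smul_eq_mul, ← Finset.sum_const]
    refine Finset.sum_le_sum fun u hu => (le_trans ?_ (h (cell u)))
    apply Finset.card_le_card_of_injOn Prod.snd
    · intro z hz
      simp only [Finset.coe_filter, Finset.mem_filter, Finset.mem_product, Set.mem_ofPred_eq] at hz ⊢
      exact ⟨hz.1.1.2, by rw [← hz.1.2, hz.2]⟩
    · rintro ⟨a, b⟩ hz ⟨a', b'⟩ hz' heq
      simp only [Finset.coe_filter, Finset.mem_filter, Finset.mem_product, Set.mem_ofPred_eq]
        at hz hz' heq
      rw [hz.2, hz'.2, heq]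
  · intro z hz
    simp only [Finset.coe_filter, Finset.mem_product, Set.mem_ofPred_eq] at hz
    exact hz.1.1

/-- Schwartz-Zippel, real form. -/
theorem sz_real {k : ℕ} (H : MvPolynomial (Fin k) ℝ) (hH : H ≠ 0) (D : ℕ)
    (hD : H.totalDegree ≤ D) (S : Fin k → Finset ℝ) (hS : ∀ i, 0 < (S i).card) :
    (((Fintype.piFinset S).filter fun x => MvPolynomial.eval x H = 0).card : ℝ)
      ≤ (∏ i, ((S i).card : ℝ)) * ∑ i, (D : ℝ) / (S i).card := by
  have h1 := MvPolynomial.schwartz_zippel_sum_degreeOf hH S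
  have h2 : ((((Fintype.piFinset S).filter fun x => MvPolynomial.eval x H = 0).card : ℝ)) /
      (∏ i, ((S i).card : ℝ)) ≤ ∑ i, (H.degreeOf i : ℝ) / (S i).card := by
    have := (NNRat.cast_le (K := ℝ)).2 h1
    push_cast at this
    exact this
  have hpos : (0 : ℝ) < ∏ i, ((S i).card : ℝ) :=
    Finset.prod_pos fun i _ => by exact_mod_cast hS i
  rw [div_le_iff₀ hpos] at h2
  refine h2.trans ?_
  rw [mul_comm]
  refine mul_le_mul_of_nonneg_left ?_ hpos.le
  refine Finset.sum_le_sum fun i _ => ?_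
  have : (H.degreeOf i : ℝ) ≤ D := by
    exact_mod_cast (MvPolynomial.degreeOf_le_totalDegree H i).trans hD
  gcongr

theorem eval_aeval_uni {k : ℕ} (g : Fin k → ℝ[X]) (P : MvPolynomial (Fin k) ℝ) (y : ℝ) :
    (MvPolynomial.aeval g P).eval y = MvPolynomial.eval (fun i => (g i).eval y) P := by
  induction P using MvPolynomial.induction_on with
  | C a => simp [← MvPolynomial.algebraMap_eq]
  | add p q hp hq => simp only [map_add, Polynomial.eval_add, hp, hq]
  | mul_X p i hp =>
    simp only [map_mul, Polynomial.eval_mul, hp, MvPolynomial.aeval_X, MvPolynomial.eval_X]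

theorem natDegree_aeval_uni {k : ℕ} (g : Fin k → ℝ[X]) (hg : ∀ i, (g i).natDegree ≤ 1)
    (P : MvPolynomial (Fin k) ℝ) : (MvPolynomial.aeval g P).natDegree ≤ P.totalDegree := by
  rw [MvPolynomial.aeval_def, MvPolynomial.eval₂_eq]
  apply Polynomial.natDegree_sum_le_of_forall_le
  intro m hm
  refine Polynomial.natDegree_mul_le.trans ?_
  rw [Polynomial.algebraMap_eq, Polynomial.natDegree_C, zero_add]
  refine (Polynomial.natDegree_prod_le _ _).trans ?_
  refine le_trans ?_ (MvPolynomial.le_totalDegree hm)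
  refine Finset.sum_le_sum fun i _ => ?_
  refine Polynomial.natDegree_pow_le.trans ?_
  exact (Nat.mul_le_mul_left _ (hg i)).trans (by simp)

/-- The two-by-two minors used in the core estimate. -/
def minorPoly (F G : MvPolynomial (Fin 3) ℝ) (i : Fin 3) : MvPolynomial (Fin 3) ℝ :=
  MvPolynomial.pderiv 2 G * MvPolynomial.pderiv i F -
    MvPolynomial.pderiv 2 F * MvPolynomial.pderiv i G

/-- The nondegeneracy condition of the core estimate. -/
def Nondeg (F G : MvPolynomial (Fin 3) ℝ) : Prop :=
  ∃ x1 x2 y y' : ℝ,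
    MvPolynomial.eval ![x1, x2, y] (minorPoly F G 0) * MvPolynomial.eval ![x1, x2, y'] (minorPoly F G 1)
    ≠ MvPolynomial.eval ![x1, x2, y'] (minorPoly F G 0) * MvPolynomial.eval ![x1, x2, y] (minorPoly F G 1)

theorem Nondeg.ne_C {F G : MvPolynomial (Fin 3) ℝ} (h : Nondeg F G) (c : ℝ) :
    F - MvPolynomial.C c ≠ 0 ∧ G - MvPolynomial.C c ≠ 0 := by
  obtain ⟨x1, x2, y, y', h⟩ := h
  constructor
  · intro h0
    rw [sub_eq_zero] at h0
    apply h
    simp [minorPoly, h0]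
  · intro h0
    rw [sub_eq_zero] at h0
    apply h
    simp [minorPoly, h0]

/-- The map on quadruples. -/
def quadMap (F G : MvPolynomial (Fin 3) ℝ) : Fin 4 → MvPolynomial (Fin 4) ℝ :=
  ![MvPolynomial.aeval ![MvPolynomial.X 0, MvPolynomial.X 1, MvPolynomial.X 2] F,
    MvPolynomial.aeval ![MvPolynomial.X 0, MvPolynomial.X 1, MvPolynomial.X 2] G,
    MvPolynomial.aeval ![MvPolynomial.X 0, MvPolynomial.X 1, MvPolynomial.X 3] F,
    MvPolynomial.aeval ![MvPolynomial.X 0, MvPolynomial.X 1, MvPolynomial.X 3] G]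

theorem eval_quad2 (F : MvPolynomial (Fin 3) ℝ) (p : Fin 4 → ℝ) :
    MvPolynomial.eval p (MvPolynomial.aeval
      ![(MvPolynomial.X 0 : MvPolynomial (Fin 4) ℝ), MvPolynomial.X 1, MvPolynomial.X 2] F)
      = MvPolynomial.eval ![p 0, p 1, p 2] F := by
  rw [eval_aeval_mv]
  congr 2
  funext i
  fin_cases i <;> simp

theorem eval_quad3 (F : MvPolynomial (Fin 3) ℝ) (p : Fin 4 → ℝ) :
    MvPolynomial.eval p (MvPolynomial.aeval
      ![(MvPolynomial.X 0 : MvPolynomial (Fin 4) ℝ), MvPolynomial.X 1, MvPolynomial.X 3] F)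
      = MvPolynomial.eval ![p 0, p 1, p 3] F := by
  rw [eval_aeval_mv]
  congr 2
  funext i
  fin_cases i <;> simp

theorem quadMap_det (F G : MvPolynomial (Fin 3) ℝ) (h : Nondeg F G) :
    (Matrix.of fun i j => MvPolynomial.pderiv j (quadMap F G i)).det ≠ 0 := by
  obtain ⟨x1, x2, y, y', h⟩ := h
  intro h0
  have h1 := congrArg (MvPolynomial.eval ![x1, x2, y, y']) h0
  rw [RingHom.map_det, map_zero] at h1
  have e2 : ∀ (K : MvPolynomial (Fin 3) ℝ) (j : Fin 4), MvPolynomial.eval ![x1, x2, y, y']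
      (MvPolynomial.pderiv j (MvPolynomial.aeval
      ![(MvPolynomial.X 0 : MvPolynomial (Fin 4) ℝ), MvPolynomial.X 1, MvPolynomial.X 2] K)) =
      ![MvPolynomial.eval ![x1, x2, y] (MvPolynomial.pderiv 0 K),
        MvPolynomial.eval ![x1, x2, y] (MvPolynomial.pderiv 1 K),
        MvPolynomial.eval ![x1, x2, y] (MvPolynomial.pderiv 2 K), 0] j := by
    intro K j
    rw [pderiv_aeval_mv, Fin.sum_univ_three]
    simp only [map_add, map_mul, eval_quad2]
    fin_cases j <;> simp [MvPolynomial.pderiv_X]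
  have e3 : ∀ (K : MvPolynomial (Fin 3) ℝ) (j : Fin 4), MvPolynomial.eval ![x1, x2, y, y']
      (MvPolynomial.pderiv j (MvPolynomial.aeval
      ![(MvPolynomial.X 0 : MvPolynomial (Fin 4) ℝ), MvPolynomial.X 1, MvPolynomial.X 3] K)) =
      ![MvPolynomial.eval ![x1, x2, y'] (MvPolynomial.pderiv 0 K),
        MvPolynomial.eval ![x1, x2, y'] (MvPolynomial.pderiv 1 K), 0,
        MvPolynomial.eval ![x1, x2, y'] (MvPolynomial.pderiv 2 K)] j := by
    intro K j
    rw [pderiv_aeval_mv, Fin.sum_univ_three]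
    simp only [map_add, map_mul, eval_quad3]
    fin_cases j <;> simp [MvPolynomial.pderiv_X]
  have hm : (MvPolynomial.eval ![x1, x2, y, y']).mapMatrix
      (Matrix.of fun i j => MvPolynomial.pderiv j (quadMap F G i)) =
      Matrix.of ![![MvPolynomial.eval ![x1, x2, y] (MvPolynomial.pderiv 0 F),
        MvPolynomial.eval ![x1, x2, y] (MvPolynomial.pderiv 1 F),
        MvPolynomial.eval ![x1, x2, y] (MvPolynomial.pderiv 2 F), 0],
        ![MvPolynomial.eval ![x1, x2, y] (MvPolynomial.pderiv 0 G),
        MvPolynomial.eval ![x1, x2, y] (MvPolynomial.pderiv 1 G),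
        MvPolynomial.eval ![x1, x2, y] (MvPolynomial.pderiv 2 G), 0],
        ![MvPolynomial.eval ![x1, x2, y'] (MvPolynomial.pderiv 0 F),
        MvPolynomial.eval ![x1, x2, y'] (MvPolynomial.pderiv 1 F), 0,
        MvPolynomial.eval ![x1, x2, y'] (MvPolynomial.pderiv 2 F)],
        ![MvPolynomial.eval ![x1, x2, y'] (MvPolynomial.pderiv 0 G),
        MvPolynomial.eval ![x1, x2, y'] (MvPolynomial.pderiv 1 G), 0,
        MvPolynomial.eval ![x1, x2, y'] (MvPolynomial.pderiv 2 G)]] := by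
    ext i j
    rw [RingHom.mapMatrix_apply, Matrix.map_apply, Matrix.of_apply, Matrix.of_apply]
    fin_cases i
    · exact e2 F j
    · exact e2 G j
    · exact e3 F j
    · exact e3 G j
  rw [hm, det_four_special] at h1
  apply h
  simp only [minorPoly, map_sub, map_mul]
  linear_combination -h1

theorem quadMap_deg (F G : MvPolynomial (Fin 3) ℝ) (δ : ℕ) (hF : F.totalDegree ≤ δ)
    (hG : G.totalDegree ≤ δ) (i : Fin 4) : (quadMap F G i).totalDegree ≤ δ := by
  have key : ∀ (K : MvPolynomial (Fin 3) ℝ) (g : Fin 3 → MvPolynomial (Fin 4) ℝ),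
      K.totalDegree ≤ δ → (∀ i, (g i).totalDegree ≤ 1) →
      (MvPolynomial.aeval g K).totalDegree ≤ δ := by
    intro K g hK hg
    exact (totalDegree_aeval_le g 1 hg K).trans (by omega)
  fin_cases i
  all_goals
    refine key _ _ (by assumption) ?_
    intro i
    fin_cases i <;> simp [MvPolynomial.totalDegree_X]

/-- A nonconstant polynomial takes many values on a box. -/
theorem many_values (F : MvPolynomial (Fin 3) ℝ) (δ : ℕ) (hF : F.totalDegree ≤ δ)
    (hc : ∀ c, F - MvPolynomial.C c ≠ 0) (X1 X2 Y U : Finset ℝ) (hY : 0 < Y.card)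
    (h1 : Y.card ≤ δ * X1.card) (h2 : Y.card ≤ δ * X2.card)
    (hU : ∀ x1 ∈ X1, ∀ x2 ∈ X2, ∀ y ∈ Y, MvPolynomial.eval ![x1, x2, y] F ∈ U) :
    Y.card ≤ δ * (2 * δ + 1) * U.card := by
  classical
  have ha : 0 < X1.card := Nat.pos_of_ne_zero (by rintro h; rw [h] at h1; omega)
  have hb : 0 < X2.card := Nat.pos_of_ne_zero (by rintro h; rw [h] at h2; omega)
  set S : Fin 3 → Finset ℝ := ![X1, X2, Y] with hS
  have hSpos : ∀ i, 0 < (S i).card := by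
    intro i; fin_cases i; exacts [ha, hb, hY]
  have hcard : (Fintype.piFinset S).card = X1.card * X2.card * Y.card := by
    rw [Fintype.card_piFinset, Fin.prod_univ_three]; simp [S]
  have hmaps : ∀ x ∈ Fintype.piFinset S, MvPolynomial.eval x F ∈ U := by
    intro x hx
    rw [Fintype.mem_piFinset] at hx
    have hx0 := hU (x 0) (hx 0) (x 1) (hx 1) (x 2) (hx 2)
    have : x = ![x 0, x 1, x 2] := by
      funext i; fin_cases i <;> rfl
    rw [this]; exact hx0
  have hfib : ∀ u ∈ U, (((Fintype.piFinset S).filter fun x => MvPolynomial.eval x F = u).card : ℝ)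
      ≤ (X1.card * X2.card * Y.card : ℝ) * (δ * (2 * δ + 1) / Y.card) := by
    intro u _
    have h3 := sz_real (F - MvPolynomial.C u) (hc u) δ
      ((MvPolynomial.totalDegree_sub_C_le F u).trans hF) S hSpos
    simp only [map_sub, MvPolynomial.eval_C, sub_eq_zero] at h3
    refine h3.trans ?_
    rw [Fin.prod_univ_three, Fin.sum_univ_three]
    simp only [S, Matrix.cons_val_zero, Matrix.cons_val_one, Matrix.cons_val]
    have a1 : (0 : ℝ) < X1.card := by exact_mod_cast ha
    have a2 : (0 : ℝ) < X2.card := by exact_mod_cast hb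
    have a3 : (0 : ℝ) < Y.card := by exact_mod_cast hY
    have b1 : (Y.card : ℝ) ≤ δ * X1.card := by exact_mod_cast h1
    have b2 : (Y.card : ℝ) ≤ δ * X2.card := by exact_mod_cast h2
    have c1 : (δ : ℝ) / X1.card ≤ δ * δ / Y.card := by
      rw [div_le_div_iff₀ a1 a3]
      nlinarith [Nat.cast_nonneg (α := ℝ) δ]
    have c2 : (δ : ℝ) / X2.card ≤ δ * δ / Y.card := by
      rw [div_le_div_iff₀ a2 a3]
      nlinarith [Nat.cast_nonneg (α := ℝ) δ]
    refine mul_le_mul_of_nonneg_left ?_ (by positivity)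
    calc _ ≤ (δ : ℝ) * δ / Y.card + δ * δ / Y.card + δ / Y.card := by gcongr
      _ = _ := by ring
  have hsum : ((Fintype.piFinset S).card : ℝ) ≤
      U.card * ((X1.card * X2.card * Y.card : ℝ) * (δ * (2 * δ + 1) / Y.card)) := by
    rw [Finset.card_eq_sum_card_fiberwise (f := fun x => MvPolynomial.eval x F) (t := U) hmaps]
    push_cast
    refine (Finset.sum_le_sum hfib).trans ?_
    rw [Finset.sum_const, nsmul_eq_mul]
  rw [hcard] at hsum
  push_cast at hsum
  have a1 : (0 : ℝ) < X1.card := by exact_mod_cast ha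
  have a2 : (0 : ℝ) < X2.card := by exact_mod_cast hb
  have a3 : (0 : ℝ) < Y.card := by exact_mod_cast hY
  have h5 : (U.card : ℝ) * ((X1.card * X2.card * Y.card : ℝ) * (δ * (2 * δ + 1) / Y.card))
      = (X1.card * X2.card) * (δ * (2 * δ + 1) * U.card) := by
    field_simp
  rw [h5] at hsum
  have h6 := le_of_mul_le_mul_left hsum (by positivity)
  exact_mod_cast h6

/-- Quadruples whose images lie in common cells. -/
def sameQuads (F G : MvPolynomial (Fin 3) ℝ) (X1 X2 Y : Finset ℝ) (cu cv : ℝ → ℕ) :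
    Finset (Fin 4 → ℝ) :=
  (Fintype.piFinset ![X1, X2, Y, Y]).filter fun x =>
    cu (MvPolynomial.eval ![x 0, x 1, x 2] F) = cu (MvPolynomial.eval ![x 0, x 1, x 3] F) ∧
    cv (MvPolynomial.eval ![x 0, x 1, x 2] G) = cv (MvPolynomial.eval ![x 0, x 1, x 3] G)

theorem eval_slice3 (F : MvPolynomial (Fin 3) ℝ) (x1 x2 y : ℝ) :
    (MvPolynomial.aeval ![Polynomial.C x1, Polynomial.C x2, (Polynomial.X : ℝ[X])] F).eval y
      = MvPolynomial.eval ![x1, x2, y] F := by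
  rw [eval_aeval_uni]
  congr 2
  funext i
  fin_cases i <;> simp

theorem natDegree_slice3 (F : MvPolynomial (Fin 3) ℝ) (x1 x2 : ℝ) :
    (MvPolynomial.aeval ![Polynomial.C x1, Polynomial.C x2, (Polynomial.X : ℝ[X])] F).natDegree
      ≤ F.totalDegree := by
  apply natDegree_aeval_uni
  intro i
  fin_cases i <;> simp

theorem sameQuads_lower (F G : MvPolynomial (Fin 3) ℝ) (δ s : ℕ) (hF : F.totalDegree ≤ δ)
    (hG : G.totalDegree ≤ δ) (X1 X2 Y U V : Finset ℝ)
    (hU : ∀ x1 ∈ X1, ∀ x2 ∈ X2, ∀ y ∈ Y, MvPolynomial.eval ![x1, x2, y] F ∈ U)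
    (hV : ∀ x1 ∈ X1, ∀ x2 ∈ X2, ∀ y ∈ Y, MvPolynomial.eval ![x1, x2, y] G ∈ V)
    (cu cv : ℝ → ℕ) (CU CV : Finset ℝ) (hCU : CU.card ≤ s) (hCV : CV.card ≤ s)
    (hcu : ∀ u ∈ U, ∀ v ∈ U, (∀ c ∈ CU, c ≤ u ↔ c ≤ v) → cu u = cu v)
    (hcv : ∀ u ∈ V, ∀ v ∈ V, (∀ c ∈ CV, c ≤ u ↔ c ≤ v) → cv u = cv v) :
    X1.card * X2.card * Y.card ^ 2 ≤ (4 * δ * s + 1) * (sameQuads F G X1 X2 Y cu cv).card := by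
  classical
  have hmaps : ∀ x ∈ sameQuads F G X1 X2 Y cu cv, (x 0, x 1) ∈ X1 ×ˢ X2 := by
    intro x hx
    have h1 := Fintype.mem_piFinset.1 (Finset.mem_filter.1 hx).1
    exact Finset.mem_product.2 ⟨h1 0, h1 1⟩
  rw [Finset.card_eq_sum_card_fiberwise (f := fun x : Fin 4 → ℝ => (x 0, x 1)) (t := X1 ×ˢ X2) hmaps,
    Finset.mul_sum]
  have h0 : X1.card * X2.card * Y.card ^ 2 = ∑ _z ∈ X1 ×ˢ X2, Y.card ^ 2 := by
    rw [Finset.sum_const, Finset.card_product, smul_eq_mul]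
  rw [h0]
  refine Finset.sum_le_sum ?_
  rintro ⟨x1, x2⟩ hx
  rw [Finset.mem_product] at hx
  refine (pairs_same_cell
    (MvPolynomial.aeval ![Polynomial.C x1, Polynomial.C x2, (Polynomial.X : ℝ[X])] F)
    (MvPolynomial.aeval ![Polynomial.C x1, Polynomial.C x2, (Polynomial.X : ℝ[X])] G)
    δ s ((natDegree_slice3 F x1 x2).trans hF) ((natDegree_slice3 G x1 x2).trans hG)
    CU CV hCU hCV Y).trans (Nat.mul_le_mul_left _ ?_)
  simp only [eval_slice3]
  apply Finset.card_le_card_of_injOn (fun z : ℝ × ℝ => ![x1, x2, z.1, z.2])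
  · rintro ⟨y, y'⟩ hz
    rw [Finset.mem_coe, Finset.mem_filter, Finset.mem_product] at hz
    obtain ⟨⟨hy, hy'⟩, h1, h2⟩ := hz
    rw [Finset.mem_coe, Finset.mem_filter]
    refine ⟨Finset.mem_filter.2 ⟨Fintype.mem_piFinset.2 ?_, ?_, ?_⟩, rfl⟩
    · intro i
      fin_cases i
      exacts [hx.1, hx.2, hy, hy']
    · exact hcu _ (hU _ hx.1 _ hx.2 _ hy) _ (hU _ hx.1 _ hx.2 _ hy') h1
    · exact hcv _ (hV _ hx.1 _ hx.2 _ hy) _ (hV _ hx.1 _ hx.2 _ hy') h2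
  · rintro ⟨y, y'⟩ _ ⟨z, z'⟩ _ h
    have h2 := congrFun h 2
    have h3 := congrFun h 3
    exact Prod.ext h2 h3

theorem sameQuads_upper (F G : MvPolynomial (Fin 3) ℝ) (D : ℕ)
    (H : MvPolynomial (Fin 4) ℝ) (hH : H ≠ 0) (hHd : H.totalDegree ≤ D)
    (hfib : ∀ (w : Fin 4 → ℝ) (S : Finset (Fin 4 → ℝ)),
        (∀ p ∈ S, MvPolynomial.eval p H ≠ 0 ∧ ∀ i, MvPolynomial.eval p (quadMap F G i) = w i) →
        S.card ≤ D)
    (c : ℕ) (X1 X2 Y U V : Finset ℝ) (hY : 0 < Y.card)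
    (h1 : Y.card ≤ c * X1.card) (h2 : Y.card ≤ c * X2.card)
    (hU : ∀ x1 ∈ X1, ∀ x2 ∈ X2, ∀ y ∈ Y, MvPolynomial.eval ![x1, x2, y] F ∈ U)
    (hV : ∀ x1 ∈ X1, ∀ x2 ∈ X2, ∀ y ∈ Y, MvPolynomial.eval ![x1, x2, y] G ∈ V)
    (cu cv : ℝ → ℕ) (wu wv : ℕ)
    (hwu : ∀ k, (U.filter fun u => cu u = k).card ≤ wu)
    (hwv : ∀ k, (V.filter fun u => cv u = k).card ≤ wv) :
    ((sameQuads F G X1 X2 Y cu cv).card : ℝ) ≤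
      2 * D * (c + 1) * (X1.card * X2.card * Y.card) + D * ((U.card * wu) * (V.card * wv)) := by
  classical
  have ha : 0 < X1.card := Nat.pos_of_ne_zero (by rintro h; rw [h] at h1; omega)
  have hb : 0 < X2.card := Nat.pos_of_ne_zero (by rintro h; rw [h] at h2; omega)
  set T := sameQuads F G X1 X2 Y cu cv with hT
  rw [← Finset.card_filter_add_card_filter_not (s := T) (fun x => MvPolynomial.eval x H = 0)]
  push_cast
  refine add_le_add ?_ ?_
  · have hSpos : ∀ i, 0 < ((![X1, X2, Y, Y] : Fin 4 → Finset ℝ) i).card := by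
      intro i; fin_cases i; exacts [ha, hb, hY, hY]
    have h3 := sz_real H hH D hHd ![X1, X2, Y, Y] hSpos
    have h4 : ((T.filter fun x => MvPolynomial.eval x H = 0).card : ℝ) ≤
        (((Fintype.piFinset ![X1, X2, Y, Y]).filter fun x => MvPolynomial.eval x H = 0).card : ℝ) := by
      exact_mod_cast Finset.card_le_card (Finset.filter_subset_filter _ (Finset.filter_subset _ _))
    refine (h4.trans h3).trans ?_
    rw [Fin.prod_univ_four, Fin.sum_univ_four]
    simp only [Matrix.cons_val_zero, Matrix.cons_val_one, Matrix.cons_val]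
    have a1 : (0 : ℝ) < X1.card := by exact_mod_cast ha
    have a2 : (0 : ℝ) < X2.card := by exact_mod_cast hb
    have a3 : (0 : ℝ) < Y.card := by exact_mod_cast hY
    have b1 : (Y.card : ℝ) ≤ c * X1.card := by exact_mod_cast h1
    have b2 : (Y.card : ℝ) ≤ c * X2.card := by exact_mod_cast h2
    have c1 : (D : ℝ) / X1.card ≤ D * c / Y.card := by
      rw [div_le_div_iff₀ a1 a3]
      nlinarith [Nat.cast_nonneg (α := ℝ) D]
    have c2 : (D : ℝ) / X2.card ≤ D * c / Y.card := by
      rw [div_le_div_iff₀ a2 a3]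
      nlinarith [Nat.cast_nonneg (α := ℝ) D]
    calc _ ≤ (X1.card * X2.card * Y.card * Y.card : ℝ) *
            (D * c / Y.card + D * c / Y.card + D / Y.card + D / Y.card) := by gcongr
      _ = _ := by field_simp; ring
  · let φ : (Fin 4 → ℝ) → (ℝ × ℝ) × (ℝ × ℝ) := fun x =>
      ((MvPolynomial.eval ![x 0, x 1, x 2] F, MvPolynomial.eval ![x 0, x 1, x 3] F),
       (MvPolynomial.eval ![x 0, x 1, x 2] G, MvPolynomial.eval ![x 0, x 1, x 3] G))
    have h3 : (T.filter fun x => ¬ MvPolynomial.eval x H = 0).card ≤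
        D * ((T.filter fun x => ¬ MvPolynomial.eval x H = 0).image φ).card := by
      apply Finset.card_le_mul_card_image
      intro w _
      apply hfib ![w.1.1, w.2.1, w.1.2, w.2.2]
      intro p hp
      rw [Finset.mem_filter, Finset.mem_filter] at hp
      refine ⟨hp.1.2, ?_⟩
      have hw := hp.2
      intro i
      fin_cases i
      · exact (eval_quad2 F p).trans (congrArg (fun z => z.1.1) hw)
      · exact (eval_quad2 G p).trans (congrArg (fun z => z.2.1) hw)
      · exact (eval_quad3 F p).trans (congrArg (fun z => z.1.2) hw)
      · exact (eval_quad3 G p).trans (congrArg (fun z => z.2.2) hw)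
    have h4 : ((T.filter fun x => ¬ MvPolynomial.eval x H = 0).image φ).card ≤
        (U.card * wu) * (V.card * wv) := by
      refine le_trans (Finset.card_le_card (t :=
        ((U ×ˢ U).filter fun z => cu z.1 = cu z.2) ×ˢ ((V ×ˢ V).filter fun z => cv z.1 = cv z.2)) ?_) ?_
      · intro w hw
        obtain ⟨x, hx, rfl⟩ := Finset.mem_image.1 hw
        have hx2 := (Finset.mem_filter.1 hx).1
        rw [hT, sameQuads, Finset.mem_filter, Fintype.mem_piFinset] at hx2
        obtain ⟨hm, e1, e2⟩ := hx2
        have m0 : x 0 ∈ X1 := hm 0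
        have m1 : x 1 ∈ X2 := hm 1
        have m2 : x 2 ∈ Y := hm 2
        have m3 : x 3 ∈ Y := hm 3
        rw [Finset.mem_product, Finset.mem_filter, Finset.mem_filter, Finset.mem_product,
          Finset.mem_product]
        exact ⟨⟨⟨hU _ m0 _ m1 _ m2, hU _ m0 _ m1 _ m3⟩, e1⟩,
          ⟨⟨hV _ m0 _ m1 _ m2, hV _ m0 _ m1 _ m3⟩, e2⟩⟩
      · rw [Finset.card_product]
        exact Nat.mul_le_mul (pairs_cell_card U cu wu hwu) (pairs_cell_card V cv wv hwv)
    have h5 := h3.trans (Nat.mul_le_mul_left D h4)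
    exact_mod_cast h5

/-- Arithmetic at the end of the core estimate. -/
theorem core_arith (δ s K L D q a b n μ ν wu wv : ℝ) (hδr : 1 ≤ δ) (hsr : 1 ≤ s) (hq0 : 0 ≤ q)
    (ha0 : 0 ≤ a) (hb0 : 0 ≤ b) (hμ0 : 0 ≤ μ) (hν0 : 0 ≤ ν) (hwu0 : 0 ≤ wu) (hwv0 : 0 ≤ wv)
    (hDr : 0 < D) (hKr : K = 20 * δ * D * (δ + 1)) (hK1 : 1 ≤ K) (hL0 : 0 ≤ L) (hn0 : 0 < n)
    (hlow' : a * b * n ^ 2 ≤ (4 * δ * s + 1) * q)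
    (hup : q ≤ 2 * D * (δ + 1) * (a * b * n) + D * ((μ * wu) * (ν * wv)))
    (hsK : s * K ≤ n) (hwU : wu * n ≤ (2 * K + L) * μ) (hwV : wv * n ≤ (2 * K + L) * ν) :
    a * b * n ^ 3 ≤ 10 * δ * D * (2 * K + L) ^ 2 * (μ * ν) ^ 2 := by
  have hn1 : 4 * δ * s + 1 ≤ 5 * δ * s := by nlinarith
  have e1 : a * b * n ^ 2 ≤ 5 * δ * s * q := hlow'.trans (mul_le_mul_of_nonneg_right hn1 hq0)
  have e2 : a * b * n ^ 2 ≤ 5 * δ * s * (2 * D * (δ + 1) * (a * b * n) + D * ((μ * wu) * (ν * wv))) :=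
    e1.trans (mul_le_mul_of_nonneg_left hup (by positivity))
  have e3 : 5 * δ * s * (2 * D * (δ + 1) * (a * b * n)) ≤ a * b * n ^ 2 / 2 := by
    have : 5 * δ * s * (2 * D * (δ + 1) * (a * b * n)) = (s * K) * (a * b * n) / 2 := by
      rw [hKr]; ring
    rw [this]
    have h5 : (s * K) * (a * b * n) ≤ n * (a * b * n) :=
      mul_le_mul_of_nonneg_right hsK (by positivity)
    nlinarith
  have hsn : s ≤ n := by
    nlinarith
  have e4 : a * b * n ^ 2 ≤ 10 * δ * D * n * ((μ * wu) * (ν * wv)) := by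
    have h5 : 10 * δ * D * s * ((μ * wu) * (ν * wv)) ≤ 10 * δ * D * n * ((μ * wu) * (ν * wv)) := by
      gcongr
    nlinarith
  have e5 : (μ * (wu * n)) * (ν * (wv * n)) ≤
      (μ * ((2 * K + L) * μ)) * (ν * ((2 * K + L) * ν)) := by
    gcongr
  have e6 : (a * b * n ^ 3) * n ≤ (10 * δ * D * (2 * K + L) ^ 2 * (μ * ν) ^ 2) * n := by
    calc (a * b * n ^ 3) * n = (a * b * n ^ 2) * n ^ 2 := by ring
      _ ≤ (10 * δ * D * n * ((μ * wu) * (ν * wv))) * n ^ 2 :=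
          mul_le_mul_of_nonneg_right e4 (by positivity)
      _ = 10 * δ * D * n * ((μ * (wu * n)) * (ν * (wv * n))) := by ring
      _ ≤ 10 * δ * D * n * ((μ * ((2 * K + L) * μ)) * (ν * ((2 * K + L) * ν))) :=
          mul_le_mul_of_nonneg_left e5 (by positivity)
      _ = _ := by ring
  exact le_of_mul_le_mul_right e6 hn0

/-- The core estimate. -/
theorem core (δ : ℕ) (hδ : 1 ≤ δ) : ∃ C : ℝ, 0 < C ∧ ∃ n0 : ℕ, 1 ≤ n0 ∧
    ∀ F G : MvPolynomial (Fin 3) ℝ, F.totalDegree ≤ δ → G.totalDegree ≤ δ → Nondeg F G →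
    ∀ X1 X2 Y U V : Finset ℝ, n0 ≤ Y.card → Y.card ≤ δ * X1.card → Y.card ≤ δ * X2.card →
    (∀ x1 ∈ X1, ∀ x2 ∈ X2, ∀ y ∈ Y, MvPolynomial.eval ![x1, x2, y] F ∈ U) →
    (∀ x1 ∈ X1, ∀ x2 ∈ X2, ∀ y ∈ Y, MvPolynomial.eval ![x1, x2, y] G ∈ V) →
    (X1.card : ℝ) * X2.card * Y.card ^ 3 ≤ C * (U.card * V.card) ^ 2 := by
  obtain ⟨D0, hD0⟩ := elimination 4 δ
  set D := D0 + 1 with hD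
  set K := 20 * δ * D * (δ + 1) with hK
  have hKpos : 1 ≤ K := Nat.one_le_iff_ne_zero.2 (by positivity)
  set L := δ * (2 * δ + 1) with hL
  refine ⟨10 * δ * D * (2 * K + L) ^ 2, by positivity, K, hKpos, ?_⟩
  intro F G hF hG hnd X1 X2 Y U V hn h1 h2 hU hV
  obtain ⟨H, hH, hHd, hfib⟩ := hD0 (quadMap F G) (quadMap_deg F G δ hF hG) (quadMap_det F G hnd)
  have hYpos : 0 < Y.card := by omega
  set s := Y.card / K with hs
  have hs1 : 1 ≤ s := (Nat.one_le_div_iff hKpos).2 hn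
  obtain ⟨cu, CU, hCU, hcu, hwu⟩ := exists_cells U s hs1
  obtain ⟨cv, CV, hCV, hcv, hwv⟩ := exists_cells V s hs1
  have hlow := sameQuads_lower F G δ s hF hG X1 X2 Y U V hU hV cu cv CU CV hCU hCV hcu hcv
  have hup := sameQuads_upper F G D H hH (hHd.trans (Nat.le_succ _))
    (fun w S hS => (hfib w S hS).trans (Nat.le_succ _)) δ X1 X2 Y U V hYpos h1 h2 hU hV cu cv
    _ _ hwu hwv
  have hLU := many_values F δ hF (fun c => (hnd.ne_C c).1) X1 X2 Y U hYpos h1 h2 hU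
  have hLV := many_values G δ hG (fun c => (hnd.ne_C c).2) X1 X2 Y V hYpos h1 h2 hV
  have hn0 : (0 : ℝ) < Y.card := by exact_mod_cast hYpos
  -- bounds on s
  have hsK : (s : ℝ) * K ≤ Y.card := by exact_mod_cast Nat.div_mul_le_self _ _
  have hsK2 : (Y.card : ℝ) ≤ 2 * K * s := by
    have h3 := Nat.div_add_mod Y.card K
    have h4 := Nat.mod_lt Y.card hKpos
    have : Y.card ≤ 2 * K * s := by
      rw [← hs] at h3
      nlinarith
    exact_mod_cast this
  have hspos : (0 : ℝ) < s := by exact_mod_cast hs1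
  have hw : ∀ W : Finset ℝ, Y.card ≤ L * W.card →
      ((W.card / s + 1 : ℕ) : ℝ) * Y.card ≤ (2 * K + L) * W.card := by
    intro W hW
    have hW' : (Y.card : ℝ) ≤ L * W.card := by exact_mod_cast hW
    have h3 : ((W.card / s : ℕ) : ℝ) ≤ W.card / s := Nat.cast_div_le
    push_cast
    have h4 : (W.card : ℝ) / s * Y.card ≤ 2 * K * W.card := by
      rw [div_mul_eq_mul_div, div_le_iff₀ hspos]
      nlinarith [Nat.cast_nonneg (α := ℝ) W.card]
    nlinarith
  have hwU := hw U hLU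
  have hwV := hw V hLV
  set wu : ℝ := ((U.card / s + 1 : ℕ) : ℝ) with hwu'
  set wv : ℝ := ((V.card / s + 1 : ℕ) : ℝ) with hwv'
  have hlow' : (X1.card : ℝ) * X2.card * Y.card ^ 2 ≤
      (4 * δ * s + 1) * ((sameQuads F G X1 X2 Y cu cv).card : ℝ) := by exact_mod_cast hlow
  have hδr : (1 : ℝ) ≤ δ := by exact_mod_cast hδ
  have hsr : (1 : ℝ) ≤ s := by exact_mod_cast hs1
  set q : ℝ := ((sameQuads F G X1 X2 Y cu cv).card : ℝ) with hq
  set a : ℝ := (X1.card : ℝ)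
  set b : ℝ := (X2.card : ℝ)
  set n : ℝ := (Y.card : ℝ)
  set μ : ℝ := (U.card : ℝ)
  set ν : ℝ := (V.card : ℝ)
  have hq0 : 0 ≤ q := Nat.cast_nonneg _
  have ha0 : 0 ≤ a := Nat.cast_nonneg _
  have hb0 : 0 ≤ b := Nat.cast_nonneg _
  have hμ0 : 0 ≤ μ := Nat.cast_nonneg _
  have hν0 : 0 ≤ ν := Nat.cast_nonneg _
  have hwu0 : 0 ≤ wu := Nat.cast_nonneg _
  have hwv0 : 0 ≤ wv := Nat.cast_nonneg _
  have hDr : (0 : ℝ) < D := by positivity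
  have hKr : (K : ℝ) = 20 * δ * D * (δ + 1) := by rw [hK]; push_cast; ring
  have hKr0 : (0 : ℝ) < K := by exact_mod_cast hKpos
  exact core_arith δ s K L D q a b n μ ν wu wv hδr hsr hq0 ha0 hb0 hμ0 hν0 hwu0 hwv0 hDr hKr
    (by exact_mod_cast hKpos) (Nat.cast_nonneg _) hn0 hlow' hup hsK hwU hwV

/-- A univariate polynomial in the variable `x_i`. -/
def atv {d : ℕ} (i : Fin d) : ℝ[X] →ₐ[ℝ] MvPolynomial (Fin d) ℝ :=
  Polynomial.aeval (MvPolynomial.X i)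

theorem eval_atv {d : ℕ} (i : Fin d) (p : ℝ[X]) (x : Fin d → ℝ) :
    MvPolynomial.eval x (atv i p) = p.eval (x i) := by
  unfold atv
  induction p using Polynomial.induction_on' with
  | add p q hp hq => simp only [map_add, hp, hq, Polynomial.eval_add]
  | monomial n a => simp [Polynomial.aeval_monomial]

theorem atv_injective {d : ℕ} (i : Fin d) : Function.Injective (atv i) := by
  rw [injective_iff_map_eq_zero]
  intro p hp
  apply Polynomial.funext
  intro x
  have := eval_atv i p (fun _ => x)
  rw [hp, map_zero] at this
  rw [← this, Polynomial.eval_zero]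

theorem atv_ne_zero {d : ℕ} (i : Fin d) {p : ℝ[X]} (hp : p ≠ 0) : atv i p ≠ 0 := fun h =>
  hp (atv_injective i (by rw [h, map_zero]))

theorem atv_C {d : ℕ} (i : Fin d) (c : ℝ) : atv i (Polynomial.C c) = MvPolynomial.C c := by
  simp [atv, MvPolynomial.algebraMap_eq]

theorem atv_X {d : ℕ} (i : Fin d) : atv i Polynomial.X = MvPolynomial.X i := by
  simp [atv]

theorem pderiv_atv_self {d : ℕ} (i : Fin d) (p : ℝ[X]) :
    MvPolynomial.pderiv i (atv i p) = atv i (derivative p) := by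
  unfold atv
  rw [Derivation.map_aeval, MvPolynomial.pderiv_X_self, smul_eq_mul, mul_one]

theorem pderiv_atv_ne {d : ℕ} {i j : Fin d} (hij : i ≠ j) (p : ℝ[X]) :
    MvPolynomial.pderiv j (atv i p) = 0 := by
  unfold atv
  rw [Derivation.map_aeval, MvPolynomial.pderiv_X_of_ne hij, smul_zero]

theorem degreeOf_atv_ne {d : ℕ} {i j : Fin d} (hij : i ≠ j) (p : ℝ[X]) :
    (atv i p).degreeOf j = 0 := pderiv_eq_zero_iff.1 (pderiv_atv_ne hij p)

theorem degreeOf_atv_self {d : ℕ} (i : Fin d) (p : ℝ[X]) :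
    (atv i p).degreeOf i = p.natDegree := by
  induction hn : p.natDegree using Nat.strong_induction_on generalizing p with
  | _ n ih =>
    rcases Nat.eq_zero_or_pos n with h0 | hpos
    · rw [h0] at hn ⊢
      rw [Polynomial.eq_C_of_natDegree_eq_zero hn, atv_C, MvPolynomial.degreeOf_C]
    · have h1 : (derivative p).natDegree = n - 1 := by
        rw [Polynomial.natDegree_derivative, hn]
      have h2 := ih (n - 1) (by omega) _ h1
      have h3 : derivative p ≠ 0 := by
        intro h
        have := Polynomial.derivative_eq_zero.1 h
        omega
      have h4 : 0 < (atv i p).degreeOf i := by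
        rw [Nat.pos_iff_ne_zero]
        intro h
        apply atv_ne_zero i h3
        rw [← pderiv_atv_self]
        exact pderiv_eq_zero_iff.2 h
      have h5 := (degreeOf_pderiv_self h4).2
      rw [pderiv_atv_self, h2] at h5
      omega

theorem atv_isRelPrime {d : ℕ} {i j : Fin d} (hij : i ≠ j) {p q : ℝ[X]} (hp : p ≠ 0) (hq : q ≠ 0) :
    IsRelPrime (atv i p) (atv j q) := by
  intro h hhp hhq
  have hdeg : ∀ k, h.degreeOf k = 0 := by
    intro k
    by_cases hk : k = i
    · subst hk
      obtain ⟨w, hw⟩ := hhq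
      have hne := atv_ne_zero j hq
      rw [hw] at hne
      have h1 := MvPolynomial.degreeOf_mul_eq (n := k) (left_ne_zero_of_mul hne) (right_ne_zero_of_mul hne)
      rw [← hw, degreeOf_atv_ne (Ne.symm hij)] at h1
      omega
    · obtain ⟨w, hw⟩ := hhp
      have hne := atv_ne_zero i hp
      rw [hw] at hne
      have h1 := MvPolynomial.degreeOf_mul_eq (n := k) (left_ne_zero_of_mul hne) (right_ne_zero_of_mul hne)
      rw [← hw, degreeOf_atv_ne (Ne.symm hk)] at h1
      omega
  obtain ⟨c, hc⟩ := eq_C_of_pderiv (fun k => pderiv_eq_zero_iff.2 (hdeg k))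
  have hne : h ≠ 0 := by
    rintro rfl
    exact atv_ne_zero i hp (zero_dvd_iff.1 hhp)
  have hc0 : c ≠ 0 := by rintro rfl; exact hne (by rw [hc, map_zero])
  rw [hc]
  exact (isUnit_iff_ne_zero.2 hc0).map MvPolynomial.C

theorem pderiv_comm_real {d : ℕ} (i j : Fin d) (P : MvPolynomial (Fin d) ℝ) :
    MvPolynomial.pderiv i (MvPolynomial.pderiv j P) = MvPolynomial.pderiv j (MvPolynomial.pderiv i P) := by
  have h : ⁅(MvPolynomial.pderiv i : Derivation ℝ (MvPolynomial (Fin d) ℝ) (MvPolynomial (Fin d) ℝ)),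
      (MvPolynomial.pderiv j : Derivation ℝ (MvPolynomial (Fin d) ℝ) (MvPolynomial (Fin d) ℝ))⁆ = 0 := by
    apply MvPolynomial.derivation_ext
    intro k
    rw [Derivation.commutator_apply, MvPolynomial.pderiv_X, MvPolynomial.pderiv_X]
    by_cases h1 : k = i <;> by_cases h2 : k = j <;> simp [Pi.single_apply, h1, h2] <;> aesop
  have h2 := DFunLike.congr_fun h P
  rw [Derivation.commutator_apply] at h2
  exact sub_eq_zero.1 h2

/-- `G` is the derivative of `P` along the vector field `b_i/a_i`. -/
def InC {d : ℕ} (a b : Fin d → ℝ[X]) (P G : MvPolynomial (Fin d) ℝ) : Prop :=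
  ∀ i, atv i (b i) * MvPolynomial.pderiv i P = atv i (a i) * G

/-- The symmetric relation. -/
def RelAB {d : ℕ} (a b : Fin d → ℝ[X]) (P : MvPolynomial (Fin d) ℝ) : Prop :=
  ∀ i j, i ≠ j → atv i (b i) * atv j (a j) * MvPolynomial.pderiv i P
    = atv j (b j) * atv i (a i) * MvPolynomial.pderiv j P

section
variable {d : ℕ} {a b : Fin d → ℝ[X]}

theorem RelAB.exists_inC (hd : 2 ≤ d) (ha : ∀ i, a i ≠ 0)
    (hab : ∀ i, IsCoprime (a i) (b i)) {P : MvPolynomial (Fin d) ℝ} (h : RelAB a b P) :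
    ∃ G, InC a b P G := by
  let i0 : Fin d := ⟨0, by omega⟩
  let i1 : Fin d := ⟨1, by omega⟩
  have h01 : i0 ≠ i1 := by simp [i0, i1, Fin.ext_iff]
  have h1 : atv i0 (a i0) ∣ atv i0 (b i0) * (atv i1 (a i1) * MvPolynomial.pderiv i0 P) := by
    rw [← mul_assoc, h i0 i1 h01]
    exact ⟨atv i1 (b i1) * MvPolynomial.pderiv i1 P, by ring⟩
  have h2 : IsCoprime (atv i0 (a i0)) (atv i0 (b i0)) := (hab i0).map (atv i0).toRingHom
  have h3 := h2.dvd_of_dvd_mul_left h1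
  have h4 := (atv_isRelPrime h01 (ha i0) (ha i1)).dvd_of_dvd_mul_left h3
  obtain ⟨G0, hG0⟩ := h4
  refine ⟨atv i0 (b i0) * G0, ?_⟩
  intro j
  by_cases hj : j = i0
  · subst hj
    rw [hG0]; ring
  · have h5 := h i0 j (Ne.symm hj)
    rw [hG0] at h5
    have h6 : atv i0 (a i0) * (atv j (b j) * MvPolynomial.pderiv j P) =
        atv i0 (a i0) * (atv j (a j) * (atv i0 (b i0) * G0)) := by
      linear_combination -h5
    exact mul_left_cancel₀ (atv_ne_zero i0 (ha i0)) h6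

theorem InC.relAB {P G : MvPolynomial (Fin d) ℝ} (h : InC a b P G) : RelAB a b G := by
  intro i j hij
  have h1 := congrArg (MvPolynomial.pderiv i) (h j)
  have h2 := congrArg (MvPolynomial.pderiv j) (h i)
  rw [Derivation.leibniz, Derivation.leibniz, pderiv_atv_ne (Ne.symm hij),
    pderiv_atv_ne (Ne.symm hij)] at h1
  rw [Derivation.leibniz, Derivation.leibniz, pderiv_atv_ne hij, pderiv_atv_ne hij] at h2
  simp only [smul_eq_mul, mul_zero, add_zero] at h1 h2
  have h3 : MvPolynomial.pderiv i (MvPolynomial.pderiv j P)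
      = MvPolynomial.pderiv j (MvPolynomial.pderiv i P) := pderiv_comm_real i j P
  rw [h3] at h1
  linear_combination atv j (b j) * h2 - atv i (b i) * h1

theorem InC.zero_const (hb : ∀ i, b i ≠ 0) {P : MvPolynomial (Fin d) ℝ} (h : InC a b P 0) :
    ∃ c, P = MvPolynomial.C c := by
  apply eq_C_of_pderiv
  intro i
  have := h i
  rw [mul_zero] at this
  exact (mul_eq_zero.1 this).resolve_left (atv_ne_zero i (hb i))

theorem InC.eq_zero_of_degreeOf (ha : ∀ i, a i ≠ 0) {P G : MvPolynomial (Fin d) ℝ}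
    (h : InC a b P G) (i : Fin d) (hi : P.degreeOf i = 0) : G = 0 := by
  have := h i
  rw [pderiv_eq_zero_iff.2 hi, mul_zero] at this
  exact (mul_eq_zero.1 this.symm).resolve_left (atv_ne_zero i (ha i))

theorem InC.degreeOf_eq (ha : ∀ i, a i ≠ 0) (hb : ∀ i, b i ≠ 0) {P G : MvPolynomial (Fin d) ℝ}
    (h : InC a b P G) (i : Fin d) (hi : 0 < P.degreeOf i) :
    (b i).natDegree + P.degreeOf i = (a i).natDegree + G.degreeOf i + 1 ∧ G ≠ 0 := by
  have h1 := degreeOf_pderiv_self hi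
  have hG : G ≠ 0 := by
    rintro rfl
    have := h i
    rw [mul_zero] at this
    exact h1.1 ((mul_eq_zero.1 this).resolve_left (atv_ne_zero i (hb i)))
  have h2 := congrArg (MvPolynomial.degreeOf i) (h i)
  rw [MvPolynomial.degreeOf_mul_eq (atv_ne_zero i (hb i)) h1.1,
    MvPolynomial.degreeOf_mul_eq (atv_ne_zero i (ha i)) hG, degreeOf_atv_self,
    degreeOf_atv_self] at h2
  exact ⟨by omega, hG⟩

theorem InC.natDegree_le (hd : 2 ≤ d) (ha : ∀ i, a i ≠ 0) (hb : ∀ i, b i ≠ 0)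
    {P G : MvPolynomial (Fin d) ℝ}
    (h : InC a b P G) (i : Fin d) (hi : ∀ i, 0 < P.degreeOf i) :
    (b i).natDegree ≤ (a i).natDegree + 1 := by
  obtain ⟨j, hj⟩ : ∃ j : Fin d, j ≠ i := by
    have : Nontrivial (Fin d) := Fin.nontrivial_iff_two_le.2 hd
    exact exists_ne i
  obtain ⟨h1, hG⟩ := h.degreeOf_eq ha hb i (hi i)
  have h2 := degreeOf_pderiv_self (hi j)
  have h3 := congrArg (MvPolynomial.degreeOf i) (h j)
  rw [MvPolynomial.degreeOf_mul_eq (atv_ne_zero j (hb j)) h2.1,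
    MvPolynomial.degreeOf_mul_eq (atv_ne_zero j (ha j)) hG, degreeOf_atv_ne hj,
    degreeOf_atv_ne hj] at h3
  have h4 := degreeOf_pderiv_of_ne (Ne.symm hj) P
  omega

/-- If some exponent drops, then all `b_j` are constant. -/
theorem b_const (hd : 2 ≤ d) (ha : ∀ i, a i ≠ 0) (hb : ∀ i, b i ≠ 0)
    (hab : ∀ i, IsCoprime (a i) (b i)) (i0 : Fin d) (hi0 : (b i0).natDegree ≤ (a i0).natDegree)
    (Q G : MvPolynomial (Fin d) ℝ) (h : InC a b Q G) (hQ : ¬ ∃ c, Q = MvPolynomial.C c) :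
    ∀ j, (b j).natDegree = 0 := by
  induction hn : Q.degreeOf i0 using Nat.strong_induction_on generalizing Q G with
  | _ n ih =>
    have hG : G ≠ 0 := by rintro rfl; exact hQ (h.zero_const hb)
    by_cases hGc : ∃ c, G = MvPolynomial.C c
    · obtain ⟨c, rfl⟩ := hGc
      have hc : c ≠ 0 := by rintro rfl; simp at hG
      intro j
      have h1 : atv j (b j) ∣ atv j (a j) := by
        have h2 : atv j (b j) ∣ atv j (a j) * MvPolynomial.C c := ⟨_, (h j).symm⟩
        exact ((isUnit_iff_ne_zero.2 hc).map MvPolynomial.C).dvd_mul_right.1 h2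
      have h2 : IsCoprime (atv j (a j)) (atv j (b j)) := (hab j).map (atv j).toRingHom
      have h3 : IsUnit (atv j (b j)) := h2.symm.isUnit_of_dvd h1
      obtain ⟨w, hw⟩ := h3.exists_right_inv
      have hw0 : w ≠ 0 := by rintro rfl; simp at hw
      have h4 := congrArg (MvPolynomial.degreeOf j) hw
      rw [MvPolynomial.degreeOf_mul_eq (atv_ne_zero j (hb j)) hw0, degreeOf_atv_self] at h4
      have h5 : (1 : MvPolynomial (Fin d) ℝ).degreeOf j = 0 := by
        rw [← MvPolynomial.C_1, MvPolynomial.degreeOf_C]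
      omega
    · have hpos : 0 < Q.degreeOf i0 := by
        rw [Nat.pos_iff_ne_zero]
        intro h0
        exact hG (h.eq_zero_of_degreeOf ha i0 h0)
      have h1 := (h.degreeOf_eq ha hb i0 hpos).1
      obtain ⟨G', hG'⟩ := h.relAB.exists_inC hd ha hab
      exact ih (G.degreeOf i0) (by omega) G G' hG' hGc rfl

theorem exists_antideriv (p : ℝ[X]) : ∃ q : ℝ[X], derivative q = p := by
  induction p using Polynomial.induction_on' with
  | add p q hp hq =>
    obtain ⟨p', hp⟩ := hp
    obtain ⟨q', hq⟩ := hq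
    exact ⟨p' + q', by rw [derivative_add, hp, hq]⟩
  | monomial n c =>
    refine ⟨monomial (n + 1) (c / (n + 1)), ?_⟩
    rw [derivative_monomial]
    congr 1
    push_cast
    field_simp

theorem pderiv_aeval_poly (i : Fin d) (s : MvPolynomial (Fin d) ℝ) (h : ℝ[X]) :
    MvPolynomial.pderiv i (Polynomial.aeval s h)
      = Polynomial.aeval s (derivative h) * MvPolynomial.pderiv i s := by
  rw [Derivation.map_aeval, smul_eq_mul]

/-- The additive case. -/
theorem additive_case (hd : 2 ≤ d) (ha : ∀ i, a i ≠ 0) (hb : ∀ i, b i ≠ 0)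
    (hab : ∀ i, IsCoprime (a i) (b i)) (hbc : ∀ i, (b i).natDegree = 0) :
    ∃ u : Fin d → ℝ[X], (∀ i, 0 < (u i).natDegree) ∧
      ∀ Q G, InC a b Q G → ∃ f : ℝ[X], Q = Polynomial.aeval (∑ i, atv i (u i)) f := by
  have h1 : ∀ i, ∃ u : ℝ[X], ∃ β : ℝ, β ≠ 0 ∧ b i = Polynomial.C β ∧ Polynomial.C β * derivative u = a i := by
    intro i
    have h2 := Polynomial.eq_C_of_natDegree_eq_zero (hbc i)
    have h3 : (b i).coeff 0 ≠ 0 := by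
      intro h0
      rw [h0, map_zero] at h2
      exact hb i h2
    obtain ⟨q, hq⟩ := exists_antideriv (Polynomial.C ((b i).coeff 0)⁻¹ * a i)
    refine ⟨q, _, h3, h2, ?_⟩
    rw [hq, ← mul_assoc, ← Polynomial.C_mul, mul_inv_cancel₀ h3, Polynomial.C_1, one_mul]
  choose u β hβ hbβ hu using h1
  refine ⟨u, ?_, ?_⟩
  · intro i
    rw [Nat.pos_iff_ne_zero]
    intro h0
    have h1 := hu i
    rw [Polynomial.derivative_of_natDegree_zero h0, mul_zero] at h1
    exact ha i h1.symm
  set s := ∑ i, atv i (u i) with hs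
  have hds : ∀ i, MvPolynomial.pderiv i s = atv i (derivative (u i)) := by
    intro i
    rw [hs, map_sum, Finset.sum_eq_single i, pderiv_atv_self]
    · intro j _ hj
      exact pderiv_atv_ne hj _
    · simp
  let i0 : Fin d := ⟨0, by omega⟩
  intro Q G h
  induction hn : Q.degreeOf i0 using Nat.strong_induction_on generalizing Q G with
  | _ n ih =>
    by_cases hQ : ∃ c, Q = MvPolynomial.C c
    · obtain ⟨c, rfl⟩ := hQ
      exact ⟨Polynomial.C c, by simp [MvPolynomial.algebraMap_eq]⟩
    · have hG : G ≠ 0 := by rintro rfl; exact hQ (h.zero_const hb)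
      have hpos : 0 < Q.degreeOf i0 := by
        rw [Nat.pos_iff_ne_zero]
        intro h0
        exact hG (h.eq_zero_of_degreeOf ha i0 h0)
      have h1 := (h.degreeOf_eq ha hb i0 hpos).1
      rw [hbc] at h1
      obtain ⟨G', hG'⟩ := h.relAB.exists_inC hd ha hab
      obtain ⟨f, hf⟩ := ih (G.degreeOf i0) (by omega) G G' hG' rfl
      obtain ⟨f1, hf1⟩ := exists_antideriv f
      have h2 : ∃ c, Q - Polynomial.aeval s f1 = MvPolynomial.C c := by
        apply eq_C_of_pderiv
        intro i
        rw [map_sub, pderiv_aeval_poly, hf1, hds, ← hf]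
        have h3 := h i
        rw [hbβ, ← hu, map_mul, atv_C, mul_assoc] at h3
        have hne : (MvPolynomial.C (β i) : MvPolynomial (Fin d) ℝ) ≠ 0 := by
          rw [Ne, MvPolynomial.C_eq_zero]; exact hβ i
        rw [mul_left_cancel₀ hne h3]
        ring
      obtain ⟨c, hc⟩ := h2
      refine ⟨f1 + Polynomial.C c, ?_⟩
      rw [map_add, Polynomial.aeval_C, MvPolynomial.algebraMap_eq, ← hc]
      ring
end

section
variable {d : ℕ} {a b : Fin d → ℝ[X]}

theorem InC.sub {P G P' G' : MvPolynomial (Fin d) ℝ} (h : InC a b P G) (h' : InC a b P' G') :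
    InC a b (P - P') (G - G') := by
  intro i
  rw [map_sub, mul_sub, mul_sub, h i, h' i]

theorem InC.C_mul (c : ℝ) {P G : MvPolynomial (Fin d) ℝ} (h : InC a b P G) :
    InC a b (MvPolynomial.C c * P) (MvPolynomial.C c * G) := by
  intro i
  rw [MvPolynomial.pderiv_C_mul]
  linear_combination MvPolynomial.C c * h i

theorem InC.sum {ι : Type*} (S : Finset ι) {P G : ι → MvPolynomial (Fin d) ℝ}
    (h : ∀ k ∈ S, InC a b (P k) (G k)) : InC a b (∑ k ∈ S, P k) (∑ k ∈ S, G k) := by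
  intro i
  rw [map_sum, Finset.mul_sum, Finset.mul_sum]
  exact Finset.sum_congr rfl fun k hk => h k hk i

/-- Eigenvectors of the derivation. -/
def Eig (a b : Fin d → ℝ[X]) (κ : ℝ) (k : ℕ) (s : MvPolynomial (Fin d) ℝ) : Prop :=
  InC a b s (MvPolynomial.C (k * κ) * s)

theorem lower_degree (i0 : Fin d) (ha : a i0 ≠ 0) (hdeg : (b i0).natDegree = (a i0).natDegree + 1)
    {P G : MvPolynomial (Fin d) ℝ} (h : InC a b P G) (N : ℕ) (hN : P.degreeOf i0 ≤ N + 1) :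
    (G - MvPolynomial.C (((N + 1 : ℕ) : ℝ) * ((b i0).leadingCoeff / (a i0).leadingCoeff)) * P).degreeOf i0
      ≤ N := by
  set κ := (b i0).leadingCoeff / (a i0).leadingCoeff with hκ
  set P1 := G - MvPolynomial.C (((N + 1 : ℕ) : ℝ) * κ) * P with hP1
  by_cases h0 : P1 = 0
  · rw [h0]; simp
  have hid : MvPolynomial.X i0 * atv i0 (a i0) * P1 =
      atv i0 (b i0) * (MvPolynomial.X i0 * MvPolynomial.pderiv i0 P - MvPolynomial.C ((N + 1 : ℕ) : ℝ) * P)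
      + MvPolynomial.C ((N + 1 : ℕ) : ℝ) * atv i0 (b i0 - Polynomial.C κ * Polynomial.X * a i0) * P := by
    have := h i0
    rw [hP1, map_sub, map_mul (atv i0), map_mul (atv i0), atv_C, atv_X, MvPolynomial.C_mul]
    linear_combination -MvPolynomial.X i0 * this
  have hl : (MvPolynomial.X i0 * atv i0 (a i0) * P1).degreeOf i0 = (b i0).natDegree + P1.degreeOf i0 := by
    rw [← atv_X, ← map_mul, MvPolynomial.degreeOf_mul_eq (atv_ne_zero i0 (mul_ne_zero X_ne_zero ha)) h0,
      degreeOf_atv_self, Polynomial.natDegree_X_mul ha, hdeg]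
  have hr1 : (MvPolynomial.X i0 * MvPolynomial.pderiv i0 P
      - MvPolynomial.C ((N + 1 : ℕ) : ℝ) * P).degreeOf i0 ≤ N := by
    rw [MvPolynomial.degreeOf_le_iff]
    intro m hm
    rw [MvPolynomial.mem_support_iff, MvPolynomial.coeff_sub, coeff_X_mul_pderiv,
      MvPolynomial.coeff_C_mul, ← sub_mul] at hm
    have h1 : m ∈ P.support := MvPolynomial.mem_support_iff.2 (right_ne_zero_of_mul hm)
    have h2 := MvPolynomial.degreeOf_le_iff.1 hN m h1
    have h3 : m i0 ≠ N + 1 := by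
      intro h4
      apply left_ne_zero_of_mul hm
      rw [h4, sub_self]
    omega
  have hr2 : (b i0 - Polynomial.C κ * Polynomial.X * a i0).natDegree ≤ (a i0).natDegree := by
    have hb0 : b i0 ≠ 0 := by intro hb; rw [hb] at hdeg; simp at hdeg
    have hla : (a i0).leadingCoeff ≠ 0 := Polynomial.leadingCoeff_ne_zero.2 ha
    have hlb : (b i0).leadingCoeff ≠ 0 := Polynomial.leadingCoeff_ne_zero.2 hb0
    have hκ0 : κ ≠ 0 := div_ne_zero hlb hla
    rw [mul_assoc]
    have e1 : (Polynomial.C κ * (Polynomial.X * a i0)).natDegree = (a i0).natDegree + 1 := by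
      rw [Polynomial.natDegree_C_mul hκ0, Polynomial.natDegree_X_mul ha]
    have e2 : (Polynomial.C κ * (Polynomial.X * a i0)).leadingCoeff = (b i0).leadingCoeff := by
      rw [Polynomial.leadingCoeff_mul, Polynomial.leadingCoeff_C, Polynomial.leadingCoeff_mul,
        Polynomial.leadingCoeff_X, one_mul, hκ, div_mul_cancel₀ _ hla]
    have hdeg2 : (b i0).degree = (Polynomial.C κ * (Polynomial.X * a i0)).degree := by
      rw [Polynomial.degree_eq_natDegree hb0, Polynomial.degree_eq_natDegree, e1, hdeg]
      exact mul_ne_zero (by simpa using hκ0) (mul_ne_zero X_ne_zero ha)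
    have h5 := Polynomial.degree_sub_lt_left hdeg2 hb0 e2.symm
    by_cases hz : b i0 - Polynomial.C κ * (Polynomial.X * a i0) = 0
    · rw [hz]; simp
    · have h6 := Polynomial.natDegree_lt_natDegree hz h5
      omega
  have h7 := congrArg (MvPolynomial.degreeOf i0) hid
  rw [hl] at h7
  have h8 := MvPolynomial.degreeOf_add_le i0
    (atv i0 (b i0) * (MvPolynomial.X i0 * MvPolynomial.pderiv i0 P - MvPolynomial.C ((N + 1 : ℕ) : ℝ) * P))
    (MvPolynomial.C ((N + 1 : ℕ) : ℝ) * atv i0 (b i0 - Polynomial.C κ * Polynomial.X * a i0) * P)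
  have h9 := MvPolynomial.degreeOf_mul_le i0 (atv i0 (b i0))
    (MvPolynomial.X i0 * MvPolynomial.pderiv i0 P - MvPolynomial.C ((N + 1 : ℕ) : ℝ) * P)
  have h10 := MvPolynomial.degreeOf_mul_le i0
    (MvPolynomial.C ((N + 1 : ℕ) : ℝ) * atv i0 (b i0 - Polynomial.C κ * Polynomial.X * a i0)) P
  have h11 := MvPolynomial.degreeOf_mul_le i0
    (MvPolynomial.C ((N + 1 : ℕ) : ℝ)) (atv i0 (b i0 - Polynomial.C κ * Polynomial.X * a i0))
  rw [MvPolynomial.degreeOf_C, degreeOf_atv_self] at h11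
  rw [degreeOf_atv_self] at h9
  rw [← h7] at h8
  rcases le_max_iff.1 h8 with h12 | h12 <;> omega

theorem eig_decomp (hd : 2 ≤ d) (ha : ∀ i, a i ≠ 0) (hb : ∀ i, b i ≠ 0)
    (hab : ∀ i, IsCoprime (a i) (b i)) (i0 : Fin d)
    (hdeg : (b i0).natDegree = (a i0).natDegree + 1) (N : ℕ) :
    ∀ (P G : MvPolynomial (Fin d) ℝ), InC a b P G → P.degreeOf i0 ≤ N →
    ∃ s : ℕ → MvPolynomial (Fin d) ℝ,
      (∀ k, Eig a b ((b i0).leadingCoeff / (a i0).leadingCoeff) k (s k)) ∧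
      P = ∑ k ∈ Finset.range (N + 1), s k := by
  set κ := (b i0).leadingCoeff / (a i0).leadingCoeff with hκ
  have hκ0 : κ ≠ 0 := div_ne_zero (Polynomial.leadingCoeff_ne_zero.2 (hb i0))
    (Polynomial.leadingCoeff_ne_zero.2 (ha i0))
  induction N with
  | zero =>
    intro P G h hN
    have hG : G = 0 := h.eq_zero_of_degreeOf ha i0 (Nat.le_zero.1 hN)
    subst hG
    refine ⟨fun k => if k = 0 then P else 0, ?_, by simp⟩
    intro k
    by_cases hk : k = 0
    · subst hk
      simpa [Eig] using h
    · simp only [Eig, if_neg hk]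
      intro i; simp
  | succ N ih =>
    intro P G h hN
    have hlow := lower_degree i0 (ha i0) hdeg h N hN
    rw [← hκ] at hlow
    set P1 := G - MvPolynomial.C (((N + 1 : ℕ) : ℝ) * κ) * P with hP1
    obtain ⟨G', hG'⟩ := h.relAB.exists_inC hd ha hab
    have hP1C : InC a b P1 (G' - MvPolynomial.C (((N + 1 : ℕ) : ℝ) * κ) * G) := hG'.sub (h.C_mul _)
    obtain ⟨s, hs, hsum⟩ := ih P1 _ hP1C hlow
    set c : ℕ → ℝ := fun k => 1 / (((k : ℝ) - ((N + 1 : ℕ) : ℝ)) * κ) with hc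
    set P2 := P - ∑ k ∈ Finset.range (N + 1), MvPolynomial.C (c k) * s k with hP2
    refine ⟨fun k => if k = N + 1 then P2 else MvPolynomial.C (c k) * s k, ?_, ?_⟩
    · intro k
      by_cases hk : k = N + 1
      · simp only [if_pos hk]
        have h1 := h.sub (InC.sum (Finset.range (N + 1)) fun k _ => (hs k).C_mul (c k))
        have h2 : MvPolynomial.C ((k : ℝ) * κ) * P2 = G - ∑ k ∈ Finset.range (N + 1),
            MvPolynomial.C (c k) * (MvPolynomial.C (k * κ) * s k) := by
          have h3 : ∑ k ∈ Finset.range (N + 1), MvPolynomial.C (c k) * (MvPolynomial.C (k * κ) * s k)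
              - MvPolynomial.C (((N + 1 : ℕ) : ℝ) * κ) * ∑ k ∈ Finset.range (N + 1), MvPolynomial.C (c k) * s k
              = P1 := by
            rw [hsum, Finset.mul_sum, ← Finset.sum_sub_distrib]
            refine Finset.sum_congr rfl fun k hk => ?_
            have hk' : k < N + 1 := Finset.mem_range.1 hk
            have hne : (k : ℝ) - ((N + 1 : ℕ) : ℝ) ≠ 0 := by
              rw [sub_ne_zero]
              exact_mod_cast hk'.ne
            have h4 : c k * (k * κ) - ((N + 1 : ℕ) : ℝ) * κ * c k = 1 := by
              simp only [hc]
              field_simp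
            calc _ = MvPolynomial.C (c k * (k * κ) - ((N + 1 : ℕ) : ℝ) * κ * c k) * s k := by
                  simp only [map_sub, map_mul]; ring
              _ = s k := by rw [h4, map_one, one_mul]
          rw [hk, hP2]
          rw [hP1] at h3
          linear_combination h3
        unfold Eig
        rw [h2]
        exact h1
      · simp only [if_neg hk]
        unfold Eig
        have h1 := (hs k).C_mul (c k)
        rwa [mul_left_comm] at h1
    · rw [Finset.sum_range_succ, if_pos rfl]
      have : ∑ k ∈ Finset.range (N + 1), (if k = N + 1 then P2 else MvPolynomial.C (c k) * s k)
          = ∑ k ∈ Finset.range (N + 1), MvPolynomial.C (c k) * s k := by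
        refine Finset.sum_congr rfl fun k hk => if_neg ?_
        have := Finset.mem_range.1 hk
        omega
      rw [this, hP2]
      ring

/-- Polynomials with equal logarithmic derivatives are proportional. -/
theorem proportional (X Y : MvPolynomial (Fin d) ℝ) (hX : X ≠ 0) (hY : Y ≠ 0)
    (h : ∀ i, Y * MvPolynomial.pderiv i X = X * MvPolynomial.pderiv i Y) :
    ∃ c : ℝ, c ≠ 0 ∧ X = MvPolynomial.C c * Y := by
  obtain ⟨X', Y', D, hrel, hXX, hYY⟩ := UniqueFactorizationMonoid.exists_reduced_factors X hX Y
  have hD : D ≠ 0 := by rintro rfl; apply hX; rw [← hXX, zero_mul]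
  have hX' : X' ≠ 0 := by rintro rfl; apply hX; rw [← hXX, mul_zero]
  have hY' : Y' ≠ 0 := by rintro rfl; apply hY; rw [← hYY, mul_zero]
  have h1 : ∀ i, Y' * MvPolynomial.pderiv i X' = X' * MvPolynomial.pderiv i Y' := by
    intro i
    have := h i
    rw [← hXX, ← hYY, Derivation.leibniz, Derivation.leibniz] at this
    simp only [smul_eq_mul] at this
    have h2 : (D * D) * (Y' * MvPolynomial.pderiv i X') = (D * D) * (X' * MvPolynomial.pderiv i Y') := by
      linear_combination this
    exact mul_left_cancel₀ (mul_ne_zero hD hD) h2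
  have key : ∀ (Z : MvPolynomial (Fin d) ℝ) (i : Fin d), Z ≠ 0 →
      Z ∣ MvPolynomial.pderiv i Z → MvPolynomial.pderiv i Z = 0 := by
    intro Z i hZ hdvd
    by_contra hne
    have hpos : 0 < Z.degreeOf i := Nat.pos_of_ne_zero fun h0 => hne (pderiv_eq_zero_iff.2 h0)
    have h3 := (degreeOf_pderiv_self hpos).2
    obtain ⟨w, hw⟩ := hdvd
    have hw0 : w ≠ 0 := by rintro rfl; rw [mul_zero] at hw; exact hne hw
    have h4 := MvPolynomial.degreeOf_mul_eq (n := i) hZ hw0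
    rw [← hw] at h4
    omega
  have hY2 : ∀ i, MvPolynomial.pderiv i Y' = 0 := fun i =>
    key Y' i hY' (hrel.symm.dvd_of_dvd_mul_left ⟨_, (h1 i).symm⟩)
  have hX2 : ∀ i, MvPolynomial.pderiv i X' = 0 := fun i =>
    key X' i hX' (hrel.dvd_of_dvd_mul_left ⟨_, h1 i⟩)
  obtain ⟨x, hx⟩ := eq_C_of_pderiv hX2
  obtain ⟨y, hy⟩ := eq_C_of_pderiv hY2
  have hx0 : x ≠ 0 := by rintro rfl; apply hX'; rw [hx, map_zero]
  have hy0 : y ≠ 0 := by rintro rfl; apply hY'; rw [hy, map_zero]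
  refine ⟨x / y, div_ne_zero hx0 hy0, ?_⟩
  rw [← hXX, ← hYY, hx, hy]
  have : MvPolynomial.C (σ := Fin d) x = MvPolynomial.C (x / y) * MvPolynomial.C y := by
    rw [← MvPolynomial.C_mul, div_mul_cancel₀ _ hy0]
  rw [this]; ring

theorem Eig.proportional (hb : ∀ i, b i ≠ 0) {κ : ℝ} {k : ℕ} {s t : MvPolynomial (Fin d) ℝ}
    (hs : Eig a b κ k s) (ht : Eig a b κ k t) (hs0 : s ≠ 0) (ht0 : t ≠ 0) :
    ∃ c : ℝ, c ≠ 0 ∧ s = MvPolynomial.C c * t := by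
  apply _root_.proportional s t hs0 ht0
  intro i
  apply mul_left_cancel₀ (atv_ne_zero i (hb i))
  have h1 := hs i
  have h2 := ht i
  linear_combination t * h1 - s * h2

theorem Eig.mul {κ : ℝ} {k l : ℕ} {s t : MvPolynomial (Fin d) ℝ}
    (hs : Eig a b κ k s) (ht : Eig a b κ l t) : Eig a b κ (k + l) (s * t) := by
  intro i
  have h1 := hs i
  have h2 := ht i
  rw [Derivation.leibniz]
  simp only [smul_eq_mul, Nat.cast_add, add_mul, map_add] at *
  linear_combination t * h1 + s * h2

theorem Eig.pow {κ : ℝ} {k : ℕ} {s : MvPolynomial (Fin d) ℝ}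
    (hs : Eig a b κ k s) (q : ℕ) : Eig a b κ (q * k) (s ^ q) := by
  induction q with
  | zero => intro i; simp
  | succ q ih =>
    have := ih.mul hs
    rwa [← pow_succ, show q * k + k = (q + 1) * k by ring] at this

theorem Eig.power_of_min (hb : ∀ i, b i ≠ 0) {κ : ℝ} {g k : ℕ} {s t : MvPolynomial (Fin d) ℝ}
    (hg : 0 < g) (hs : Eig a b κ g s) (hs0 : s ≠ 0)
    (hmin : ∀ r, 0 < r → r < g → ∀ w, Eig a b κ r w → w = 0)
    (ht : Eig a b κ k t) (ht0 : t ≠ 0) : ∃ c : ℝ, t = MvPolynomial.C c * s ^ (k / g) := by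
  set q := k / g with hq
  have h1 : s ^ q ∣ t := by
    rw [← UniqueFactorizationMonoid.pow_dvd_pow_iff_dvd hg.ne']
    have e1 := hs.pow k
    have e2 := ht.pow g
    rw [mul_comm] at e2
    obtain ⟨c, hc0, hc⟩ := e2.proportional hb e1 (pow_ne_zero _ ht0) (pow_ne_zero _ hs0)
    rw [hc, ← pow_mul]
    exact Dvd.dvd.mul_left (pow_dvd_pow _ (by rw [hq]; exact Nat.div_mul_le_self k g)) _
  obtain ⟨w, hw⟩ := h1
  have hw0 : w ≠ 0 := by rintro rfl; rw [mul_zero] at hw; exact ht0 hw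
  have hkq : k = q * g + k % g := by rw [hq, mul_comm]; exact (Nat.div_add_mod k g).symm
  have h2 : Eig a b κ (k % g) w := by
    intro i
    have h3 := ht i
    have h4 := hs.pow q i
    rw [hw, Derivation.leibniz] at h3
    have h5 : ((k : ℕ) : ℝ) = ((q * g : ℕ) : ℝ) + ((k % g : ℕ) : ℝ) := by exact_mod_cast hkq
    rw [h5] at h3
    simp only [smul_eq_mul, add_mul, map_add] at h3
    apply mul_left_cancel₀ (pow_ne_zero q hs0)
    linear_combination h3 - w * h4
  have h3 : k % g = 0 := by
    by_contra hne
    exact hw0 (hmin _ (Nat.pos_of_ne_zero hne) (Nat.mod_lt k hg) w h2)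
  rw [h3] at h2
  have h4 : InC a b w 0 := by simpa [Eig] using h2
  obtain ⟨c, hc⟩ := h4.zero_const hb
  exact ⟨c, by rw [hw, hc, mul_comm]⟩
end

section
variable {d : ℕ}

/-- Restriction of a polynomial to a line parallel to a coordinate axis. -/
def slice (i : Fin d) (p : Fin d → ℝ) : MvPolynomial (Fin d) ℝ →ₐ[ℝ] ℝ[X] :=
  MvPolynomial.aeval (fun j => if j = i then Polynomial.X else Polynomial.C (p j))

theorem eval_slice (i : Fin d) (p : Fin d → ℝ) (P : MvPolynomial (Fin d) ℝ) (y : ℝ) :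
    (slice i p P).eval y = MvPolynomial.eval (Function.update p i y) P := by
  unfold slice
  rw [eval_aeval_uni]
  congr 2
  funext j
  by_cases h : j = i
  · subst h; simp
  · simp [h]

theorem slice_atv (i : Fin d) (p : Fin d → ℝ) (q : ℝ[X]) : slice i p (atv i q) = q := by
  apply Polynomial.funext
  intro y
  rw [eval_slice, eval_atv, Function.update_self]

theorem slice_C (i : Fin d) (p : Fin d → ℝ) (c : ℝ) : slice i p (MvPolynomial.C c) = Polynomial.C c := by
  apply Polynomial.funext
  intro y
  rw [eval_slice, MvPolynomial.eval_C, Polynomial.eval_C]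

theorem derivative_slice (i : Fin d) (p : Fin d → ℝ) (P : MvPolynomial (Fin d) ℝ) :
    derivative (slice i p P) = slice i p (MvPolynomial.pderiv i P) := by
  induction P using MvPolynomial.induction_on with
  | C a => rw [slice_C, MvPolynomial.pderiv_C, map_zero, derivative_C]
  | add p q hp hq => simp only [map_add, hp, hq]
  | mul_X P j hP =>
    rw [map_mul, derivative_mul, hP, Derivation.leibniz, MvPolynomial.pderiv_X]
    simp only [smul_eq_mul, map_add, map_mul]
    have h1 : slice i p (MvPolynomial.X j) = if j = i then Polynomial.X else Polynomial.C (p j) := by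
      simp [slice]
    rw [h1]
    by_cases h : j = i
    · subst h
      simp
      ring
    · have h' : i ≠ j := fun e => h e.symm
      simp [h, Pi.single_apply]
      ring

theorem natDegree_slice_le (i : Fin d) (p : Fin d → ℝ) (P : MvPolynomial (Fin d) ℝ) :
    (slice i p P).natDegree ≤ P.totalDegree := by
  apply natDegree_aeval_uni
  intro j
  by_cases h : j = i <;> simp [h]

theorem exists_eval_ne_zero (P : MvPolynomial (Fin d) ℝ) (hP : P ≠ 0) :
    ∃ x, MvPolynomial.eval x P ≠ 0 := by
  by_contra h
  push Not at h
  exact hP (MvPolynomial.funext fun x => by rw [h x, map_zero])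

variable {a b : Fin d → ℝ[X]}

theorem Eig.product (ha : ∀ i, a i ≠ 0) (hb : ∀ i, b i ≠ 0) {κ : ℝ} (hκ : κ ≠ 0) {g : ℕ} (hg : 0 < g)
    {s : MvPolynomial (Fin d) ℝ} (hs : Eig a b κ g s) (hs0 : s ≠ 0) :
    ∃ (u : Fin d → ℝ[X]) (c : ℝ), (∀ i, 0 < (u i).natDegree) ∧ c ≠ 0 ∧
      s = MvPolynomial.C c * ∏ i, atv i (u i) := by
  obtain ⟨p, hp⟩ := exists_eval_ne_zero s hs0
  set u : Fin d → ℝ[X] := fun i => slice i p s with hu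
  have hu0 : ∀ i, u i ≠ 0 := by
    intro i h0
    have := eval_slice i p s (p i)
    rw [Function.update_eq_self] at this
    apply hp
    rw [← this]
    simp only [hu] at h0
    rw [h0, Polynomial.eval_zero]
  have hdu : ∀ i, b i * derivative (u i) = Polynomial.C (g * κ) * a i * u i := by
    intro i
    have h1 := congrArg (slice i p) (hs i)
    rw [map_mul, map_mul, map_mul, slice_atv, slice_atv, slice_C, ← derivative_slice] at h1
    rw [show derivative (u i) = derivative (slice i p s) from rfl, h1]
    simp only [hu]
    ring
  have hupos : ∀ i, 0 < (u i).natDegree := by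
    intro i
    rw [Nat.pos_iff_ne_zero]
    intro h0
    have h1 := hdu i
    rw [Polynomial.derivative_of_natDegree_zero h0, mul_zero] at h1
    have hne : Polynomial.C ((g : ℝ) * κ) ≠ 0 := by
      rw [Ne, Polynomial.C_eq_zero]
      have : (g : ℝ) ≠ 0 := by exact_mod_cast hg.ne'
      exact mul_ne_zero this hκ
    exact mul_ne_zero (mul_ne_zero hne (ha i)) (hu0 i) h1.symm
  have hprod : Eig a b κ g (∏ i, atv i (u i)) := by
    intro i
    rw [← Finset.mul_prod_erase _ _ (Finset.mem_univ i), Derivation.leibniz]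
    have h1 : MvPolynomial.pderiv i (∏ j ∈ Finset.univ.erase i, atv j (u j)) = 0 := by
      rw [pderiv_eq_zero_iff, MvPolynomial.degreeOf_prod_eq]
      · apply Finset.sum_eq_zero
        intro j hj
        exact degreeOf_atv_ne (Finset.ne_of_mem_erase hj) _
      · intro j _
        exact atv_ne_zero j (hu0 j)
    rw [h1, pderiv_atv_self, smul_zero, zero_add, smul_eq_mul]
    have h2 := congrArg (atv i) (hdu i)
    rw [map_mul, map_mul, map_mul, atv_C] at h2
    linear_combination (∏ j ∈ Finset.univ.erase i, atv j (u j)) * h2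
  obtain ⟨c, hc0, hc⟩ := hs.proportional hb hprod hs0
    (Finset.prod_ne_zero_iff.2 fun i _ => atv_ne_zero i (hu0 i))
  exact ⟨u, c, hupos, hc0, hc⟩

theorem multiplicative_case (hd : 2 ≤ d) (ha : ∀ i, a i ≠ 0) (hb : ∀ i, b i ≠ 0)
    (hab : ∀ i, IsCoprime (a i) (b i)) (i0 : Fin d)
    (hdeg : (b i0).natDegree = (a i0).natDegree + 1) (P G : MvPolynomial (Fin d) ℝ)
    (h : InC a b P G) (hP : ¬ ∃ c, P = MvPolynomial.C c) :
    ∃ (f : ℝ[X]) (u : Fin d → ℝ[X]), (∀ i, 0 < (u i).natDegree) ∧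
      P = Polynomial.aeval (∏ i, atv i (u i)) f := by
  classical
  obtain ⟨s, hs, hsum⟩ := eig_decomp hd ha hb hab i0 hdeg _ P G h le_rfl
  set κ := (b i0).leadingCoeff / (a i0).leadingCoeff with hκ
  have hκ0 : κ ≠ 0 := div_ne_zero (Polynomial.leadingCoeff_ne_zero.2 (hb i0))
    (Polynomial.leadingCoeff_ne_zero.2 (ha i0))
  have hex : ∃ k, 0 < k ∧ ∃ w, Eig a b κ k w ∧ w ≠ 0 := by
    by_contra hcon
    push Not at hcon
    apply hP
    have h0 : InC a b (s 0) 0 := by simpa [Eig] using hs 0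
    obtain ⟨c, hc⟩ := h0.zero_const hb
    refine ⟨c, ?_⟩
    rw [hsum, Finset.sum_eq_single 0, hc]
    · intro k _ hk
      exact hcon k (Nat.pos_of_ne_zero hk) _ (hs k)
    · simp
  set g := Nat.find hex with hg
  obtain ⟨hgpos, w, hw, hw0⟩ := Nat.find_spec hex
  rw [← hg] at hgpos hw
  have hmin : ∀ r, 0 < r → r < g → ∀ w, Eig a b κ r w → w = 0 := by
    intro r hr hrg w' hw'
    by_contra hne
    exact Nat.find_min hex hrg ⟨hr, w', hw', hne⟩
  have hk : ∀ k, ∃ c : ℝ, s k = MvPolynomial.C c * w ^ (k / g) := by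
    intro k
    by_cases h0 : s k = 0
    · exact ⟨0, by rw [h0, map_zero, zero_mul]⟩
    · exact Eig.power_of_min hb hgpos hw hw0 hmin (hs k) h0
  choose c hc using hk
  obtain ⟨u, c1, hupos, hc1, hwu⟩ := hw.product ha hb hκ0 hgpos hw0
  refine ⟨∑ k ∈ Finset.range (P.degreeOf i0 + 1),
    Polynomial.C (c k) * (Polynomial.C c1 * Polynomial.X) ^ (k / g), u, hupos, ?_⟩
  conv_lhs => rw [hsum]
  rw [map_sum]
  refine Finset.sum_congr rfl fun k _ => ?_
  rw [hc k, hwu]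
  simp [MvPolynomial.algebraMap_eq]

/-- The structure theorem. -/
theorem structure_thm (hd : 2 ≤ d) (P : MvPolynomial (Fin d) ℝ) (hP : ∀ i, 1 ≤ P.degreeOf i)
    (a b : Fin d → ℝ[X]) (ha : ∀ i, a i ≠ 0) (hb : ∀ i, b i ≠ 0) (h : RelAB a b P) :
    ∃ (f : ℝ[X]) (u : Fin d → ℝ[X]), (∀ i, 0 < (u i).natDegree) ∧
      (P = Polynomial.aeval (∑ i, atv i (u i)) f ∨ P = Polynomial.aeval (∏ i, atv i (u i)) f) := by
  have h1 : ∀ i, ∃ a' b' g : ℝ[X], g ≠ 0 ∧ a i = g * a' ∧ b i = g * b' ∧ IsCoprime a' b' := by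
    intro i
    have h2 : EuclideanDomain.gcd (a i) (b i) ≠ 0 := by
      rw [Ne, EuclideanDomain.gcd_eq_zero_iff]
      exact fun h => ha i h.1
    obtain ⟨a', ha'⟩ := EuclideanDomain.gcd_dvd_left (a i) (b i)
    obtain ⟨b', hb'⟩ := EuclideanDomain.gcd_dvd_right (a i) (b i)
    refine ⟨a', b', _, h2, ha', hb', ?_⟩
    have h3 := EuclideanDomain.gcd_eq_gcd_ab (a i) (b i)
    refine ⟨EuclideanDomain.gcdA (a i) (b i), EuclideanDomain.gcdB (a i) (b i), ?_⟩
    apply mul_left_cancel₀ h2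
    linear_combination -h3 - EuclideanDomain.gcdA (a i) (b i) * ha' - EuclideanDomain.gcdB (a i) (b i) * hb'
  choose a' b' g hg ha' hb' hcop using h1
  have ha0 : ∀ i, a' i ≠ 0 := by
    intro i h0; apply ha i; rw [ha' i, h0, mul_zero]
  have hb0 : ∀ i, b' i ≠ 0 := by
    intro i h0; apply hb i; rw [hb' i, h0, mul_zero]
  have hrel : RelAB a' b' P := by
    intro i j hij
    have h2 := h i j hij
    rw [ha' i, ha' j, hb' i, hb' j, map_mul, map_mul, map_mul, map_mul] at h2
    apply mul_left_cancel₀ (mul_ne_zero (atv_ne_zero i (hg i)) (atv_ne_zero j (hg j)))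
    linear_combination h2
  obtain ⟨G, hG⟩ := hrel.exists_inC hd ha0 hcop
  let i0 : Fin d := ⟨0, by omega⟩
  have hPc : ¬ ∃ c, P = MvPolynomial.C c := by
    rintro ⟨c, hc⟩
    have := hP i0
    rw [hc, MvPolynomial.degreeOf_C] at this
    omega
  by_cases hall : ∃ i, (b' i).natDegree ≤ (a' i).natDegree
  · obtain ⟨i, hi⟩ := hall
    have hbc := b_const hd ha0 hb0 hcop i hi P G hG hPc
    obtain ⟨u, hu, hadd⟩ := additive_case hd ha0 hb0 hcop hbc
    obtain ⟨f, hf⟩ := hadd P G hG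
    exact ⟨f, u, hu, Or.inl hf⟩
  · push Not at hall
    have hle := hG.natDegree_le hd ha0 hb0 i0 hP
    have hlt := hall i0
    obtain ⟨f, u, hu, hf⟩ := multiplicative_case hd ha0 hb0 hcop i0 (by omega) P G hG hPc
    exact ⟨f, u, hu, Or.inr hf⟩
end

section
variable {d : ℕ}

/-- The special forms of a polynomial. -/
def Special (P : MvPolynomial (Fin d) ℝ) : Prop :=
  ∃ (f : ℝ[X]) (u : Fin d → ℝ[X]), (∀ i, 0 < (u i).natDegree) ∧
      (P = Polynomial.aeval (∑ i, atv i (u i)) f ∨ P = Polynomial.aeval (∏ i, atv i (u i)) f)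

theorem uni_proportional (p q : ℝ[X]) (hp : p ≠ 0) (hq : q ≠ 0)
    (h : derivative p * q = p * derivative q) : ∃ c : ℝ, c ≠ 0 ∧ p = Polynomial.C c * q := by
  obtain ⟨c, hc, h1⟩ := proportional (d := 1) (atv 0 p) (atv 0 q) (atv_ne_zero 0 hp) (atv_ne_zero 0 hq) (by
    intro i
    have hi : i = 0 := Subsingleton.elim _ _
    subst hi
    rw [pderiv_atv_self, pderiv_atv_self, ← map_mul, ← map_mul, ← h, mul_comm])
  refine ⟨c, hc, atv_injective (0 : Fin 1) ?_⟩
  rw [map_mul, atv_C, h1]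

theorem uni_wronskian (p q : ℝ[X]) (h : derivative p * q = p * derivative q) (y z : ℝ) :
    p.eval y * q.eval z = p.eval z * q.eval y := by
  by_cases hp : p = 0
  · simp [hp]
  by_cases hq : q = 0
  · simp [hq]
  obtain ⟨c, _, rfl⟩ := uni_proportional p q hp hq h
  simp only [Polynomial.eval_mul, Polynomial.eval_C]
  ring

/-- Substitution of constants for the variables in `K`. -/
def sub (c : Fin d → ℝ) (K : Finset (Fin d)) : MvPolynomial (Fin d) ℝ →ₐ[ℝ] MvPolynomial (Fin d) ℝ :=
  MvPolynomial.aeval (fun j => if j ∈ K then MvPolynomial.C (c j) else MvPolynomial.X j)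

theorem eval_sub' (c x : Fin d → ℝ) (K : Finset (Fin d)) (P : MvPolynomial (Fin d) ℝ) :
    MvPolynomial.eval x (sub c K P) = MvPolynomial.eval (K.piecewise c x) P := by
  unfold sub
  rw [eval_aeval_mv]
  congr 2
  funext j
  by_cases h : j ∈ K <;> simp [h]

theorem sub_sub' (c : Fin d → ℝ) (K L : Finset (Fin d)) (P : MvPolynomial (Fin d) ℝ) :
    sub c K (sub c L P) = sub c (L ∪ K) P := by
  apply MvPolynomial.funext
  intro x
  rw [eval_sub', eval_sub', eval_sub']
  congr 2
  funext j
  by_cases h : j ∈ K <;> by_cases h' : j ∈ L <;> simp [h, h', Finset.piecewise]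

theorem sub_erase (c : Fin d → ℝ) (i : Fin d) (P : MvPolynomial (Fin d) ℝ) :
    sub c (Finset.univ.erase i) P = atv i (slice i c P) := by
  apply MvPolynomial.funext
  intro x
  rw [eval_sub', eval_atv, eval_slice]
  congr 2
  funext j
  by_cases h : j = i
  · subst h; simp
  · simp [h]

theorem sub_single_rel (c : Fin d → ℝ) (i j k : Fin d) (P : MvPolynomial (Fin d) ℝ)
    (hW : MvPolynomial.pderiv k (MvPolynomial.pderiv i P) * MvPolynomial.pderiv j P =
      MvPolynomial.pderiv i P * MvPolynomial.pderiv k (MvPolynomial.pderiv j P)) :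
    MvPolynomial.pderiv i P * sub c {k} (MvPolynomial.pderiv j P)
      = MvPolynomial.pderiv j P * sub c {k} (MvPolynomial.pderiv i P) := by
  apply MvPolynomial.funext
  intro x
  have h1 := uni_wronskian (slice k x (MvPolynomial.pderiv i P)) (slice k x (MvPolynomial.pderiv j P))
    (by rw [derivative_slice, derivative_slice, ← map_mul, ← map_mul, hW]) (x k) (c k)
  simp only [eval_slice, Function.update_eq_self] at h1
  have h2 : ({k} : Finset (Fin d)).piecewise c x = Function.update x k (c k) :=
    Finset.piecewise_singleton ..
  rw [map_mul, map_mul, eval_sub', eval_sub', h2, h1, mul_comm]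

theorem sub_rel (c : Fin d → ℝ) (P : MvPolynomial (Fin d) ℝ)
    (hc : ∀ j, MvPolynomial.eval c (MvPolynomial.pderiv j P) ≠ 0)
    (hW : ∀ i j k, i ≠ j → i ≠ k → j ≠ k →
      MvPolynomial.pderiv k (MvPolynomial.pderiv i P) * MvPolynomial.pderiv j P =
      MvPolynomial.pderiv i P * MvPolynomial.pderiv k (MvPolynomial.pderiv j P))
    (i j : Fin d) (hij : i ≠ j) (K : Finset (Fin d)) (hi : i ∉ K) (hj : j ∉ K) :
    MvPolynomial.pderiv i P * sub c K (MvPolynomial.pderiv j P)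
      = MvPolynomial.pderiv j P * sub c K (MvPolynomial.pderiv i P) := by
  classical
  induction K using Finset.induction_on with
  | empty =>
    have : ∀ Q : MvPolynomial (Fin d) ℝ, sub c ∅ Q = Q := by
      intro Q
      apply MvPolynomial.funext
      intro x
      rw [eval_sub', Finset.piecewise_empty]
    rw [this, this, mul_comm]
  | insert k K hk ih =>
    have hik : i ≠ k := fun h => hi (h ▸ Finset.mem_insert_self _ _)
    have hjk : j ≠ k := fun h => hj (h ▸ Finset.mem_insert_self _ _)
    have h1 := ih (fun h => hi (Finset.mem_insert_of_mem h)) (fun h => hj (Finset.mem_insert_of_mem h))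
    have h2 := congrArg (sub c K) (sub_single_rel c i j k P (hW i j k hij hik hjk))
    rw [map_mul, map_mul, sub_sub', sub_sub', ← Finset.insert_eq] at h2
    have hne : sub c K (MvPolynomial.pderiv j P) ≠ 0 := by
      intro h0
      have := eval_sub' c c K (MvPolynomial.pderiv j P)
      rw [h0, map_zero, Finset.piecewise_same] at this
      exact hc j this.symm
    apply mul_left_cancel₀ hne
    linear_combination sub c (insert k K) (MvPolynomial.pderiv j P) * h1 + MvPolynomial.pderiv j P * h2

theorem special_of_wronskian (hd : 3 ≤ d) (P : MvPolynomial (Fin d) ℝ) (hP : ∀ i, 1 ≤ P.degreeOf i)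
    (hW : ∀ i j k, i ≠ j → i ≠ k → j ≠ k →
      MvPolynomial.pderiv k (MvPolynomial.pderiv i P) * MvPolynomial.pderiv j P =
      MvPolynomial.pderiv i P * MvPolynomial.pderiv k (MvPolynomial.pderiv j P)) :
    Special P := by
  classical
  have hne : ∏ j, MvPolynomial.pderiv j P ≠ 0 :=
    Finset.prod_ne_zero_iff.2 fun j _ => (degreeOf_pderiv_self (hP j)).1
  obtain ⟨c, hc⟩ := exists_eval_ne_zero _ hne
  rw [map_prod, Finset.prod_ne_zero_iff] at hc
  have hc' : ∀ j, MvPolynomial.eval c (MvPolynomial.pderiv j P) ≠ 0 := fun j => hc j (Finset.mem_univ _)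
  have hrel := sub_rel c P hc' hW
  have third : ∀ i j : Fin d, ∃ k, k ≠ i ∧ k ≠ j := by
    intro i j
    have : ∃ k ∈ (Finset.univ : Finset (Fin d)), k ∉ ({i, j} : Finset (Fin d)) := by
      apply Finset.exists_mem_notMem_of_card_lt_card
      refine lt_of_le_of_lt (Finset.card_le_two) ?_
      rw [Finset.card_univ, Fintype.card_fin]; omega
    obtain ⟨k, _, hk⟩ := this
    simp only [Finset.mem_insert, Finset.mem_singleton, not_or] at hk
    exact ⟨k, hk⟩
  choose kk hkk using fun i : Fin d => third i i
  set D : Fin d → MvPolynomial (Fin d) ℝ := fun j => MvPolynomial.pderiv j P with hD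
  have hslice_ne : ∀ i j, slice i c (D j) ≠ 0 := by
    intro i j h0
    have := eval_slice i c (D j) (c i)
    rw [h0, Function.update_eq_self, Polynomial.eval_zero] at this
    exact hc' j this.symm
  refine structure_thm (by omega) P hP (fun i => slice i c (D i))
    (fun i => Polynomial.C (MvPolynomial.eval c (D (kk i)))⁻¹ * slice i c (D (kk i)))
    (fun i => hslice_ne i i)
    (fun i => mul_ne_zero (by
      rw [Ne, Polynomial.C_eq_zero]; exact inv_ne_zero (hc' _)) (hslice_ne i _)) ?_
  -- the value of `b i` does not depend on the auxiliary index
  have hb : ∀ i k, k ≠ i → slice i c (D k) = Polynomial.C (MvPolynomial.eval c (D k)) *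
      (Polynomial.C (MvPolynomial.eval c (D (kk i)))⁻¹ * slice i c (D (kk i))) := by
    intro i k hki
    by_cases hk : k = kk i
    · rw [← hk, ← mul_assoc, ← Polynomial.C_mul, mul_inv_cancel₀ (hc' k), Polynomial.C_1, one_mul]
    · have h1 := hrel k (kk i) hk {i} (by simpa using hki) (by simpa using (hkk i).1)
      have h2 := congrArg (slice i c) h1
      have h3 : ∀ Q, slice i c (sub c {i} Q) = Polynomial.C (MvPolynomial.eval c Q) := by
        intro Q
        apply Polynomial.funext
        intro y
        rw [eval_slice, eval_sub', Polynomial.eval_C]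
        congr 2
        rw [Finset.piecewise_singleton]
        simp
      rw [map_mul, map_mul, h3, h3] at h2
      have h4 : Polynomial.C (MvPolynomial.eval c (D (kk i))) ≠ 0 := by
        rw [Ne, Polynomial.C_eq_zero]; exact hc' _
      have h5 : Polynomial.C (MvPolynomial.eval c (D (kk i))) * Polynomial.C (MvPolynomial.eval c (D (kk i)))⁻¹
          = 1 := by
        rw [← Polynomial.C_mul, mul_inv_cancel₀ (hc' _), Polynomial.C_1]
      apply mul_left_cancel₀ h4
      simp only [hD] at h5 ⊢
      linear_combination h2 - Polynomial.C (MvPolynomial.eval c (MvPolynomial.pderiv k P)) *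
        slice i c (MvPolynomial.pderiv (kk i) P) * h5
  intro i j hij
  obtain ⟨k, hki, hkj⟩ := third i j
  set K1 : Finset (Fin d) := (Finset.univ.erase i).erase j with hK1
  have E1 := hrel i j hij K1 (by simp [hK1]) (by simp [hK1])
  have E2 := congrArg (sub c K1) (hrel i k hki.symm {j} (by simpa using hij) (by simpa using hkj))
  have E3 := congrArg (sub c K1) (hrel j k hkj.symm {i} (by simpa using hij.symm) (by simpa using hki))
  have u1 : ({j} : Finset (Fin d)) ∪ K1 = Finset.univ.erase i := by
    ext l; by_cases h : l = j <;> simp [hK1, h, hij.symm]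
  have u2 : ({i} : Finset (Fin d)) ∪ K1 = Finset.univ.erase j := by
    ext l; by_cases h : l = i <;> simp [hK1, h, hij]
  rw [map_mul, map_mul, sub_sub', sub_sub', u1, sub_erase, sub_erase] at E2
  rw [map_mul, map_mul, sub_sub', sub_sub', u2, sub_erase, sub_erase] at E3
  have hsne : ∀ l, sub c K1 (D l) ≠ 0 := by
    intro l h0
    have := eval_sub' c c K1 (D l)
    rw [h0, map_zero, Finset.piecewise_same] at this
    exact hc' l this.symm
  have hfin : D i * atv i (slice i c (D k)) * atv j (slice j c (D j)) =
      D j * atv i (slice i c (D i)) * atv j (slice j c (D k)) := by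
    apply mul_left_cancel₀ (mul_ne_zero (hsne j) (hsne k))
    simp only [hD]
    linear_combination atv i (slice i c (D k)) * atv j (slice j c (D j)) * sub c K1 (D k) * E1
      + D j * atv j (slice j c (D j)) * sub c K1 (D k) * E2
      + D j * atv i (slice i c (D i)) * sub c K1 (D k) * (-E3)
  rw [hb i k hki, hb j k hkj, map_mul, atv_C, map_mul (atv j), atv_C] at hfin
  have hCne : (MvPolynomial.C (MvPolynomial.eval c (D k)) : MvPolynomial (Fin d) ℝ) ≠ 0 := by
    rw [Ne, MvPolynomial.C_eq_zero]; exact hc' _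
  apply mul_left_cancel₀ hCne
  simp only [hD] at hfin ⊢
  linear_combination hfin
end

section
variable {d : ℕ}

/-- Substitution leaving three variables. -/
def three (a : Fin d → ℝ) (i j k : Fin d) : Fin d → MvPolynomial (Fin 3) ℝ := fun l =>
  if l = i then MvPolynomial.X 0 else if l = j then MvPolynomial.X 1 else
    if l = k then MvPolynomial.X 2 else MvPolynomial.C (a l)

theorem pderiv_three0 (a : Fin d → ℝ) (i j k : Fin d) (P : MvPolynomial (Fin d) ℝ) :
    MvPolynomial.pderiv 0 (MvPolynomial.aeval (three a i j k) P) =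
      MvPolynomial.aeval (three a i j k) (MvPolynomial.pderiv i P) := by
  rw [pderiv_aeval_mv, Finset.sum_eq_single i]
  · simp [three]
  · intro b _ hb
    unfold three
    split_ifs <;> simp_all
  · simp

theorem pderiv_three1 (a : Fin d → ℝ) (i j k : Fin d) (hij : i ≠ j) (P : MvPolynomial (Fin d) ℝ) :
    MvPolynomial.pderiv 1 (MvPolynomial.aeval (three a i j k) P) =
      MvPolynomial.aeval (three a i j k) (MvPolynomial.pderiv j P) := by
  rw [pderiv_aeval_mv, Finset.sum_eq_single j]
  · simp [three, hij.symm]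
  · intro b _ hb
    unfold three
    split_ifs <;> simp_all
  · simp

theorem eval_three (a : Fin d → ℝ) (i j k : Fin d) (x1 x2 y : ℝ) (P : MvPolynomial (Fin d) ℝ) :
    MvPolynomial.eval ![x1, x2, y] (MvPolynomial.aeval (three a i j k) P) =
      MvPolynomial.eval (fun l => if l = i then x1 else if l = j then x2 else if l = k then y else a l) P := by
  rw [eval_aeval_mv]
  congr 2
  funext l
  unfold three
  split_ifs <;> simp

theorem eval_three' (a : Fin d → ℝ) (i j k : Fin d) (hik : i ≠ k) (hjk : j ≠ k) (y : ℝ) (P : MvPolynomial (Fin d) ℝ) :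
    MvPolynomial.eval ![a i, a j, y] (MvPolynomial.aeval (three a i j k) P) =
      (slice k a P).eval y := by
  rw [eval_three, eval_slice]
  congr 2
  funext l
  rw [Function.update_apply]
  split_ifs <;> simp_all

theorem totalDegree_three (a : Fin d → ℝ) (i j k : Fin d) (P : MvPolynomial (Fin d) ℝ) :
    (MvPolynomial.aeval (three a i j k) P).totalDegree ≤ P.totalDegree := by
  have := totalDegree_aeval_le (three a i j k) 1 (by
    intro l
    unfold three
    split_ifs <;> simp) P
  simpa using this

theorem nondeg_of_wronskian (a : Fin d → ℝ) (i j k : Fin d) (hij : i ≠ j) (hik : i ≠ k) (hjk : j ≠ k)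
    (P : MvPolynomial (Fin d) ℝ)
    (hW : MvPolynomial.eval a (MvPolynomial.pderiv k (MvPolynomial.pderiv i P) * MvPolynomial.pderiv j P -
      MvPolynomial.pderiv i P * MvPolynomial.pderiv k (MvPolynomial.pderiv j P)) ≠ 0) :
    Nondeg (MvPolynomial.X 2) (MvPolynomial.aeval (three a i j k) P) := by
  by_contra hN
  unfold Nondeg at hN
  push Not at hN
  have hm0 : minorPoly (MvPolynomial.X 2) (MvPolynomial.aeval (three a i j k) P) 0 =
      - MvPolynomial.aeval (three a i j k) (MvPolynomial.pderiv i P) := by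
    unfold minorPoly
    rw [pderiv_three0, MvPolynomial.pderiv_X_self, MvPolynomial.pderiv_X_of_ne (by decide)]
    ring
  have hm1 : minorPoly (MvPolynomial.X 2) (MvPolynomial.aeval (three a i j k) P) 1 =
      - MvPolynomial.aeval (three a i j k) (MvPolynomial.pderiv j P) := by
    unfold minorPoly
    rw [pderiv_three1 _ _ _ _ hij, MvPolynomial.pderiv_X_self, MvPolynomial.pderiv_X_of_ne (by decide)]
    ring
  apply hW
  set p := slice k a (MvPolynomial.pderiv i P) with hp
  set q := slice k a (MvPolynomial.pderiv j P) with hq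
  have h1 : p * Polynomial.C (q.eval (a k)) = Polynomial.C (p.eval (a k)) * q := by
    apply Polynomial.funext
    intro y
    have := hN (a i) (a j) y (a k)
    rw [hm0, hm1, map_neg, map_neg, map_neg, map_neg, eval_three' _ _ _ _ hik hjk, eval_three' _ _ _ _ hik hjk,
      eval_three' _ _ _ _ hik hjk, eval_three' _ _ _ _ hik hjk] at this
    rw [Polynomial.eval_mul, Polynomial.eval_mul, Polynomial.eval_C, Polynomial.eval_C]
    linarith
  have h2 := congrArg (fun r => (derivative r).eval (a k)) h1
  simp only [Polynomial.derivative_mul, Polynomial.derivative_C, mul_zero, add_zero, zero_mul, zero_add,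
    Polynomial.eval_mul, Polynomial.eval_C, hp, hq, derivative_slice, eval_slice, Function.update_eq_self] at h2
  rw [map_sub, map_mul, map_mul, h2, sub_self]

theorem step1_ge3 (hd : 3 ≤ d) (δ : ℕ) (hδ : 1 ≤ δ) : ∃ C : ℝ, 0 < C ∧ ∃ n0 : ℕ, 1 ≤ n0 ∧
    ∀ P : MvPolynomial (Fin d) ℝ, P.totalDegree ≤ δ → (∀ i, 1 ≤ P.degreeOf i) → Special P ∨
      ∀ (n : ℕ) (A : Fin d → Finset ℝ), (∀ i, (A i).card = n) → n0 ≤ n →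
        (n : ℝ) ^ 3 ≤ C * (((Fintype.piFinset A).image (fun a => MvPolynomial.eval a P)).card : ℝ) ^ 2 := by
  classical
  obtain ⟨C, hC, n0, hn0, hcore⟩ := core δ hδ
  refine ⟨C, hC, max n0 (2 * δ + 1), le_trans hn0 (le_max_left _ _), ?_⟩
  intro P hP hPd
  by_cases hW : ∀ i j k, i ≠ j → i ≠ k → j ≠ k →
      MvPolynomial.pderiv k (MvPolynomial.pderiv i P) * MvPolynomial.pderiv j P =
      MvPolynomial.pderiv i P * MvPolynomial.pderiv k (MvPolynomial.pderiv j P)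
  · exact Or.inl (special_of_wronskian hd P hPd hW)
  right
  push Not at hW
  obtain ⟨i, j, k, hij, hik, hjk, hW⟩ := hW
  intro n A hA hn
  have hn1 : n0 ≤ n := le_trans (le_max_left _ _) hn
  have hn2 : 2 * δ + 1 ≤ n := le_trans (le_max_right _ _) hn
  set W := MvPolynomial.pderiv k (MvPolynomial.pderiv i P) * MvPolynomial.pderiv j P -
      MvPolynomial.pderiv i P * MvPolynomial.pderiv k (MvPolynomial.pderiv j P) with hWdef
  have hW0 : W ≠ 0 := sub_ne_zero.2 hW
  have hpd : ∀ l (R : MvPolynomial (Fin d) ℝ), R.totalDegree ≤ δ → (MvPolynomial.pderiv l R).totalDegree ≤ δ :=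
    fun l R hR => le_trans (totalDegree_pderiv_le l R) hR
  have hWdeg : W.totalDegree ≤ 2 * δ := by
    refine le_trans (MvPolynomial.totalDegree_sub _ _) (max_le ?_ ?_)
    · refine le_trans (MvPolynomial.totalDegree_mul _ _) ?_
      have := hpd k _ (hpd i P hP)
      have := hpd j P hP
      omega
    · refine le_trans (MvPolynomial.totalDegree_mul _ _) ?_
      have := hpd k _ (hpd j P hP)
      have := hpd i P hP
      omega
  have hex : ∃ a : Fin d → ℝ, (∀ l, a l ∈ A l) ∧ MvPolynomial.eval a W ≠ 0 := by
    by_contra h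
    push Not at h
    apply hW0
    apply MvPolynomial.eq_zero_of_eval_zero_at_prod_finset W A
    · intro l
      rw [hA l]
      exact lt_of_le_of_lt (le_trans (MvPolynomial.degreeOf_le_totalDegree _ _) hWdeg) (by omega)
    · exact h
  obtain ⟨a, haA, haW⟩ := hex
  have hND := nondeg_of_wronskian a i j k hij hik hjk P haW
  set V := (Fintype.piFinset A).image (fun a => MvPolynomial.eval a P) with hV
  have hle : n ≤ δ * n := Nat.le_mul_of_pos_left n hδ
  have := hcore (MvPolynomial.X 2) (MvPolynomial.aeval (three a i j k) P)
    (by rw [MvPolynomial.totalDegree_X]; exact hδ) (le_trans (totalDegree_three a i j k P) hP) hND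
    (A i) (A j) (A k) (A k) V (by rw [hA]; exact hn1) (by rw [hA, hA]; exact hle) (by rw [hA, hA]; exact hle)
    (by
      intro x1 _ x2 _ y hy
      simpa using hy)
    (by
      intro x1 h1 x2 h2 y hy
      rw [eval_three, hV]
      refine Finset.mem_image_of_mem (fun a => MvPolynomial.eval a P) ?_
      rw [Fintype.mem_piFinset]
      intro l
      split_ifs with c1 c2 c3
      · rw [c1]; exact h1
      · rw [c2]; exact h2
      · rw [c3]; exact hy
      · exact haA l)
  rw [hA, hA, hA] at this
  have hnpos : (0 : ℝ) < n := by
    have : 0 < n := by omega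
    exact_mod_cast this
  have h2 : (n : ℝ) ^ 2 * (n : ℝ) ^ 3 ≤ (n : ℝ) ^ 2 * (C * (V.card : ℝ) ^ 2) := by
    nlinarith [this]
  exact le_of_mul_le_mul_left h2 (by positivity)

end

section

theorem special_two (P Q : MvPolynomial (Fin 2) ℝ) (hP : ∀ i, 1 ≤ P.degreeOf i) (hQ : ∀ i, 1 ≤ Q.degreeOf i)
    (h : ∀ x1 x2 y y' : ℝ,
      MvPolynomial.eval ![x2, y] (MvPolynomial.pderiv 1 Q) * MvPolynomial.eval ![x1, y] (MvPolynomial.pderiv 0 P) *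
      (MvPolynomial.eval ![x1, y'] (MvPolynomial.pderiv 1 P) * MvPolynomial.eval ![x2, y'] (MvPolynomial.pderiv 0 Q))
      = MvPolynomial.eval ![x2, y'] (MvPolynomial.pderiv 1 Q) * MvPolynomial.eval ![x1, y'] (MvPolynomial.pderiv 0 P) *
      (MvPolynomial.eval ![x1, y] (MvPolynomial.pderiv 1 P) * MvPolynomial.eval ![x2, y] (MvPolynomial.pderiv 0 Q))) :
    Special P := by
  have hne : (MvPolynomial.pderiv 0 P * MvPolynomial.pderiv 1 P) *
      (MvPolynomial.pderiv 0 Q * MvPolynomial.pderiv 1 Q) ≠ 0 :=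
    mul_ne_zero (mul_ne_zero (degreeOf_pderiv_self (hP 0)).1 (degreeOf_pderiv_self (hP 1)).1)
      (mul_ne_zero (degreeOf_pderiv_self (hQ 0)).1 (degreeOf_pderiv_self (hQ 1)).1)
  obtain ⟨c, hc⟩ := exists_eval_ne_zero _ hne
  simp only [map_mul] at hc
  have hP0 := left_ne_zero_of_mul (left_ne_zero_of_mul hc)
  have hP1 := right_ne_zero_of_mul (left_ne_zero_of_mul hc)
  have hQ0 := left_ne_zero_of_mul (right_ne_zero_of_mul hc)
  have hQ1 := right_ne_zero_of_mul (right_ne_zero_of_mul hc)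
  have hsl : ∀ i (R : MvPolynomial (Fin 2) ℝ), MvPolynomial.eval c R ≠ 0 → slice i c R ≠ 0 := by
    intro i R hR h0
    have := eval_slice i c R (c i)
    rw [h0, Function.update_eq_self, Polynomial.eval_zero] at this
    exact hR this.symm
  have hCn : ∀ r : ℝ, r ≠ 0 → Polynomial.C r ≠ 0 := fun r hr => by rwa [Ne, Polynomial.C_eq_zero]
  have key : atv 0 (slice 0 c (MvPolynomial.pderiv 1 P)) *
      atv 1 (slice 1 c (MvPolynomial.pderiv 1 Q) * Polynomial.C (MvPolynomial.eval c (MvPolynomial.pderiv 0 Q))) *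
      MvPolynomial.pderiv 0 P =
      atv 1 (slice 1 c (MvPolynomial.pderiv 0 Q) * Polynomial.C (MvPolynomial.eval c (MvPolynomial.pderiv 1 Q))) *
      atv 0 (slice 0 c (MvPolynomial.pderiv 0 P)) * MvPolynomial.pderiv 1 P := by
    apply MvPolynomial.funext
    intro x
    have hu0 : ∀ y, Function.update c 0 y = ![y, c 1] := by
      intro y; funext l; fin_cases l <;> simp
    have hu1 : ∀ y, Function.update c 1 y = ![c 0, y] := by
      intro y; funext l; fin_cases l <;> simp
    have hx : x = ![x 0, x 1] := by funext l; fin_cases l <;> simp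
    have hcc : c = ![c 0, c 1] := by funext l; fin_cases l <;> simp
    have h1 := h (x 0) (c 0) (x 1) (c 1)
    rw [← hx, ← hcc] at h1
    simp only [map_mul, eval_atv, eval_slice, Polynomial.eval_C, hu0, hu1]
    linear_combination h1
  refine structure_thm le_rfl P hP
    ![slice 0 c (MvPolynomial.pderiv 0 P),
      slice 1 c (MvPolynomial.pderiv 1 Q) * Polynomial.C (MvPolynomial.eval c (MvPolynomial.pderiv 0 Q))]
    ![slice 0 c (MvPolynomial.pderiv 1 P),
      slice 1 c (MvPolynomial.pderiv 0 Q) * Polynomial.C (MvPolynomial.eval c (MvPolynomial.pderiv 1 Q))] ?_ ?_ ?_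
  · rw [Fin.forall_fin_two]
    exact ⟨hsl 0 _ hP0, mul_ne_zero (hsl 1 _ hQ1) (hCn _ hQ0)⟩
  · rw [Fin.forall_fin_two]
    exact ⟨hsl 0 _ hP1, mul_ne_zero (hsl 1 _ hQ0) (hCn _ hQ1)⟩
  · intro i j hij
    fin_cases i <;> fin_cases j
    · exact absurd rfl hij
    · exact key
    · exact key.symm
    · exact absurd rfl hij

theorem step1_two (δ : ℕ) (hδ : 1 ≤ δ) : ∃ C : ℝ, 0 < C ∧ ∃ n0 : ℕ, 1 ≤ n0 ∧
    ∀ P Q : MvPolynomial (Fin 2) ℝ, P.totalDegree ≤ δ → Q.totalDegree ≤ δ →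
      (∀ i, 1 ≤ P.degreeOf i) → (∀ i, 1 ≤ Q.degreeOf i) → (Special P ∧ Special Q) ∨
      ∀ (n : ℕ) (A : Fin 2 → Finset ℝ), (∀ i, (A i).card = n) → n0 ≤ n →
        (n : ℝ) ^ 5 ≤ C * ((((Fintype.piFinset A).image (fun a => MvPolynomial.eval a P)).card : ℝ) *
          (((Fintype.piFinset A).image (fun a => MvPolynomial.eval a Q)).card : ℝ)) ^ 2 := by
  classical
  obtain ⟨C, hC, n0, hn0, hcore⟩ := core δ hδ
  refine ⟨C, hC, n0, hn0, ?_⟩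
  intro P Q hP hQ hPd hQd
  set F : MvPolynomial (Fin 3) ℝ := MvPolynomial.aeval ![MvPolynomial.X 0, MvPolynomial.X 2] P with hF
  set G : MvPolynomial (Fin 3) ℝ := MvPolynomial.aeval ![MvPolynomial.X 1, MvPolynomial.X 2] Q with hG
  have evF : ∀ (R : MvPolynomial (Fin 2) ℝ) (x1 x2 y : ℝ), MvPolynomial.eval ![x1, x2, y]
      (MvPolynomial.aeval (![MvPolynomial.X 0, MvPolynomial.X 2] : Fin 2 → MvPolynomial (Fin 3) ℝ) R) = MvPolynomial.eval ![x1, y] R := by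
    intro R x1 x2 y
    rw [eval_aeval_mv]
    congr 2
    funext l; fin_cases l <;> simp
  have evG : ∀ (R : MvPolynomial (Fin 2) ℝ) (x1 x2 y : ℝ), MvPolynomial.eval ![x1, x2, y]
      (MvPolynomial.aeval (![MvPolynomial.X 1, MvPolynomial.X 2] : Fin 2 → MvPolynomial (Fin 3) ℝ) R) = MvPolynomial.eval ![x2, y] R := by
    intro R x1 x2 y
    rw [eval_aeval_mv]
    congr 2
    funext l; fin_cases l <;> simp
  by_cases hND : Nondeg F G
  · right
    intro n A hA hn
    have hle : n ≤ δ * n := Nat.le_mul_of_pos_left n hδ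
    have dF : F.totalDegree ≤ δ := by
      have := totalDegree_aeval_le (![MvPolynomial.X 0, MvPolynomial.X 2] : Fin 2 → MvPolynomial (Fin 3) ℝ) 1 (by
        intro l; fin_cases l <;> simp) P
      exact le_trans this (by omega)
    have dG : G.totalDegree ≤ δ := by
      have := totalDegree_aeval_le (![MvPolynomial.X 1, MvPolynomial.X 2] : Fin 2 → MvPolynomial (Fin 3) ℝ) 1 (by
        intro l; fin_cases l <;> simp) Q
      exact le_trans this (by omega)
    have := hcore F G dF dG hND (A 0) (A 0) (A 1)
      ((Fintype.piFinset A).image (fun a => MvPolynomial.eval a P))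
      ((Fintype.piFinset A).image (fun a => MvPolynomial.eval a Q))
      (by rw [hA]; exact hn) (by rw [hA, hA]; exact hle) (by rw [hA, hA]; exact hle)
      (by
        intro x1 h1 x2 h2 y hy
        rw [hF, evF]
        refine Finset.mem_image_of_mem (fun a => MvPolynomial.eval a P) ?_
        rw [Fintype.mem_piFinset, Fin.forall_fin_two]
        exact ⟨h1, hy⟩)
      (by
        intro x1 h1 x2 h2 y hy
        rw [hG, evG]
        refine Finset.mem_image_of_mem (fun a => MvPolynomial.eval a Q) ?_
        rw [Fintype.mem_piFinset, Fin.forall_fin_two]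
        exact ⟨h2, hy⟩)
    rw [hA, hA] at this
    refine le_trans (le_of_eq ?_) this
    ring
  · left
    have F0 : MvPolynomial.pderiv 0 F = MvPolynomial.aeval ![MvPolynomial.X 0, MvPolynomial.X 2] (MvPolynomial.pderiv 0 P) := by
      rw [hF, pderiv_aeval_mv, Fin.sum_univ_two]; simp [MvPolynomial.pderiv_X]
    have F1 : MvPolynomial.pderiv 1 F = 0 := by
      rw [hF, pderiv_aeval_mv, Fin.sum_univ_two]; simp [MvPolynomial.pderiv_X]
    have F2 : MvPolynomial.pderiv 2 F = MvPolynomial.aeval ![MvPolynomial.X 0, MvPolynomial.X 2] (MvPolynomial.pderiv 1 P) := by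
      rw [hF, pderiv_aeval_mv, Fin.sum_univ_two]; simp [MvPolynomial.pderiv_X]
    have G0 : MvPolynomial.pderiv 0 G = 0 := by
      rw [hG, pderiv_aeval_mv, Fin.sum_univ_two]; simp [MvPolynomial.pderiv_X]
    have G1 : MvPolynomial.pderiv 1 G = MvPolynomial.aeval ![MvPolynomial.X 1, MvPolynomial.X 2] (MvPolynomial.pderiv 0 Q) := by
      rw [hG, pderiv_aeval_mv, Fin.sum_univ_two]; simp [MvPolynomial.pderiv_X]
    have G2 : MvPolynomial.pderiv 2 G = MvPolynomial.aeval ![MvPolynomial.X 1, MvPolynomial.X 2] (MvPolynomial.pderiv 1 Q) := by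
      rw [hG, pderiv_aeval_mv, Fin.sum_univ_two]; simp [MvPolynomial.pderiv_X]
    unfold Nondeg minorPoly at hND
    push Not at hND
    rw [F0, F1, F2, G0, G1, G2] at hND
    simp only [mul_zero, sub_zero, zero_sub, map_neg, map_mul, evF, evG] at hND
    refine ⟨special_two P Q hPd hQd ?_, special_two Q P hQd hPd ?_⟩
    · intro x1 x2 y y'
      linear_combination -hND x1 x2 y y'
    · intro x1 x2 y y'
      linear_combination hND x2 x1 y y'

end

section

/-- Addition (`false`) or multiplication (`true`). -/
def opr (s : Bool) (x y : ℝ) : ℝ := if s then x * y else x + y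

/-- Partial fold. -/
def pfold {d : ℕ} (s : Bool) (J : Finset (Fin d)) (u : Fin d → ℝ[X]) (a : Fin d → ℝ) : ℝ :=
  if s then ∏ i ∈ J, (u i).eval (a i) else ∑ i ∈ J, (u i).eval (a i)

theorem pfold_insert {d : ℕ} (s : Bool) (J : Finset (Fin d)) (u : Fin d → ℝ[X]) (a : Fin d → ℝ) (j : Fin d)
    (hj : j ∉ J) : pfold s (insert j J) u a = opr s (pfold s J u a) ((u j).eval (a j)) := by
  cases s <;> simp [pfold, opr, hj, add_comm, mul_comm]

theorem pfold_update {d : ℕ} (s : Bool) (J : Finset (Fin d)) (u : Fin d → ℝ[X]) (a : Fin d → ℝ) (j : Fin d)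
    (hj : j ∉ J) (y : ℝ) : pfold s J u (Function.update a j y) = pfold s J u a := by
  have h : ∀ i ∈ J, (u i).eval (Function.update a j y i) = (u i).eval (a i) := by
    intro i hi
    have hij : i ≠ j := fun h => hj (h ▸ hi)
    rw [Function.update_of_ne hij]
  cases s
  · simp only [pfold, Bool.false_eq_true, if_false]; exact Finset.sum_congr rfl h
  · simp only [pfold, if_true]; exact Finset.prod_congr rfl h

theorem opr_inj (s : Bool) (w : ℝ) (hw : w ≠ 0) : Function.Injective (fun x => opr s x w) := by
  intro x y h
  cases s
  · simpa [opr] using h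
  · simpa [opr, hw] using h

/-- The three-variable polynomial attached to an operation. -/
def oF (s : Bool) (k : Fin 3) (p : ℝ[X]) : MvPolynomial (Fin 3) ℝ :=
  if s then MvPolynomial.X k * atv 2 p else MvPolynomial.X k + atv 2 p

theorem eval_oF (s : Bool) (k : Fin 3) (p : ℝ[X]) (x : Fin 3 → ℝ) :
    MvPolynomial.eval x (oF s k p) = opr s (x k) (p.eval (x 2)) := by
  cases s <;> simp [oF, opr, eval_atv]

theorem totalDegree_atv_le {d : ℕ} (i : Fin d) (p : ℝ[X]) : (atv i p).totalDegree ≤ p.natDegree := by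
  unfold atv
  rw [Polynomial.aeval_eq_sum_range]
  refine MvPolynomial.totalDegree_finsetSum_le ?_
  intro k hk
  refine le_trans (MvPolynomial.totalDegree_smul_le _ _) ?_
  rw [MvPolynomial.totalDegree_X_pow]
  rw [Finset.mem_range] at hk
  omega

theorem totalDegree_oF (s : Bool) (k : Fin 3) (p : ℝ[X]) (δ : ℕ) (hp : p.natDegree ≤ δ) :
    (oF s k p).totalDegree ≤ δ + 1 := by
  have h := le_trans (totalDegree_atv_le (2 : Fin 3) p) hp
  cases s
  · simp only [oF, Bool.false_eq_true, if_false]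
    refine le_trans (MvPolynomial.totalDegree_add _ _) (max_le ?_ (by omega))
    rw [MvPolynomial.totalDegree_X]; omega
  · simp only [oF, if_true]
    refine le_trans (MvPolynomial.totalDegree_mul _ _) ?_
    rw [MvPolynomial.totalDegree_X]; omega

theorem card_le_mul_image_poly (p : ℝ[X]) (δ : ℕ) (h0 : 0 < p.natDegree) (hp : p.natDegree ≤ δ) (S : Finset ℝ) :
    S.card ≤ δ * (S.image (fun x => p.eval x)).card := by
  classical
  refine Finset.card_le_mul_card_image S δ ?_
  intro b _
  have hne : p - Polynomial.C b ≠ 0 := by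
    intro h
    rw [sub_eq_zero] at h
    rw [h, Polynomial.natDegree_C] at h0
    exact lt_irrefl _ h0
  have : (S.filter (fun x => p.eval x = b)) ⊆ (p - Polynomial.C b).roots.toFinset := by
    intro x hx
    rw [Finset.mem_filter] at hx
    rw [Multiset.mem_toFinset, Polynomial.mem_roots hne]
    simp [hx.2]
  refine le_trans (Finset.card_le_card this) (le_trans (Multiset.toFinset_card_le _) ?_)
  refine le_trans (Polynomial.card_roots' _) ?_
  rw [Polynomial.natDegree_sub_C]
  exact hp

theorem exists_eval_ne_zero_finset (p : ℝ[X]) (hp : p ≠ 0) (S : Finset ℝ) (h : p.natDegree < S.card) :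
    ∃ y ∈ S, p.eval y ≠ 0 := by
  by_contra hcon
  push Not at hcon
  exact hp (Polynomial.eq_zero_of_natDegree_lt_card_of_eval_eq_zero' p S hcon h)

/-- The image of a partial fold. -/
def img {d : ℕ} (s : Bool) (J : Finset (Fin d)) (u : Fin d → ℝ[X]) (A : Fin d → Finset ℝ) : Finset ℝ :=
  (Fintype.piFinset A).image (fun a => pfold s J u a)

theorem opr_mem_img {d : ℕ} (s : Bool) (J : Finset (Fin d)) (u : Fin d → ℝ[X]) (A : Fin d → Finset ℝ)
    (j : Fin d) (hj : j ∉ J) (x y : ℝ) (hx : x ∈ img s J u A) (hy : y ∈ A j) :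
    opr s x ((u j).eval y) ∈ img s (insert j J) u A := by
  unfold img at hx ⊢
  rw [Finset.mem_image] at hx ⊢
  obtain ⟨a, ha, rfl⟩ := hx
  refine ⟨Function.update a j y, ?_, ?_⟩
  · rw [Fintype.mem_piFinset] at ha ⊢
    intro i
    by_cases h : i = j
    · subst h; simpa using hy
    · rw [Function.update_of_ne h]; exact ha i
  · rw [pfold_insert _ _ _ _ _ hj, pfold_update _ _ _ _ _ hj, Function.update_self]

theorem img_mono {d : ℕ} (s : Bool) (J : Finset (Fin d)) (u : Fin d → ℝ[X]) (A : Fin d → Finset ℝ)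
    (j : Fin d) (hj : j ∉ J) (hu : 0 < (u j).natDegree) (hA : (u j).natDegree < (A j).card) :
    (img s J u A).card ≤ (img s (insert j J) u A).card := by
  obtain ⟨y, hy, hne⟩ := exists_eval_ne_zero_finset (u j) (Polynomial.ne_zero_of_natDegree_gt hu) (A j) hA
  exact Finset.card_le_card_of_injOn (fun x => opr s x ((u j).eval y))
    (fun x hx => opr_mem_img s J u A j hj x y hx hy) ((opr_inj s _ hne).injOn)

theorem img_base {d : ℕ} (s : Bool) (u : Fin d → ℝ[X]) (A : Fin d → Finset ℝ) (n δ : ℕ) (hn : 1 ≤ n)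
    (hA : ∀ i, (A i).card = n) (i0 : Fin d) (hu : 0 < (u i0).natDegree) (hu' : (u i0).natDegree ≤ δ) :
    n ≤ δ * (img s {i0} u A).card := by
  classical
  have h := card_le_mul_image_poly (u i0) δ hu hu' (A i0)
  rw [hA] at h
  refine le_trans h (Nat.mul_le_mul_left _ (Finset.card_le_card ?_))
  intro z hz
  rw [Finset.mem_image] at hz
  obtain ⟨y, hy, rfl⟩ := hz
  have hne : ∀ i, (A i).Nonempty := fun i => Finset.card_pos.1 (by rw [hA i]; omega)
  choose b hb using hne
  unfold img
  rw [Finset.mem_image]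
  refine ⟨Function.update b i0 y, ?_, ?_⟩
  · rw [Fintype.mem_piFinset]
    intro i
    by_cases h : i = i0
    · subst h; simpa using hy
    · rw [Function.update_of_ne h]; exact hb i
  · cases s <;> simp [pfold]

open Classical in
theorem chain (δ : ℕ) (hδ : 1 ≤ δ) : ∃ c : ℝ, 0 < c ∧ ∃ n0 : ℕ, 1 ≤ n0 ∧
    ∀ (d : ℕ) (s s' : Bool) (u v : Fin d → ℝ[X]),
      (∀ i, 0 < (u i).natDegree) → (∀ i, 0 < (v i).natDegree) →
      (∀ i, (u i).natDegree ≤ δ) → (∀ i, (v i).natDegree ≤ δ) →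
      ∀ (n : ℕ) (A : Fin d → Finset ℝ), (∀ i, (A i).card = n) → n0 ≤ n →
      ∀ (i0 : Fin d) (J : Finset (Fin d)), i0 ∉ J →
        n ≤ δ * (img s (insert i0 J) u A).card ∧ n ≤ δ * (img s' (insert i0 J) v A).card ∧
        c * (n : ℝ) ^ ((3 : ℝ) - (1 / 2) ^ (J.filter (fun j => Nondeg (oF s 0 (u j)) (oF s' 1 (v j)))).card) ≤
          ((img s (insert i0 J) u A).card : ℝ) * (img s' (insert i0 J) v A).card := by
  obtain ⟨C, hC, n0, hn0, hcore⟩ := core (δ + 1) (by omega)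
  have hδR : (1 : ℝ) ≤ δ := by exact_mod_cast hδ
  refine ⟨min (1 / C) (1 / (δ : ℝ) ^ 2), by positivity, max n0 (δ + 1), le_trans hn0 (le_max_left _ _), ?_⟩
  intro d s s' u v hu hv hu' hv' n A hA hn i0 J
  have hn1 : n0 ≤ n := le_trans (le_max_left _ _) hn
  have hn2 : δ + 1 ≤ n := le_trans (le_max_right _ _) hn
  have hnR : (0 : ℝ) < n := by
    have : 0 < n := by omega
    exact_mod_cast this
  set c := min (1 / C) (1 / (δ : ℝ) ^ 2) with hc
  have hcpos : 0 < c := by rw [hc]; positivity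
  induction J using Finset.induction_on with
  | empty =>
    intro _
    have h1 := img_base s u A n δ (by omega) hA i0 (hu i0) (hu' i0)
    have h2 := img_base s' v A n δ (by omega) hA i0 (hv i0) (hv' i0)
    simp only [insert_empty_eq, Finset.filter_empty, Finset.card_empty, pow_zero]
    refine ⟨h1, h2, ?_⟩
    have h1' : (n : ℝ) ≤ δ * (img s {i0} u A).card := by exact_mod_cast h1
    have h2' : (n : ℝ) ≤ δ * (img s' {i0} v A).card := by exact_mod_cast h2
    have e : ((3 : ℝ) - 1) = ((2 : ℕ) : ℝ) := by norm_num
    rw [e, Real.rpow_natCast]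
    calc c * (n : ℝ) ^ 2 ≤ (1 / (δ : ℝ) ^ 2) * (n : ℝ) ^ 2 := by
          gcongr; exact min_le_right _ _
      _ ≤ (1 / (δ : ℝ) ^ 2) * ((δ * (img s {i0} u A).card) * (δ * (img s' {i0} v A).card)) := by
          rw [pow_two (n : ℝ)]; gcongr
      _ = _ := by field_simp
  | insert j J hj ih =>
    intro hi0
    rw [Finset.mem_insert, not_or] at hi0
    obtain ⟨ih1, ih2, ih3⟩ := ih hi0.2
    have hjI : j ∉ insert i0 J := by
      rw [Finset.mem_insert, not_or]; exact ⟨fun h => hi0.1 h.symm, hj⟩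
    have hcomm : insert i0 (insert j J) = insert j (insert i0 J) := Finset.insert_comm _ _ _
    rw [hcomm]
    have m1 := img_mono s (insert i0 J) u A j hjI (hu j) (by rw [hA]; have := hu' j; omega)
    have m2 := img_mono s' (insert i0 J) v A j hjI (hv j) (by rw [hA]; have := hv' j; omega)
    refine ⟨le_trans ih1 (Nat.mul_le_mul_left _ m1), le_trans ih2 (Nat.mul_le_mul_left _ m2), ?_⟩
    have m1' : ((img s (insert i0 J) u A).card : ℝ) ≤ (img s (insert j (insert i0 J)) u A).card := by exact_mod_cast m1
    have m2' : ((img s' (insert i0 J) v A).card : ℝ) ≤ (img s' (insert j (insert i0 J)) v A).card := by exact_mod_cast m2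
    rw [Finset.filter_insert]
    split_ifs with hb
    · have hjf : j ∉ J.filter (fun j => Nondeg (oF s 0 (u j)) (oF s' 1 (v j))) :=
        fun h => hj (Finset.mem_of_mem_filter _ h)
      rw [Finset.card_insert_of_notMem hjf]
      set b := (J.filter (fun j => Nondeg (oF s 0 (u j)) (oF s' 1 (v j)))).card with hbdef
      have hk := hcore _ _ (totalDegree_oF s 0 (u j) δ (hu' j)) (totalDegree_oF s' 1 (v j) δ (hv' j)) hb
        (img s (insert i0 J) u A) (img s' (insert i0 J) v A) (A j)
        (img s (insert j (insert i0 J)) u A) (img s' (insert j (insert i0 J)) v A)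
        (by rw [hA]; exact hn1)
        (by rw [hA]; exact le_trans ih1 (Nat.mul_le_mul_right _ (by omega)))
        (by rw [hA]; exact le_trans ih2 (Nat.mul_le_mul_right _ (by omega)))
        (by
          intro x1 h1 x2 h2 y hy
          rw [eval_oF]
          exact opr_mem_img s _ u A j hjI x1 y h1 hy)
        (by
          intro x1 h1 x2 h2 y hy
          rw [eval_oF]
          exact opr_mem_img s' _ v A j hjI x2 y h2 hy)
      rw [hA] at hk
      set M := ((img s (insert j (insert i0 J)) u A).card : ℝ) * (img s' (insert j (insert i0 J)) v A).card with hM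
      have hM0 : 0 ≤ M := by positivity
      refine le_of_sq_le_sq ?_ hM0
      have e1 : ((n : ℝ) ^ ((3 : ℝ) - (1 / 2) ^ (b + 1))) ^ 2 = (n : ℝ) ^ ((3 : ℝ) - (1 / 2) ^ b) * (n : ℝ) ^ 3 := by
        rw [← Real.rpow_natCast, ← Real.rpow_mul hnR.le, ← Real.rpow_natCast (n : ℝ) 3, ← Real.rpow_add hnR]
        congr 1
        push_cast
        ring
      have hcC : c * C ≤ 1 := by
        have : c ≤ 1 / C := min_le_left _ _
        rwa [le_div_iff₀ hC] at this
      calc (c * (n : ℝ) ^ ((3 : ℝ) - (1 / 2) ^ (b + 1))) ^ 2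
          = c * (c * (n : ℝ) ^ ((3 : ℝ) - (1 / 2) ^ b) * (n : ℝ) ^ 3) := by rw [mul_pow, e1]; ring
        _ ≤ c * (((img s (insert i0 J) u A).card : ℝ) * (img s' (insert i0 J) v A).card * (n : ℝ) ^ 3) := by
            gcongr
        _ ≤ c * (C * M ^ 2) := by gcongr
        _ = (c * C) * M ^ 2 := by ring
        _ ≤ 1 * M ^ 2 := by gcongr
        _ = M ^ 2 := one_mul _
    · refine le_trans ih3 ?_
      gcongr
end

section

theorem eval_aeval_poly {d : ℕ} (g : MvPolynomial (Fin d) ℝ) (f : ℝ[X]) (a : Fin d → ℝ) :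
    MvPolynomial.eval a (Polynomial.aeval g f) = f.eval (MvPolynomial.eval a g) := by
  induction f using Polynomial.induction_on' with
  | add p q hp hq => simp only [map_add, hp, hq, Polynomial.eval_add]
  | monomial n a => simp [Polynomial.aeval_monomial]

theorem special_form {d : ℕ} (hd : 1 ≤ d) (δ : ℕ) (P : MvPolynomial (Fin d) ℝ) (hP : P.totalDegree ≤ δ)
    (hPd : ∀ i, 1 ≤ P.degreeOf i) (hS : Special P) :
    ∃ (s : Bool) (f : ℝ[X]) (u : Fin d → ℝ[X]), 0 < f.natDegree ∧ f.natDegree ≤ δ ∧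
      (∀ i, 0 < (u i).natDegree) ∧ (∀ i, (u i).natDegree ≤ δ) ∧
      ∀ a, MvPolynomial.eval a P = f.eval (pfold s Finset.univ u a) := by
  classical
  obtain ⟨f, u, hu, hfu⟩ := hS
  have h1 : ∃ s : Bool, ∀ a, MvPolynomial.eval a P = f.eval (pfold s Finset.univ u a) := by
    rcases hfu with h | h
    · refine ⟨false, fun a => ?_⟩
      rw [h, eval_aeval_poly]
      simp [pfold, map_sum, eval_atv]
    · refine ⟨true, fun a => ?_⟩
      rw [h, eval_aeval_poly]
      simp [pfold, map_prod, eval_atv]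
  obtain ⟨s, hs⟩ := h1
  let i0 : Fin d := ⟨0, by omega⟩
  have hf0 : 0 < f.natDegree := by
    rw [Nat.pos_iff_ne_zero]
    intro h0
    have hf := Polynomial.eq_C_of_natDegree_eq_zero h0
    have : P = MvPolynomial.C (f.coeff 0) := by
      apply MvPolynomial.funext
      intro a
      rw [hs, hf]; simp
    have h2 := hPd i0
    rw [this, MvPolynomial.degreeOf_C] at h2
    omega
  have hc : ∀ i, ∃ y, (u i).eval y ≠ 0 := by
    intro i
    by_contra h
    push Not at h
    have : u i = 0 := Polynomial.funext (fun y => by rw [h y, Polynomial.eval_zero])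
    have h2 := hu i
    rw [this] at h2
    simp at h2
  choose c hc using hc
  have hdeg : ∀ i, f.natDegree * (u i).natDegree ≤ δ := by
    intro i
    set w := pfold s (Finset.univ.erase i) u c with hw
    have hsl : slice i c P = f.comp (if s then Polynomial.C w * u i else Polynomial.C w + u i) := by
      apply Polynomial.funext
      intro y
      have h3 : pfold s Finset.univ u (Function.update c i y) = opr s w ((u i).eval y) := by
        rw [← Finset.insert_erase (Finset.mem_univ i), pfold_insert _ _ _ _ _ (Finset.notMem_erase _ _),
          pfold_update _ _ _ _ _ (Finset.notMem_erase _ _), Function.update_self]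
      rw [eval_slice, hs, h3, Polynomial.eval_comp]
      cases s <;> simp [opr]
    have hd2 : (if s then Polynomial.C w * u i else Polynomial.C w + u i).natDegree = (u i).natDegree := by
      cases s
      · simp
      · have hw0 : w ≠ 0 := by
          rw [hw]
          simp only [pfold, if_true]
          exact Finset.prod_ne_zero_iff.2 fun j _ => hc j
        simp only [if_true]
        exact Polynomial.natDegree_C_mul hw0
    have h4 := natDegree_slice_le i c P
    rw [hsl, Polynomial.natDegree_comp, hd2] at h4
    exact le_trans h4 hP
  refine ⟨s, f, u, hf0, ?_, hu, ?_, hs⟩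
  · exact le_trans (Nat.le_mul_of_pos_right _ (hu i0)) (hdeg i0)
  · intro i
    exact le_trans (Nat.le_mul_of_pos_left _ hf0) (hdeg i)

open Classical in
theorem many_bad (δ : ℕ) (hδ : 1 ≤ δ) : ∃ c : ℝ, 0 < c ∧ ∃ n0 : ℕ, 1 ≤ n0 ∧
    ∀ (d t : ℕ) (s s' : Bool) (f g : ℝ[X]) (u v : Fin d → ℝ[X]) (P Q : MvPolynomial (Fin d) ℝ),
      1 ≤ d → t ≤ d - 1 → 0 < f.natDegree → f.natDegree ≤ δ → 0 < g.natDegree → g.natDegree ≤ δ →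
      (∀ i, 0 < (u i).natDegree) → (∀ i, 0 < (v i).natDegree) →
      (∀ i, (u i).natDegree ≤ δ) → (∀ i, (v i).natDegree ≤ δ) →
      (∀ a, MvPolynomial.eval a P = f.eval (pfold s Finset.univ u a)) →
      (∀ a, MvPolynomial.eval a Q = g.eval (pfold s' Finset.univ v a)) →
      t ≤ ((Finset.univ : Finset (Fin d)).filter (fun j => Nondeg (oF s 0 (u j)) (oF s' 1 (v j)))).card →
      ∀ (n : ℕ) (A : Fin d → Finset ℝ), (∀ i, (A i).card = n) → n0 ≤ n →
        c * (n : ℝ) ^ ((3 : ℝ) - (1 / 2) ^ t) ≤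
          (((Fintype.piFinset A).image (fun a => MvPolynomial.eval a P)).card : ℝ) *
          (((Fintype.piFinset A).image (fun a => MvPolynomial.eval a Q)).card : ℝ) := by
  obtain ⟨c, hc, n0, hn0, hch⟩ := chain δ hδ
  have hδR : (1 : ℝ) ≤ δ := by exact_mod_cast hδ
  refine ⟨c / (δ : ℝ) ^ 2, by positivity, n0, hn0, ?_⟩
  intro d t s s' f g u v P Q hd htd hf hf' hg hg' hu hv hu' hv' hP hQ ht n A hA hn
  have hi0 : ∃ i0 : Fin d, t ≤ ((Finset.univ.erase i0).filter
      (fun j => Nondeg (oF s 0 (u j)) (oF s' 1 (v j)))).card := by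
    by_cases hg : ∃ i0, ¬ Nondeg (oF s 0 (u i0)) (oF s' 1 (v i0))
    · obtain ⟨i0, hi0⟩ := hg
      refine ⟨i0, le_trans ht (Finset.card_le_card ?_)⟩
      intro j hj
      rw [Finset.mem_filter] at hj ⊢
      refine ⟨Finset.mem_erase.2 ⟨?_, Finset.mem_univ _⟩, hj.2⟩
      rintro rfl
      exact hi0 hj.2
    · push Not at hg
      refine ⟨⟨0, by omega⟩, ?_⟩
      rw [Finset.filter_true_of_mem (fun j _ => hg j), Finset.card_erase_of_mem (Finset.mem_univ _),
        Finset.card_univ, Fintype.card_fin]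
      exact htd
  obtain ⟨i0, hi0⟩ := hi0
  obtain ⟨_, _, h3⟩ := hch d s s' u v hu hv hu' hv' n A hA hn i0 (Finset.univ.erase i0) (Finset.notMem_erase _ _)
  rw [Finset.insert_erase (Finset.mem_univ i0)] at h3
  set b := ((Finset.univ.erase i0).filter (fun j => Nondeg (oF s 0 (u j)) (oF s' 1 (v j)))).card with hb
  have key : ∀ (s : Bool) (f : ℝ[X]) (u : Fin d → ℝ[X]) (P : MvPolynomial (Fin d) ℝ), 0 < f.natDegree → f.natDegree ≤ δ →
      (∀ a, MvPolynomial.eval a P = f.eval (pfold s Finset.univ u a)) →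
      ((img s Finset.univ u A).card : ℝ) ≤
        δ * (((Fintype.piFinset A).image (fun a => MvPolynomial.eval a P)).card : ℝ) := by
    intro s f u P hf hf' hP
    have h := card_le_mul_image_poly f δ hf hf' (img s Finset.univ u A)
    have e : (img s Finset.univ u A).image (fun x => f.eval x) =
        (Fintype.piFinset A).image (fun a => MvPolynomial.eval a P) := by
      unfold img
      rw [Finset.image_image]
      exact Finset.image_congr (fun a _ => (hP a).symm)
    rw [e] at h
    exact_mod_cast h
  have k1 := key s f u P hf hf' hP
  have k2 := key s' g v Q hg hg' hQ
  have hn1 : (1 : ℝ) ≤ n := by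
    have : 1 ≤ n := le_trans hn0 hn
    exact_mod_cast this
  have hexp : (n : ℝ) ^ ((3 : ℝ) - (1 / 2) ^ t) ≤ (n : ℝ) ^ ((3 : ℝ) - (1 / 2) ^ b) := by
    apply Real.rpow_le_rpow_of_exponent_le hn1
    have : ((1 : ℝ) / 2) ^ b ≤ (1 / 2) ^ t := pow_le_pow_of_le_one (by norm_num) (by norm_num) hi0
    linarith
  set p := (((Fintype.piFinset A).image (fun a => MvPolynomial.eval a P)).card : ℝ)
  set q := (((Fintype.piFinset A).image (fun a => MvPolynomial.eval a Q)).card : ℝ)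
  rw [div_mul_eq_mul_div, div_le_iff₀ (by positivity)]
  calc c * (n : ℝ) ^ ((3 : ℝ) - (1 / 2) ^ t) ≤ c * (n : ℝ) ^ ((3 : ℝ) - (1 / 2) ^ b) := by gcongr
    _ ≤ _ := h3
    _ ≤ (δ * p) * (δ * q) := by gcongr
    _ = p * q * (δ : ℝ) ^ 2 := by ring

/-- The multiplier attached to an operation. -/
def wt (s : Bool) (u : ℝ[X]) : ℝ[X] := if s then u else 1

theorem wt_ne_zero (s : Bool) (u : ℝ[X]) (hu : u ≠ 0) : wt s u ≠ 0 := by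
  cases s <;> simp [wt, hu]

theorem good_rel (s s' : Bool) (u v : ℝ[X]) (hu : 0 < u.natDegree) (hv : 0 < v.natDegree)
    (h : ¬ Nondeg (oF s 0 u) (oF s' 1 v)) :
    ∃ l : ℝ, l ≠ 0 ∧ derivative v * wt s u = Polynomial.C l * (derivative u * wt s' v) := by
  have hu0 := Polynomial.ne_zero_of_natDegree_gt hu
  have hv0 := Polynomial.ne_zero_of_natDegree_gt hv
  have hdu : derivative u ≠ 0 := by rw [Ne, Polynomial.derivative_eq_zero]; omega
  have hdv : derivative v ≠ 0 := by rw [Ne, Polynomial.derivative_eq_zero]; omega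
  have hX := mul_ne_zero (mul_ne_zero hdv (wt_ne_zero s u hu0)) (mul_ne_zero hdu (wt_ne_zero s' v hv0))
  have hex : ∃ y, ((derivative v * wt s u) * (derivative u * wt s' v)).eval y ≠ 0 := by
    by_contra hcon
    push Not at hcon
    exact hX (Polynomial.funext (fun y => by rw [hcon y, Polynomial.eval_zero]))
  obtain ⟨z, hz⟩ := hex
  rw [Polynomial.eval_mul] at hz
  have hz1 := left_ne_zero_of_mul hz
  have hz2 := right_ne_zero_of_mul hz
  refine ⟨(derivative v * wt s u).eval z / (derivative u * wt s' v).eval z, div_ne_zero hz1 hz2, ?_⟩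
  apply Polynomial.funext
  intro y
  unfold Nondeg at h
  push Not at h
  have h1 := h 1 1 y z
  have d0 : ∀ (s : Bool) (k : Fin 3) (p : ℝ[X]) (y : ℝ), k ≠ 2 → MvPolynomial.eval ![1, 1, y] (MvPolynomial.pderiv k (oF s k p)) =
      (wt s p).eval y := by
    intro s k p y hk
    cases s
    · simp [oF, wt, pderiv_atv_ne hk.symm]
    · simp [oF, wt, pderiv_atv_ne hk.symm, eval_atv]
  have d1 : ∀ (s : Bool) (k l : Fin 3) (p : ℝ[X]), k ≠ 2 → l ≠ 2 → k ≠ l → (MvPolynomial.pderiv l (oF s k p)) = 0 := by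
    intro s k l p hk hl hkl
    cases s
    · simp [oF, pderiv_atv_ne hl.symm, MvPolynomial.pderiv_X_of_ne hkl]
    · simp [oF, pderiv_atv_ne hl.symm, MvPolynomial.pderiv_X_of_ne hkl]
  have d2 : ∀ (s : Bool) (k : Fin 3) (p : ℝ[X]) (y : ℝ), k ≠ 2 → MvPolynomial.eval ![1, 1, y] (MvPolynomial.pderiv 2 (oF s k p)) =
      (derivative p).eval y := by
    intro s k p y hk
    have hx : (![1, 1, y] : Fin 3 → ℝ) k = 1 := by fin_cases k <;> simp_all
    cases s
    · simp [oF, pderiv_atv_self, MvPolynomial.pderiv_X_of_ne hk, eval_atv]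
    · simp [oF, pderiv_atv_self, MvPolynomial.pderiv_X_of_ne hk, eval_atv, hx]
  unfold minorPoly at h1
  rw [d1 s 0 1 u (by decide) (by decide) (by decide), d1 s' 1 0 v (by decide) (by decide) (by decide)] at h1
  simp only [map_mul, mul_zero, sub_zero, zero_sub, map_neg, d0 s 0 u _ (by decide),
    d0 s' 1 v _ (by decide), d2 s 0 u _ (by decide), d2 s' 1 v _ (by decide)] at h1
  rw [Polynomial.eval_mul (p := Polynomial.C _), Polynomial.eval_C, div_mul_eq_mul_div, eq_div_iff hz2]
  simp only [Polynomial.eval_mul]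
  linear_combination -h1

theorem mixed_false (s s' : Bool) (hss : s ≠ s') (u v : ℝ[X]) (hu : 0 < u.natDegree) (hv : 0 < v.natDegree)
    (h : ¬ Nondeg (oF s 0 u) (oF s' 1 v)) : False := by
  obtain ⟨l, hl, h⟩ := good_rel s s' u v hu hv h
  have hu0 := Polynomial.ne_zero_of_natDegree_gt hu
  have hv0 := Polynomial.ne_zero_of_natDegree_gt hv
  have hdu : derivative u ≠ 0 := by rw [Ne, Polynomial.derivative_eq_zero]; omega
  have hdv : derivative v ≠ 0 := by rw [Ne, Polynomial.derivative_eq_zero]; omega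
  have lu := Polynomial.natDegree_derivative_lt (p := u) (by omega)
  have lv := Polynomial.natDegree_derivative_lt (p := v) (by omega)
  have h2 := congrArg Polynomial.natDegree h
  rw [Polynomial.natDegree_C_mul hl] at h2
  cases s <;> cases s'
  · exact hss rfl
  · simp only [wt, if_true, Bool.false_eq_true, if_false, mul_one] at h2
    rw [Polynomial.natDegree_mul hdu hv0] at h2
    omega
  · simp only [wt, if_true, Bool.false_eq_true, if_false, mul_one] at h2
    rw [Polynomial.natDegree_mul hdv hu0] at h2
    omega
  · exact hss rfl

theorem good_add (u v : ℝ[X]) (hu : 0 < u.natDegree) (hv : 0 < v.natDegree)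
    (h : ¬ Nondeg (oF false 0 u) (oF false 1 v)) :
    ∃ l k : ℝ, l ≠ 0 ∧ v = Polynomial.C l * u + Polynomial.C k := by
  obtain ⟨l, hl, h⟩ := good_rel _ _ u v hu hv h
  simp only [wt, Bool.false_eq_true, if_false, mul_one] at h
  have h1 : derivative (v - Polynomial.C l * u) = 0 := by
    rw [Polynomial.derivative_sub, Polynomial.derivative_C_mul, h, sub_self]
  rw [Polynomial.derivative_eq_zero] at h1
  have h2 := Polynomial.eq_C_of_natDegree_eq_zero h1
  exact ⟨l, _, hl, by rw [← h2]; ring⟩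

theorem good_mul (u v : ℝ[X]) (hu : 0 < u.natDegree) (hv : 0 < v.natDegree)
    (h : ¬ Nondeg (oF true 0 u) (oF true 1 v)) :
    ∃ k : ℝ, 0 < k ∧ EquivM u (Polynomial.C k⁻¹ * v) := by
  obtain ⟨l, hl, h⟩ := good_rel _ _ u v hu hv h
  simp only [wt, if_true] at h
  have hu0 := Polynomial.ne_zero_of_natDegree_gt hu
  have hv0 := Polynomial.ne_zero_of_natDegree_gt hv
  set p := v.natDegree with hp
  set q := u.natDegree with hq
  have hlc : (p : ℝ) = l * q := by
    have h2 := congrArg (fun r => r.coeff (p - 1 + q)) h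
    have e1 : (derivative v * u).coeff (p - 1 + q) = v.leadingCoeff * p * u.leadingCoeff := by
      rw [Polynomial.coeff_mul_add_eq_of_natDegree_le (Polynomial.natDegree_derivative_le v) le_rfl,
        Polynomial.coeff_derivative]
      have : p - 1 + 1 = p := by omega
      rw [this]
      have : ((p - 1 : ℕ) : ℝ) + 1 = p := by exact_mod_cast this
      rw [this]; rfl
    have e2 : (derivative u * v).coeff (p - 1 + q) = u.leadingCoeff * q * v.leadingCoeff := by
      have : p - 1 + q = (q - 1) + p := by omega
      rw [this, Polynomial.coeff_mul_add_eq_of_natDegree_le (Polynomial.natDegree_derivative_le u) le_rfl,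
        Polynomial.coeff_derivative]
      have : q - 1 + 1 = q := by omega
      rw [this]
      have : ((q - 1 : ℕ) : ℝ) + 1 = q := by exact_mod_cast this
      rw [this]; rfl
    simp only [Polynomial.coeff_C_mul] at h2
    rw [e1, e2] at h2
    have hlu := Polynomial.leadingCoeff_ne_zero.2 hu0
    have hlv := Polynomial.leadingCoeff_ne_zero.2 hv0
    apply mul_left_cancel₀ (mul_ne_zero hlu hlv)
    linear_combination h2
  have hrel : Polynomial.C (q : ℝ) * (derivative v * u) = Polynomial.C (p : ℝ) * (derivative u * v) := by
    rw [h, hlc, Polynomial.C_mul]; ring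
  have hpow : derivative (v ^ q) * u ^ p = v ^ q * derivative (u ^ p) := by
    rw [Polynomial.derivative_pow, Polynomial.derivative_pow]
    obtain ⟨p', hp'⟩ : ∃ p', p = p' + 1 := ⟨p - 1, by omega⟩
    obtain ⟨q', hq'⟩ : ∃ q', q = q' + 1 := ⟨q - 1, by omega⟩
    have a1 : v ^ q = v ^ (q - 1) * v := by rw [← pow_succ]; congr 1; omega
    have a2 : u ^ p = u ^ (p - 1) * u := by rw [← pow_succ]; congr 1; omega
    rw [a1, a2]
    linear_combination v ^ (q - 1) * u ^ (p - 1) * hrel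
  obtain ⟨c, hc, hvu⟩ := uni_proportional (v ^ q) (u ^ p) (pow_ne_zero _ hv0) (pow_ne_zero _ hu0) hpow
  have hqR : (0 : ℝ) < q := by exact_mod_cast hu
  have hpR : (0 : ℝ) < p := by exact_mod_cast hv
  set k := |c| ^ (1 / (q : ℝ)) with hk
  have hkpos : 0 < k := Real.rpow_pos_of_pos (abs_pos.2 hc) _
  have hkq : k ^ q = |c| := by
    rw [hk, ← Real.rpow_natCast, ← Real.rpow_mul (abs_nonneg _), one_div, inv_mul_cancel₀ hqR.ne', Real.rpow_one]
  refine ⟨k, hkpos, (q : ℚ) / p, by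
    have : (0:ℚ) < q := by exact_mod_cast hu
    have : (0:ℚ) < p := by exact_mod_cast hv
    positivity, ?_⟩
  intro x
  have hx := congrArg (fun r => |r.eval x|) hvu
  simp only [Polynomial.eval_pow, Polynomial.eval_mul, Polynomial.eval_C, abs_mul, abs_pow] at hx
  rw [Polynomial.eval_mul, Polynomial.eval_C, abs_mul, abs_of_pos (inv_pos.2 hkpos)]
  have h5 : (k⁻¹ * |v.eval x|) ^ q = |u.eval x| ^ p := by
    rw [mul_pow, inv_pow, hkq, hx, inv_mul_cancel_left₀ (abs_ne_zero.2 hc)]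
  have e : (((q : ℚ) / p : ℚ) : ℝ) = (q : ℝ) * (p : ℝ)⁻¹ := by push_cast; rw [div_eq_mul_inv]
  have h6 : 0 ≤ k⁻¹ * |v.eval x| := by positivity
  rw [e, Real.rpow_mul h6, Real.rpow_natCast, h5, ← Real.rpow_natCast, ← Real.rpow_mul (abs_nonneg _),
    mul_inv_cancel₀ hpR.ne', Real.rpow_one]

end

section

open Classical in
theorem few_bad (d t : ℕ) (s s' : Bool) (f g : ℝ[X]) (u v : Fin d → ℝ[X]) (P Q : MvPolynomial (Fin d) ℝ)
    (hd : 1 ≤ d) (htd : t ≤ d - 1) (hf : 0 < f.natDegree) (hg : 0 < g.natDegree)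
    (hu : ∀ i, 0 < (u i).natDegree) (hv : ∀ i, 0 < (v i).natDegree)
    (hP : ∀ a, MvPolynomial.eval a P = f.eval (pfold s Finset.univ u a))
    (hQ : ∀ a, MvPolynomial.eval a Q = g.eval (pfold s' Finset.univ v a))
    (hb : ((Finset.univ : Finset (Fin d)).filter (fun j => Nondeg (oF s 0 (u j)) (oF s' 1 (v j)))).card < t) :
    TAdditivePair d t P Q ∨ TMultiplicativePair d t P Q := by
  have hss : s = s' := by
    by_contra hss
    have : ∀ j, Nondeg (oF s 0 (u j)) (oF s' 1 (v j)) := fun j => by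
      by_contra h
      exact mixed_false s s' hss (u j) (v j) (hu j) (hv j) h
    rw [Finset.filter_true_of_mem (fun j _ => this j), Finset.card_univ, Fintype.card_fin] at hb
    omega
  subst hss
  cases s
  · left
    have hk : ∀ i, ∃ k : ℝ, ¬ Nondeg (oF false 0 (u i)) (oF false 1 (v i)) → EquivA (u i) (v i - Polynomial.C k) := by
      intro i
      by_cases h : Nondeg (oF false 0 (u i)) (oF false 1 (v i))
      · exact ⟨0, fun h' => absurd h h'⟩
      · obtain ⟨l, k, hl, hlk⟩ := good_add (u i) (v i) (hu i) (hv i) h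
        refine ⟨k, fun _ => ⟨l⁻¹, inv_ne_zero hl, fun x => ?_⟩⟩
        rw [hlk]
        simp [hl]
    choose k hk using hk
    refine ⟨f, g.comp (Polynomial.X + Polynomial.C (∑ i, k i)), u, fun i => v i - Polynomial.C (k i), hf, ?_, hu, ?_, ?_, ?_, ?_⟩
    · rw [Polynomial.natDegree_comp, Polynomial.natDegree_X_add_C, mul_one]; exact hg
    · intro i; rw [Polynomial.natDegree_sub_C]; exact hv i
    · intro a; rw [hP]; simp [pfold]
    · intro a
      rw [hQ]
      simp only [pfold, Bool.false_eq_true, if_false, Polynomial.eval_comp, Polynomial.eval_add, Polynomial.eval_sub,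
        Polynomial.eval_C, Polynomial.eval_X]
      rw [Finset.sum_sub_distrib, sub_add_cancel]
    · refine lt_of_le_of_lt ?_ hb
      rw [← Set.ncard_coe_finset]
      refine Set.ncard_le_ncard ?_ (Finset.finite_toSet _)
      intro i hi
      simp only [Finset.coe_filter, Finset.mem_univ, true_and]
      by_contra h
      exact hi (hk i h)
  · right
    have hk : ∀ i, ∃ k : ℝ, 0 < k ∧ (¬ Nondeg (oF true 0 (u i)) (oF true 1 (v i)) → EquivM (u i) (Polynomial.C k⁻¹ * v i)) := by
      intro i
      by_cases h : Nondeg (oF true 0 (u i)) (oF true 1 (v i))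
      · exact ⟨1, one_pos, fun h' => absurd h h'⟩
      · obtain ⟨k, hk, hE⟩ := good_mul (u i) (v i) (hu i) (hv i) h
        exact ⟨k, hk, fun _ => hE⟩
    choose k hk0 hk using hk
    have hprod : ∏ i, k i ≠ 0 := Finset.prod_ne_zero_iff.2 fun i _ => (hk0 i).ne'
    refine ⟨f, g.comp (Polynomial.C (∏ i, k i) * Polynomial.X), u, fun i => Polynomial.C (k i)⁻¹ * v i, hf, ?_, hu, ?_, ?_, ?_, ?_⟩
    · rw [Polynomial.natDegree_comp, Polynomial.natDegree_C_mul_X _ hprod, mul_one]; exact hg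
    · intro i; rw [Polynomial.natDegree_C_mul (inv_ne_zero (hk0 i).ne')]; exact hv i
    · intro a; rw [hP]; simp [pfold]
    · intro a
      rw [hQ]
      simp only [pfold, if_true, Polynomial.eval_comp, Polynomial.eval_mul, Polynomial.eval_C, Polynomial.eval_X]
      rw [Finset.prod_mul_distrib, ← mul_assoc, Finset.prod_inv_distrib, mul_inv_cancel₀ hprod, one_mul]
    · refine lt_of_le_of_lt ?_ hb
      rw [← Set.ncard_coe_finset]
      refine Set.ncard_le_ncard ?_ (Finset.finite_toSet _)
      intro i hi
      simp only [Finset.coe_filter, Finset.mem_univ, true_and]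
      by_contra h
      exact hi (hk i h)

/-- The bound for special pairs. -/
theorem special_bound (δ : ℕ) (hδ : 1 ≤ δ) : ∃ c : ℝ, 0 < c ∧ ∃ n0 : ℕ, 1 ≤ n0 ∧
    ∀ (d t : ℕ) (P Q : MvPolynomial (Fin d) ℝ), 1 ≤ d → t ≤ d - 1 →
      P.totalDegree ≤ δ → Q.totalDegree ≤ δ → (∀ i, 1 ≤ P.degreeOf i) → (∀ i, 1 ≤ Q.degreeOf i) →
      Special P → Special Q → ¬ TAdditivePair d t P Q → ¬ TMultiplicativePair d t P Q →
      ∀ (n : ℕ) (A : Fin d → Finset ℝ), (∀ i, (A i).card = n) → n0 ≤ n →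
        c * (n : ℝ) ^ ((3 : ℝ) - (1 / 2) ^ t) ≤
          (((Fintype.piFinset A).image (fun a => MvPolynomial.eval a P)).card : ℝ) *
          (((Fintype.piFinset A).image (fun a => MvPolynomial.eval a Q)).card : ℝ) := by
  classical
  obtain ⟨c, hc, n0, hn0, h⟩ := many_bad δ hδ
  refine ⟨c, hc, n0, hn0, ?_⟩
  intro d t P Q hd htd hP hQ hPd hQd hSP hSQ hA hM n A hAn hn
  obtain ⟨s, f, u, hf, hf', hu, hu', hs⟩ := special_form hd δ P hP hPd hSP
  obtain ⟨s', g, v, hg, hg', hv, hv', hs'⟩ := special_form hd δ Q hQ hQd hSQ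
  refine h d t s s' f g u v P Q hd htd hf hf' hg hg' hu hv hu' hv' hs hs' ?_ n A hAn hn
  by_contra hlt
  push Not at hlt
  rcases few_bad d t s s' f g u v P Q hd htd hf hg hu hv hs hs' hlt with h1 | h1
  · exact hA h1
  · exact hM h1

/-- The bound for large `n`, in squared form. -/
theorem large_bound (d t δ : ℕ) (hd : 2 ≤ d) (ht1 : 1 ≤ t) (ht2 : t ≤ d - 1) (hδ : 1 ≤ δ) :
    ∃ c : ℝ, 0 < c ∧ ∃ n0 : ℕ, 1 ≤ n0 ∧
    ∀ (P Q : MvPolynomial (Fin d) ℝ),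
      P.totalDegree ≤ δ → Q.totalDegree ≤ δ → (∀ i, 1 ≤ P.degreeOf i) → (∀ i, 1 ≤ Q.degreeOf i) →
      ¬ TAdditivePair d t P Q → ¬ TMultiplicativePair d t P Q →
      ∀ (n : ℕ) (A : Fin d → Finset ℝ), (∀ i, (A i).card = n) → n0 ≤ n →
        c * (n : ℝ) ^ ((3 : ℝ) - (1 / 2) ^ t) ≤
          (max (((Fintype.piFinset A).image (fun a => MvPolynomial.eval a P)).card : ℝ)
          (((Fintype.piFinset A).image (fun a => MvPolynomial.eval a Q)).card : ℝ)) ^ 2 := by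
  classical
  obtain ⟨c, hc, n0, hn0, hS⟩ := special_bound δ hδ
  have hprod : ∀ x y : ℝ, 0 ≤ x → 0 ≤ y → x * y ≤ (max x y) ^ 2 := by
    intro x y hx hy
    rw [pow_two]
    exact mul_le_mul (le_max_left _ _) (le_max_right _ _) hy (le_trans hx (le_max_left _ _))
  by_cases hd3 : 3 ≤ d
  · obtain ⟨C, hC, n1, hn1, h3⟩ := step1_ge3 hd3 δ hδ
    refine ⟨min c (1 / C), lt_min hc (by positivity), max n0 n1, le_trans hn0 (le_max_left _ _), ?_⟩
    intro P Q hP hQ hPd hQd hA hM n A hAn hn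
    have hnn0 : n0 ≤ n := le_trans (le_max_left _ _) hn
    have hnn1 : n1 ≤ n := le_trans (le_max_right _ _) hn
    have hn1R : (1 : ℝ) ≤ n := by
      have : 1 ≤ n := le_trans hn0 hnn0
      exact_mod_cast this
    have hR0 : (0 : ℝ) ≤ (n : ℝ) ^ ((3 : ℝ) - (1 / 2) ^ t) := Real.rpow_nonneg (by linarith) _
    set p := (((Fintype.piFinset A).image (fun a => MvPolynomial.eval a P)).card : ℝ) with hp
    set q := (((Fintype.piFinset A).image (fun a => MvPolynomial.eval a Q)).card : ℝ) with hq
    have hp0 : 0 ≤ p := by rw [hp]; positivity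
    have hq0 : 0 ≤ q := by rw [hq]; positivity
    have hcube : ∀ m : ℝ, 0 ≤ m → m ≤ max p q → (n : ℝ) ^ 3 ≤ C * m ^ 2 →
        min c (1 / C) * (n : ℝ) ^ ((3 : ℝ) - (1 / 2) ^ t) ≤ (max p q) ^ 2 := by
      intro m hm0 hm h
      have h5 : (n : ℝ) ^ ((3 : ℝ) - (1 / 2) ^ t) ≤ (n : ℝ) ^ 3 := by
        rw [← Real.rpow_natCast (n : ℝ) 3]
        apply Real.rpow_le_rpow_of_exponent_le hn1R
        have : (0 : ℝ) ≤ (1 / 2) ^ t := by positivity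
        push_cast
        linarith
      calc min c (1 / C) * (n : ℝ) ^ ((3 : ℝ) - (1 / 2) ^ t) ≤ (1 / C) * (C * m ^ 2) :=
            mul_le_mul (min_le_right _ _) (le_trans h5 h) hR0 (by positivity)
        _ = m ^ 2 := by field_simp
        _ ≤ (max p q) ^ 2 := by gcongr
    rcases h3 P hP hPd with hSP | hSP
    · rcases h3 Q hQ hQd with hSQ | hSQ
      · refine le_trans ?_ (hprod p q hp0 hq0)
        refine le_trans (mul_le_mul_of_nonneg_right (min_le_left _ _) hR0) ?_
        exact hS d t P Q (by omega) ht2 hP hQ hPd hQd hSP hSQ hA hM n A hAn hnn0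
      · exact hcube q hq0 (le_max_right _ _) (hSQ n A hAn hnn1)
    · exact hcube p hp0 (le_max_left _ _) (hSP n A hAn hnn1)
  · have hd2 : d = 2 := by omega
    subst hd2
    have ht : t = 1 := by omega
    subst ht
    obtain ⟨C, hC, n1, hn1, h2⟩ := step1_two δ hδ
    have hsC : 0 < Real.sqrt C := Real.sqrt_pos.2 hC
    refine ⟨min c (1 / Real.sqrt C), lt_min hc (by positivity), max n0 n1, le_trans hn0 (le_max_left _ _), ?_⟩
    intro P Q hP hQ hPd hQd hA hM n A hAn hn
    have hnn0 : n0 ≤ n := le_trans (le_max_left _ _) hn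
    have hnn1 : n1 ≤ n := le_trans (le_max_right _ _) hn
    have hn1R : (1 : ℝ) ≤ n := by
      have : 1 ≤ n := le_trans hn0 hnn0
      exact_mod_cast this
    have hR0 : (0 : ℝ) ≤ (n : ℝ) ^ ((3 : ℝ) - (1 / 2) ^ 1) := Real.rpow_nonneg (by linarith) _
    set p := (((Fintype.piFinset A).image (fun a => MvPolynomial.eval a P)).card : ℝ) with hp
    set q := (((Fintype.piFinset A).image (fun a => MvPolynomial.eval a Q)).card : ℝ) with hq
    have hp0 : 0 ≤ p := by rw [hp]; positivity
    have hq0 : 0 ≤ q := by rw [hq]; positivity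
    refine le_trans ?_ (hprod p q hp0 hq0)
    rcases h2 P Q hP hQ hPd hQd with ⟨hSP, hSQ⟩ | h5
    · refine le_trans (mul_le_mul_of_nonneg_right (min_le_left _ _) hR0) ?_
      exact hS 2 1 P Q (by omega) ht2 hP hQ hPd hQd hSP hSQ hA hM n A hAn hnn0
    · have h6 := h5 n A hAn hnn1
      refine le_trans (mul_le_mul_of_nonneg_right (min_le_right _ _) hR0) ?_
      rw [one_div, inv_mul_le_iff₀ hsC]
      refine le_of_sq_le_sq ?_ (by positivity)
      rw [mul_pow, Real.sq_sqrt hC.le]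
      refine le_trans (le_of_eq ?_) h6
      rw [← Real.rpow_natCast, ← Real.rpow_mul (by linarith), ← Real.rpow_natCast (n : ℝ) 5]
      congr 1
      norm_num

end

theorem stmt1 (d t δ : ℕ) (hd : 2 ≤ d) (ht1 : 1 ≤ t) (ht2 : t ≤ d - 1) :
    ∃ c : ℝ, 0 < c ∧
      ∀ P Q : MvPolynomial (Fin d) ℝ,
        P.totalDegree ≤ δ → Q.totalDegree ≤ δ →
        (∀ i : Fin d, 1 ≤ P.degreeOf i) →
        (∀ i : Fin d, 1 ≤ Q.degreeOf i) →
        ¬ TAdditivePair d t P Q →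
        ¬ TMultiplicativePair d t P Q →
        ∀ (n : ℕ) (A : Fin d → Finset ℝ), (∀ i, (A i).card = n) →
          c * (n : ℝ) ^ ((3 : ℝ) / 2 - 1 / 2 ^ (t + 1)) ≤
            max
              (((Fintype.piFinset A).image
                  (fun a => MvPolynomial.eval a P)).card : ℝ)
              (((Fintype.piFinset A).image
                  (fun a => MvPolynomial.eval a Q)).card : ℝ) := by
  obtain ⟨c, hc, n0, hn0, h⟩ := large_bound d t (max δ 1) hd ht1 ht2 (le_max_right _ _)
  have hn0R : (1 : ℝ) ≤ n0 := by exact_mod_cast hn0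
  set e : ℝ := (3 : ℝ) / 2 - 1 / 2 ^ (t + 1) with he
  have hpow : (0 : ℝ) < 1 / 2 ^ (t + 1) := by positivity
  have hpow2 : (1 : ℝ) / 2 ^ (t + 1) ≤ 1 := by
    rw [div_le_one (by positivity)]
    exact one_le_pow₀ (by norm_num)
  have he0 : 0 < e := by rw [he]; linarith
  have he2 : 2 * e = (3 : ℝ) - (1 / 2) ^ t := by
    rw [he, pow_succ, one_div_pow]
    field_simp
  have hn0e : 0 < (n0 : ℝ) ^ e := Real.rpow_pos_of_pos (by linarith) _
  refine ⟨min (Real.sqrt c) (1 / (n0 : ℝ) ^ e), lt_min (Real.sqrt_pos.2 hc) (by positivity), ?_⟩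
  intro P Q hP hQ hPd hQd hA hM n A hAn
  set p := (((Fintype.piFinset A).image (fun a => MvPolynomial.eval a P)).card : ℝ) with hp
  set q := (((Fintype.piFinset A).image (fun a => MvPolynomial.eval a Q)).card : ℝ) with hq
  have hp0 : 0 ≤ p := by rw [hp]; positivity
  have hmax0 : 0 ≤ max p q := le_trans hp0 (le_max_left _ _)
  have hne : (0 : ℝ) ≤ (n : ℝ) ^ e := Real.rpow_nonneg (by positivity) _
  by_cases hn : n0 ≤ n
  · have h1 := h P Q (le_trans hP (le_max_left _ _)) (le_trans hQ (le_max_left _ _)) hPd hQd hA hM n A hAn hn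
    refine le_trans (mul_le_mul_of_nonneg_right (min_le_left _ _) hne) ?_
    refine le_of_sq_le_sq ?_ hmax0
    rw [mul_pow, Real.sq_sqrt hc.le, ← Real.rpow_natCast, ← Real.rpow_mul (by positivity)]
    have e3 : e * ((2 : ℕ) : ℝ) = (3 : ℝ) - (1 / 2) ^ t := by rw [← he2]; push_cast; ring
    rw [e3]
    exact h1
  · rcases Nat.eq_zero_or_pos n with h0 | hpos
    · rw [h0, Nat.cast_zero, Real.zero_rpow he0.ne', mul_zero]
      exact hmax0
    · have hp1 : 1 ≤ p := by
        rw [hp]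
        have : 0 < ((Fintype.piFinset A).image (fun a => MvPolynomial.eval a P)).card := by
          rw [Finset.card_pos, Finset.image_nonempty, Fintype.piFinset_nonempty]
          intro i
          rw [← Finset.card_pos, hAn i]
          exact hpos
        exact_mod_cast this
      refine le_trans ?_ (le_trans hp1 (le_max_left _ _))
      refine le_trans (mul_le_mul_of_nonneg_right (min_le_right _ _) hne) ?_
      rw [one_div, inv_mul_le_iff₀ hn0e, mul_one]
      refine Real.rpow_le_rpow (by positivity) ?_ he0.le
      have : n ≤ n0 := by omega
      exact_mod_cast this
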